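/- Let k ∈ {4,5}. There exist an absolute constant C ≥ 1 and a natural number t such that the following holds for every n. Let G = 𝔽₂ⁿ, let f : G → 𝔻 be a function, and let α : G^k → 𝔽₂ be a multilinear form. If |E_{a₁,…,a_k,x ∈ G} Δ×_{a₁}⋯Δ×_{a_k} f(x) · (−1)^{α(a₁,…,a_k)}| ≥ c for some c > 0, then there exists a strongly symmetric multilinear form σ : G^k → 𝔽₂ such that prank(α + σ) ≤ C · exp^{(t)}(C · c^{−1}). -/

import Mathlib

open Finset

/-- `β : (Fin k → V) → ZMod 2` is a multilinear form in the variables indexed by `S`: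
it depends only on the coordinates in `S` and is additive (hence `𝔽₂`-linear) in each of
those coordinates. -/
def MultilinearOn {V : Type*} [AddCommGroup V] [Module (ZMod 2) V] (k : ℕ)
    (S : Finset (Fin k)) (β : (Fin k → V) → ZMod 2) : Prop :=
  (∀ x y : Fin k → V, (∀ i ∈ S, x i = y i) → β x = β y) ∧
  (∀ i ∈ S, ∀ (x : Fin k → V) (u v : V),
    β (Function.update x i (u + v)) = β (Function.update x i u) + β (Function.update x i v))

/-- A multilinear form in all `k` variables. -/
def IsMultilinear {V : Type*} [AddCommGroup V] [Module (ZMod 2) V] (k : ℕ)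
    (α : (Fin k → V) → ZMod 2) : Prop :=
  MultilinearOn k Finset.univ α

/-- `α`, a multilinear form in the variables indexed by `S`, admits a partition-rank
decomposition with `m` terms. -/
def PrankDecompOn {V : Type*} [AddCommGroup V] [Module (ZMod 2) V] (k : ℕ)
    (S : Finset (Fin k)) (m : ℕ) (α : (Fin k → V) → ZMod 2) : Prop :=
  ∃ (I : Fin m → Finset (Fin k)) (β γ : Fin m → ((Fin k → V) → ZMod 2)),
    (∀ i, I i ⊆ S) ∧ (∀ i, I i ≠ ∅) ∧ (∀ i, I i ≠ S) ∧
    (∀ i, MultilinearOn k (I i) (β i)) ∧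
    (∀ i, MultilinearOn k (S \ I i) (γ i)) ∧
    (∀ x, α x = ∑ i, β i x * γ i x)

/-- The partition rank of a multilinear form in the variables indexed by `S`. -/
noncomputable def prankOn {V : Type*} [AddCommGroup V] [Module (ZMod 2) V] (k : ℕ)
    (S : Finset (Fin k)) (α : (Fin k → V) → ZMod 2) : ℕ :=
  sInf {m | PrankDecompOn k S m α}

/-- The partition rank of a multilinear form in `k` variables. -/
noncomputable def prank {V : Type*} [AddCommGroup V] [Module (ZMod 2) V] (k : ℕ)
    (α : (Fin k → V) → ZMod 2) : ℕ :=
  prankOn k Finset.univ α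

/-- `α ∘ π`: the form `(x₁, …, x_k) ↦ α(x_{π⁻¹(1)}, …, x_{π⁻¹(k)})`. -/
def permForm {V : Type*} (k : ℕ) (π : Equiv.Perm (Fin k))
    (α : (Fin k → V) → ZMod 2) : (Fin k → V) → ZMod 2 :=
  fun x => α (fun i => x (π.symm i))

/-- `α` is symmetric in its first `m` variables (0-indexed: coordinates `< m`). -/
def SymmetricInFirst {V : Type*} (k m : ℕ) (α : (Fin k → V) → ZMod 2) : Prop :=
  ∀ i j : Fin k, (i : ℕ) < m → (j : ℕ) < m → permForm k (Equiv.swap i j) α = α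

/-- `α` is symmetric in all of its variables. -/
def SymmetricForm {V : Type*} (k : ℕ) (α : (Fin k → V) → ZMod 2) : Prop :=
  ∀ π : Equiv.Perm (Fin k), permForm k π α = α

/-- `σ` is strongly symmetric: it is symmetric, and the form
`(x, y₃, …, y_k) ↦ σ(x, x, y₃, …, y_k)` is also symmetric.  (Given the symmetry of `σ`,
the latter is equivalent to being allowed to swap the doubled variable with the third
variable, which is how it is stated here.) -/
def StronglySymmetric {V : Type*} (k : ℕ) (σ : (Fin k → V) → ZMod 2) : Prop :=
  SymmetricForm k σ ∧
  ∀ (u v : V) (z : Fin k → V),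
    σ (fun i => if (i : ℕ) = 0 ∨ (i : ℕ) = 1 then u else if (i : ℕ) = 2 then v else z i) =
    σ (fun i => if (i : ℕ) = 0 ∨ (i : ℕ) = 1 then v else if (i : ℕ) = 2 then u else z i)

/-- The multiplicative derivative `Δ×_a f (x) = f(x+a) ⬝ conj (f x)`. -/
def mder {G : Type*} [AddCommGroup G] (f : G → ℂ) (a : G) : G → ℂ :=
  fun x => f (x + a) * (starRingEnd ℂ) (f x)

/-- The iterated multiplicative derivative `Δ×_{a₁} ⋯ Δ×_{a_k} f`. -/
def mderIter {G : Type*} [AddCommGroup G] : (k : ℕ) → (G → ℂ) → (Fin k → G) → G → ℂ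
  | 0, f, _ => f
  | k + 1, f, a => mderIter k (mder f (a 0)) (fun i => a i.succ)

/-- `(-1)^e` for `e : 𝔽₂`. -/
def chF2 (e : ZMod 2) : ℂ := (-1 : ℂ) ^ e.val

/-! ### Tower-type bounds -/

/-- The tower function: `t`-fold iterated exponential in base two, started at `s + 1`. -/
def tow (t s : ℕ) : ℕ := (fun m => 2 ^ m)^[t] (s + 1)

lemma tow_zero (s : ℕ) : tow 0 s = s + 1 := rfl

lemma tow_succ (t s : ℕ) : tow (t + 1) s = 2 ^ tow t s := by
  simp only [tow, Function.iterate_succ_apply']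

lemma tow_mono (t : ℕ) : Monotone (tow t) := by
  induction t with
  | zero => intro a b h; simpa [tow_zero] using h
  | succ t ih =>
    intro a b h
    simp only [tow_succ]
    exact Nat.pow_le_pow_right (by norm_num) (ih h)

lemma tow_le_succ (t s : ℕ) : tow t s + 1 ≤ tow (t + 1) s := by
  rw [tow_succ]; exact Nat.lt_two_pow_self

lemma tow_mono_left {t t' : ℕ} (h : t ≤ t') (s : ℕ) : tow t s ≤ tow t' s := by
  induction h with
  | refl => exact le_rfl
  | step _ ih => exact ih.trans ((Nat.le_succ _).trans (tow_le_succ _ _))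

lemma tow_tow (t t' s : ℕ) : tow t (tow t' s) ≤ tow (t + t' + 1) s := by
  have h : tow (t + t' + 1) s = (fun m => 2 ^ m)^[t] (tow (t' + 1) s) := by
    simp only [tow, ← Function.iterate_add_apply]; rfl
  rw [h]
  have hm : ∀ t, Monotone ((fun m : ℕ => 2 ^ m)^[t]) := fun t =>
    Monotone.iterate (fun a b h => Nat.pow_le_pow_right (by norm_num) h) t
  exact hm t (tow_le_succ t' s)

/-- `F` is bounded by a tower of exponentials of bounded height. -/
@[fun_prop]
def TowerBounded (F : ℕ → ℕ) : Prop := ∃ t, ∀ s, F s ≤ tow t s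

namespace TowerBounded

lemma mono {F G : ℕ → ℕ} (hG : TowerBounded G) (h : ∀ s, F s ≤ G s) : TowerBounded F := by
  obtain ⟨t, ht⟩ := hG
  exact ⟨t, fun s => (h s).trans (ht s)⟩

@[fun_prop]
lemma id : TowerBounded (fun s => s) := ⟨0, fun s => by simp [tow_zero]⟩

@[fun_prop]
lemma const (c : ℕ) : TowerBounded (fun _ => c) := by
  refine ⟨c, fun s => ?_⟩
  induction c with
  | zero => simp
  | succ c ih => exact (Nat.succ_le_succ ih).trans (tow_le_succ c s)

@[fun_prop]
lemma comp {F G : ℕ → ℕ} (hF : TowerBounded F) (hG : TowerBounded G) :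
    TowerBounded (fun s => F (G s)) := by
  obtain ⟨t, ht⟩ := hF
  obtain ⟨t', ht'⟩ := hG
  exact ⟨t + t' + 1, fun s => (ht _).trans ((tow_mono t (ht' s)).trans (tow_tow t t' s))⟩

lemma max {F G : ℕ → ℕ} (hF : TowerBounded F) (hG : TowerBounded G) :
    TowerBounded (fun s => max (F s) (G s)) := by
  obtain ⟨t, ht⟩ := hF
  obtain ⟨t', ht'⟩ := hG
  exact ⟨Max.max t t', fun s => max_le ((ht s).trans (tow_mono_left (le_max_left _ _) s))
    ((ht' s).trans (tow_mono_left (le_max_right _ _) s))⟩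

lemma two_pow : TowerBounded (fun s => 2 ^ s) :=
  ⟨1, fun s => by
    rw [tow_succ, tow_zero]; exact Nat.pow_le_pow_right (by norm_num) (Nat.le_succ s)⟩

lemma four_pow : TowerBounded (fun s => 4 ^ s) := by
  obtain ⟨t, ht⟩ := two_pow
  have h2 : TowerBounded (fun s => 2 * s) := by
    refine ⟨2, fun s => ?_⟩
    rw [tow_succ, tow_succ, tow_zero]
    have h1 : s < 2 ^ s := Nat.lt_two_pow_self
    have h3 : 2 ^ s + 1 ≤ 2 ^ (s + 1) := by
      rw [pow_succ]; have := Nat.one_le_two_pow (n := s); omega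
    have h4 : (2 : ℕ) ^ (s + 1) ≤ 2 ^ 2 ^ (s + 1) :=
      Nat.pow_le_pow_right (by norm_num) Nat.lt_two_pow_self.le
    have h5 : 2 * s ≤ 2 ^ (s + 1) := by rw [pow_succ]; omega
    exact h5.trans h4
  have := comp two_pow h2
  simpa [pow_mul] using this

@[fun_prop]
lemma add {F G : ℕ → ℕ} (hF : TowerBounded F) (hG : TowerBounded G) :
    TowerBounded (fun s => F s + G s) := by
  refine (comp four_pow (max hF hG)).mono fun s => ?_
  set m := Max.max (F s) (G s)
  have h1 : F s ≤ m := le_max_left _ _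
  have h2 : G s ≤ m := le_max_right _ _
  have h3 : m < 2 ^ m := Nat.lt_two_pow_self
  have h4 : (4 : ℕ) ^ m = 2 ^ m * 2 ^ m := by rw [← mul_pow]; norm_num
  nlinarith

@[fun_prop]
lemma mul {F G : ℕ → ℕ} (hF : TowerBounded F) (hG : TowerBounded G) :
    TowerBounded (fun s => F s * G s) := by
  refine (comp four_pow (max hF hG)).mono fun s => ?_
  set m := Max.max (F s) (G s)
  have h1 : F s ≤ m := le_max_left _ _
  have h2 : G s ≤ m := le_max_right _ _
  have h3 : m < 2 ^ m := Nat.lt_two_pow_self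
  have h4 : (4 : ℕ) ^ m = 2 ^ m * 2 ^ m := by rw [← mul_pow]; norm_num
  rw [h4]
  exact Nat.mul_le_mul (h1.trans h3.le) (h2.trans h3.le)

@[fun_prop]
lemma pow {F G : ℕ → ℕ} (hF : TowerBounded F) (hG : TowerBounded G) :
    TowerBounded (fun s => F s ^ G s) := by
  have h := comp two_pow (mul hF hG)
  refine h.mono fun s => ?_
  calc F s ^ G s ≤ (2 ^ F s) ^ G s := Nat.pow_le_pow_left Nat.lt_two_pow_self.le _
    _ = 2 ^ (F s * G s) := (pow_mul _ _ _).symm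

end TowerBounded

section

variable {k : ℕ} {V : Type} [AddCommGroup V] [Module (ZMod 2) V]

/-- `φ` is a multilinear form in the variables indexed by `S`. -/
abbrev ML (S : Finset (Fin k)) (φ : (Fin k → V) → ZMod 2) : Prop := MultilinearOn k S φ

/-- `φ`, regarded as a form in the variables indexed by `R`, is a sum of at most `s` products of
forms in complementary nonempty sets of variables. -/
inductive PR (R : Finset (Fin k)) : ℕ → ((Fin k → V) → ZMod 2) → Prop
  | zero (s : ℕ) : PR R s 0
  | cons {s : ℕ} {I : Finset (Fin k)} {β γ φ : (Fin k → V) → ZMod 2} (hI : I ⊆ R)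
      (h0 : I.Nonempty) (h1 : (R \ I).Nonempty) (hβ : ML I β) (hγ : ML (R \ I) γ)
      (h : PR R s φ) : PR R (s + 1) (β * γ + φ)

/-- Freeze the variables indexed by `A` to the values `a`. -/
def fz (A : Finset (Fin k)) (a : Fin k → V) (φ : (Fin k → V) → ZMod 2) :
    (Fin k → V) → ZMod 2 := fun v => φ (A.piecewise a v)

lemma add_self2 {M : Type*} [AddCommGroup M] [Module (ZMod 2) M] (x : M) : x + x = 0 := by
  rw [← two_smul (ZMod 2) x]; simp [show (2 : ZMod 2) = 0 from rfl]

lemma zmod2_cases (c : ZMod 2) : c = 0 ∨ c = 1 := by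
  revert c; decide

namespace ML

variable {S T : Finset (Fin k)} {φ ψ : (Fin k → V) → ZMod 2}

lemma zero : ML S (0 : (Fin k → V) → ZMod 2) := ⟨fun _ _ _ => rfl, fun _ _ _ _ _ => by simp⟩

lemma add (h : ML S φ) (h' : ML S ψ) : ML S (φ + ψ) :=
  ⟨fun x y hxy => by simp [h.1 x y hxy, h'.1 x y hxy], fun i hi x u v => by
    simp only [Pi.add_apply, h.2 i hi, h'.2 i hi]; ring⟩

lemma smul (h : ML S φ) (c : ZMod 2) : ML S (c • φ) :=
  ⟨fun x y hxy => by simp [h.1 x y hxy], fun i hi x u v => by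
    simp only [Pi.smul_apply, h.2 i hi, smul_add]⟩

/-- The space of multilinear forms in the variables indexed by `S`. -/
def submodule (S : Finset (Fin k)) : Submodule (ZMod 2) ((Fin k → V) → ZMod 2) where
  carrier := {φ | ML S φ}
  add_mem' h h' := h.add h'
  zero_mem' := zero
  smul_mem' c _ h := smul h c

lemma sum {ι : Type*} {s : Finset ι} {f : ι → (Fin k → V) → ZMod 2}
    (h : ∀ i ∈ s, ML S (f i)) : ML S (∑ i ∈ s, f i) :=
  (submodule S).sum_mem h

lemma mul (h : ML S φ) (h' : ML T ψ) (hd : Disjoint S T) : ML (S ∪ T) (φ * ψ) := by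
  refine ⟨fun x y hxy => ?_, fun i hi x u v => ?_⟩
  · simp [h.1 x y fun i hi => hxy i (mem_union_left _ hi),
      h'.1 x y fun i hi => hxy i (mem_union_right _ hi)]
  · simp only [Pi.mul_apply]
    rcases mem_union.1 hi with hi | hi
    · have hT : i ∉ T := disjoint_left.1 hd hi
      have e : ∀ w w', ψ (Function.update x i w) = ψ (Function.update x i w') := fun w w' =>
        h'.1 _ _ fun j hj => by
          have : j ≠ i := fun h => hT (h ▸ hj)
          simp [this]
      rw [h.2 i hi, e (u + v) u, e v u]; ring
    · have hS : i ∉ S := disjoint_right.1 hd hi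
      have e : ∀ w w', φ (Function.update x i w) = φ (Function.update x i w') := fun w w' =>
        h.1 _ _ fun j hj => by
          have : j ≠ i := fun h => hS (h ▸ hj)
          simp [this]
      rw [h'.2 i hi, e (u + v) u, e v u]; ring

lemma mul' (h : ML S φ) (h' : ML T ψ) (hd : Disjoint S T) {R : Finset (Fin k)}
    (hR : S ∪ T = R) : ML R (φ * ψ) := hR ▸ h.mul h' hd

lemma congr (h : ML S φ) {x y : Fin k → V} (hxy : ∀ i ∈ S, x i = y i) : φ x = φ y := h.1 x y hxy

lemma update_notMem (h : ML S φ) {i : Fin k} (hi : i ∉ S) (x : Fin k → V) (u : V) :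
    φ (Function.update x i u) = φ x :=
  h.congr fun j hj => by
    have : j ≠ i := fun h => hi (h ▸ hj)
    simp [this]

lemma fz (h : ML T φ) (A : Finset (Fin k)) (a : Fin k → V) : ML (T \ A) (fz A a φ) := by
  refine ⟨fun x y hxy => h.congr fun i hi => ?_, fun i hi x u v => ?_⟩
  · by_cases hA : i ∈ A
    · simp [hA]
    · simp [hA, hxy i (mem_sdiff.2 ⟨hi, hA⟩)]
  · obtain ⟨hT, hA⟩ := mem_sdiff.1 hi
    have e : ∀ w, A.piecewise a (Function.update x i w)
        = Function.update (A.piecewise a x) i w := fun w =>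
      (update_piecewise_of_notMem _ _ _ hA _).symm
    simp only [_root_.fz, e]
    exact h.2 i hT _ _ _

lemma zero_apply (h : ML S φ) {i : Fin k} (hi : i ∈ S) {x : Fin k → V} (hx : x i = 0) :
    φ x = 0 := by
  have := h.2 i hi x 0 0
  rw [add_zero, ← hx, Function.update_eq_self] at this
  simpa using this

end ML

section fz

variable {A B : Finset (Fin k)} {a b : Fin k → V} {φ ψ : (Fin k → V) → ZMod 2}

@[simp] lemma fz_add : fz A a (φ + ψ) = fz A a φ + fz A a ψ := rfl
@[simp] lemma fz_mul : fz A a (φ * ψ) = fz A a φ * fz A a ψ := rfl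
@[simp] lemma fz_zero : fz A a (0 : (Fin k → V) → ZMod 2) = 0 := rfl
@[simp] lemma fz_smul (c : ZMod 2) : fz A a (c • φ) = c • fz A a φ := rfl

@[simp] lemma fz_sum {ι : Type*} (s : Finset ι) (f : ι → (Fin k → V) → ZMod 2) :
    fz A a (∑ i ∈ s, f i) = ∑ i ∈ s, fz A a (f i) := by
  ext v; simp [fz]

lemma fz_empty : fz ∅ a φ = φ := by ext v; simp [fz]

lemma fz_fz : fz B b (fz A a φ) = fz (A ∪ B) (A.piecewise a b) φ := by
  ext v
  simp only [fz]
  congr 1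
  ext i
  by_cases hA : i ∈ A <;> by_cases hB : i ∈ B <;> simp [hA, hB]

lemma fz_congr (h : ∀ i ∈ A, a i = b i) : fz A a φ = fz A b φ := by
  ext v
  simp only [fz]
  congr 1
  ext i
  by_cases hA : i ∈ A <;> simp [hA, h]

lemma ML.fz_eq_of_disjoint {S : Finset (Fin k)} (h : ML S φ) (hd : Disjoint A S) :
    _root_.fz A a φ = φ := by
  ext v
  exact h.congr fun i hi => by simp [disjoint_right.1 hd hi]

lemma ML.fz_of_subset {S : Finset (Fin k)} (h : ML S φ) (hd : S ⊆ A) (v : Fin k → V) :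
    _root_.fz A a φ v = φ a :=
  h.congr fun i hi => by simp [hd hi]

lemma ML.fz_of_subset' {S : Finset (Fin k)} (h : ML S φ) (hd : S ⊆ A) :
    _root_.fz A a φ = fun _ => φ a := funext (h.fz_of_subset hd)

end fz

namespace PR

variable {R : Finset (Fin k)} {s s' : ℕ} {φ ψ : (Fin k → V) → ZMod 2}

lemma mono (h : PR R s φ) (hs : s ≤ s') : PR R s' φ := by
  induction h generalizing s' with
  | zero => exact .zero _
  | cons hI h0 h1 hβ hγ _ ih =>
    obtain ⟨m, rfl⟩ : ∃ m, s' = m + 1 := ⟨s' - 1, by omega⟩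
    exact .cons hI h0 h1 hβ hγ (ih (by omega))

lemma add (h : PR R s φ) (h' : PR R s' ψ) : PR R (s + s') (φ + ψ) := by
  induction h with
  | zero s => simpa using h'.mono (by omega)
  | cons hI h0 h1 hβ hγ _ ih =>
    rw [Nat.add_right_comm, add_assoc (_ * _)]
    exact .cons hI h0 h1 hβ hγ ih

lemma single {I : Finset (Fin k)} {β γ : (Fin k → V) → ZMod 2} (hI : I ⊆ R)
      (h0 : I.Nonempty) (h1 : (R \ I).Nonempty) (hβ : ML I β) (hγ : ML (R \ I) γ) :
    PR R 1 (β * γ) := by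
  simpa using PR.cons hI h0 h1 hβ hγ (.zero 0)

lemma single' {I J : Finset (Fin k)} {β γ : (Fin k → V) → ZMod 2} (hI : I ∪ J = R)
      (hd : Disjoint I J) (h0 : I.Nonempty) (h1 : J.Nonempty) (hβ : ML I β) (hγ : ML J γ) :
    PR R 1 (β * γ) := by
  have : R \ I = J := by rw [← hI, union_sdiff_left, sdiff_eq_self_of_disjoint hd.symm]
  exact single (hI ▸ subset_union_left) h0 (this ▸ h1) hβ (this ▸ hγ)

lemma smul (h : PR R s φ) (c : ZMod 2) : PR R s (c • φ) := by
  rcases zmod2_cases c with rfl | rfl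
  · simpa using PR.zero s
  · simpa using h

lemma sum {ι : Type*} (t : Finset ι) {f : ι → (Fin k → V) → ZMod 2}
    (h : ∀ i ∈ t, PR R s (f i)) : PR R (t.card * s) (∑ i ∈ t, f i) := by
  classical
  induction t using Finset.induction_on with
  | empty => simpa using PR.zero _
  | insert i t hi ih =>
    rw [sum_insert hi, card_insert_of_notMem hi, add_mul, one_mul, add_comm]
    rw [add_comm]
    exact add_comm (t.card * s) s ▸ (h i (mem_insert_self _ _)).add
      (ih fun j hj => h j (mem_insert_of_mem hj))

lemma sum_fin {m : ℕ} {f : Fin m → (Fin k → V) → ZMod 2}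
    (h : ∀ i, PR R s (f i)) : PR R (m * s) (∑ i, f i) := by
  simpa using PR.sum univ fun i _ => h i

lemma ml (h : PR R s φ) : ML R φ := by
  induction h with
  | zero => exact ML.zero
  | cons hI _ _ hβ hγ _ ih =>
    exact (hβ.mul' hγ disjoint_sdiff (union_sdiff_of_subset hI)).add ih

lemma eq_zero_of_card_le_one (h : PR R s φ) (hR : R.card ≤ 1) : φ = 0 := by
  cases h with
  | zero => rfl
  | @cons s I β γ ψ hI h0 h1 =>
    exfalso
    have := card_sdiff_add_card_eq_card hI
    have := h0.card_pos
    have := h1.card_pos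
    omega

lemma prank_le {σ : (Fin k → V) → ZMod 2} (h : PR univ s σ) : prank k σ ≤ s := by
  have key : ∃ m ≤ s, PrankDecompOn k univ m σ := by
    induction h with
    | zero => exact ⟨0, Nat.zero_le _, Fin.elim0, Fin.elim0, Fin.elim0, by simp⟩
    | @cons s I β γ φ hI h0 h1 hβ hγ h ih =>
      obtain ⟨m, hm, J, b, c, hJ, hJ0, hJ1, hb, hc, hsum⟩ := ih
      refine ⟨m + 1, by omega, Fin.cons I J, Fin.cons β b, Fin.cons γ c, ?_, ?_, ?_, ?_, ?_, ?_⟩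
      · intro i; exact subset_univ _
      · intro i
        refine Fin.cases ?_ (fun i => ?_) i
        · simpa using h0.ne_empty
        · simpa using hJ0 i
      · intro i
        refine Fin.cases ?_ (fun i => ?_) i
        · rintro rfl; simp at h1
        · simpa using hJ1 i
      · intro i
        refine Fin.cases ?_ (fun i => ?_) i
        · simpa using hβ
        · simpa using hb i
      · intro i
        refine Fin.cases ?_ (fun i => ?_) i
        · simpa using hγ
        · simpa using hc i
      · intro x
        simp [Fin.sum_univ_succ, hsum x]
  obtain ⟨m, hm, hd⟩ := key
  exact (Nat.sInf_le hd).trans hm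

end PR

end

section

/-- A filtration of an abelian group, compatible with addition. -/
structure SumFiltration {W : Type*} [AddCommGroup W] (L : ℕ → W → Prop) : Prop where
  zero : L 0 0
  add : ∀ {s s' v w}, L s v → L s' w → L (s + s') (v + w)
  mono : ∀ {s s' v}, L s v → s ≤ s' → L s' v

namespace SumFiltration

variable {W : Type*} [AddCommGroup W] {L : ℕ → W → Prop} (hL : SumFiltration L)
include hL

lemma sum {ι : Type*} {t : Finset ι} {f : ι → W} {s : ℕ} (h : ∀ i ∈ t, L s (f i)) :
    L (t.card * s) (∑ i ∈ t, f i) := by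
  classical
  induction t using Finset.induction_on with
  | empty => simpa using hL.zero
  | insert i t hi ih =>
    rw [sum_insert hi, card_insert_of_notMem hi, add_mul, one_mul, add_comm (_ * _)]
    exact hL.add (h i (mem_insert_self _ _)) (ih fun j hj => h j (mem_insert_of_mem hj))

lemma sum_le {ι : Type*} {t : Finset ι} {f : ι → W} {s N : ℕ} (h : ∀ i ∈ t, L s (f i))
    (hN : t.card ≤ N) : L (N * s) (∑ i ∈ t, f i) :=
  hL.mono (hL.sum h) (Nat.mul_le_mul_right _ hN)

end SumFiltration

lemma kernel_count (N r : ℕ) (b : ℕ → Fin r → ZMod 2) :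
    2 ^ N ≤ 2 ^ r * ((range N).powerset.filter fun J => ∀ i, ∑ j ∈ J, b j i = 0).card := by
  classical
  set A := (range N).powerset
  set g : Finset ℕ → (Fin r → ZMod 2) := fun J i => ∑ j ∈ J, b j i
  set Kr := A.filter fun J => ∀ i, ∑ j ∈ J, b j i = 0
  have hsum : ∀ J J₀ i, g (symmDiff J J₀) i = g J i + g J₀ i := by
    intro J J₀ i
    have e : ∀ S ⊆ J ∪ J₀, g S i = ∑ j ∈ J ∪ J₀, if j ∈ S then b j i else 0 := by
      intro S hS
      rw [← sum_filter]
      congr 1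
      ext j
      simp only [mem_filter]
      exact ⟨fun h => ⟨hS h, h⟩, fun h => h.2⟩
    rw [e J subset_union_left, e J₀ subset_union_right, e _ symmDiff_subset_union,
      ← sum_add_distrib]
    refine sum_congr rfl fun j _ => ?_
    by_cases h1 : j ∈ J <;> by_cases h2 : j ∈ J₀ <;>
      simp [mem_symmDiff, h1, h2, add_self2]
  have hf : ∀ c : Fin r → ZMod 2, (A.filter fun J => g J = c).card ≤ Kr.card := by
    intro c
    rcases (A.filter fun J => g J = c).eq_empty_or_nonempty with h | ⟨J₀, hJ₀⟩
    · simp [h]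
    · refine card_le_card_of_injOn (fun J => symmDiff J J₀) (fun J hJ => ?_) ?_
      · simp only [coe_filter, Set.mem_ofPred_eq, mem_filter] at hJ hJ₀
        simp only [Kr, coe_filter, Set.mem_ofPred_eq, A, mem_powerset]
        refine ⟨symmDiff_subset_union.trans (union_subset (mem_powerset.1 hJ.1)
          (mem_powerset.1 hJ₀.1)), fun i => ?_⟩
        have := hsum J J₀ i
        rw [hJ.2, hJ₀.2, add_self2] at this
        exact this
      · intro J _ J' _ h
        exact symmDiff_left_injective J₀ h
  calc 2 ^ N = A.card := by simp [A]
    _ = ∑ c : Fin r → ZMod 2, (A.filter fun J => g J = c).card :=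
        card_eq_sum_card_fiberwise fun _ _ => mem_univ _
    _ ≤ ∑ c : Fin r → ZMod 2, Kr.card := sum_le_sum fun c _ => hf c
    _ = 2 ^ r * Kr.card := by simp [ZMod.card]

section FL

variable {X Y W : Type*} [AddCommGroup X] [AddCommGroup W] [Module (ZMod 2) W]
  {L : ℕ → W → Prop}

open Classical in
lemma counting_upper (hL : SumFiltration L) (N s s₀ : ℕ) (Q : ℕ → Finset ℕ → W)
    (G : ℕ → Submodule (ZMod 2) W)
    (hQ : ∀ n < N, ∀ l < n, ∀ J ⊆ range N, ∃ w ∈ G n, L s (Q l J + w))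
    (hloc : ∀ n < N, ∀ l < n, ∀ J, Q l (insert n J) = Q l J)
    (hnew : ∀ n < N, ∀ J ⊆ range n, ∀ w ∈ G n,
      ¬ L (2 * (2 * s₀ + 2 * (N * s))) (Q n (insert n J) + Q n J + w)) :
    ∀ n ≤ N, ∃ K : Finset ℕ → ℕ, (∀ J ⊆ range n, ∀ w,
      ((range n).powerset.filter fun T => L s₀ (w + ∑ l ∈ T, Q l J)).card ≤ K J) ∧
      ∑ J ∈ (range n).powerset, K J ≤ 3 ^ n := by
  intro n
  induction n with
  | zero =>
    intro _
    refine ⟨fun _ => 1, fun J _ w => ?_, by simp⟩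
    exact (card_filter_le _ _).trans (by simp)
  | succ n ih =>
    intro hn
    obtain ⟨K, hK, hsum⟩ := ih (by omega)
    set bad : Finset ℕ → Prop := fun J => ∃ w ∈ G n, L (2 * s₀ + 2 * (N * s)) (Q n J + w)
    have hnN : n < N := hn
    have hsub : ∀ {J}, J ⊆ range n → J ⊆ range N := fun h =>
      h.trans (range_subset_range.2 hnN.le)
    have hstep : ∀ J ⊆ range (n + 1), ∀ w, ((range (n + 1)).powerset.filter
        fun T => L s₀ (w + ∑ l ∈ T, Q l J)).card ≤
        (if bad J then 2 else 1) * K (J.erase n) := by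
      intro J hJ w
      have hJe : J.erase n ⊆ range n := fun j hj => by
        have h1 := mem_erase.1 hj
        have h2 := mem_range.1 (hJ h1.2)
        exact mem_range.2 (by omega)
      have hQe : ∀ T ⊆ range n, ∑ l ∈ T, Q l J = ∑ l ∈ T, Q l (J.erase n) := by
        intro T hT
        refine sum_congr rfl fun l hl => ?_
        by_cases hnJ : n ∈ J
        · rw [← hloc n hnN l (mem_range.1 (hT hl)) (J.erase n), insert_erase hnJ]
        · rw [erase_eq_of_notMem hnJ]
      have hsplit : ((range (n + 1)).powerset.filter fun T => L s₀ (w + ∑ l ∈ T, Q l J)).card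
          = ((range n).powerset.filter fun T => L s₀ (w + ∑ l ∈ T, Q l (J.erase n))).card +
            ((range n).powerset.filter
              fun T => L s₀ ((w + Q n J) + ∑ l ∈ T, Q l (J.erase n))).card := by
        simp only [card_filter]
        rw [range_add_one, sum_powerset_insert notMem_range_self]
        congr 1
        · refine sum_congr rfl fun T hT => ?_
          rw [hQe T (mem_powerset.1 hT)]
        · refine sum_congr rfl fun T hT => ?_
          rw [sum_insert fun h => notMem_range_self (mem_powerset.1 hT h),
            hQe T (mem_powerset.1 hT), add_assoc]
      rw [hsplit]
      have h1 := hK _ hJe w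
      have h2 := hK _ hJe (w + Q n J)
      by_cases hb : bad J
      · rw [if_pos hb]; omega
      · rw [if_neg hb, one_mul]
        by_cases hne : ((range n).powerset.filter
            fun T => L s₀ (w + ∑ l ∈ T, Q l (J.erase n))) = ∅
        · rw [hne]; simpa using h2
        by_cases hne' : ((range n).powerset.filter
            fun T => L s₀ ((w + Q n J) + ∑ l ∈ T, Q l (J.erase n))) = ∅
        · rw [hne']; simpa using h1
        exfalso
        obtain ⟨T₁, hT₁⟩ := nonempty_iff_ne_empty.2 hne
        obtain ⟨T₂, hT₂⟩ := nonempty_iff_ne_empty.2 hne'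
        simp only [mem_filter, mem_powerset] at hT₁ hT₂
        have key : ∀ T ⊆ range n, ∃ w ∈ G n, L (N * s) (∑ l ∈ T, Q l (J.erase n) + w) := by
          intro T hT
          have : ∀ l, ∃ w ∈ G n, l ∈ T → L s (Q l (J.erase n) + w) := by
            intro l
            by_cases hl : l ∈ T
            · obtain ⟨w, hw, h⟩ := hQ n hnN l (mem_range.1 (hT hl)) _ (hsub hJe)
              exact ⟨w, hw, fun _ => h⟩
            · exact ⟨0, zero_mem _, fun h => absurd h hl⟩
          choose f hf hf' using this
          refine ⟨∑ l ∈ T, f l, sum_mem fun l _ => hf l, ?_⟩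
          rw [← sum_add_distrib]
          refine hL.sum_le hf' ((card_le_card hT).trans ?_)
          rw [card_range]; exact hnN.le
        obtain ⟨w₁, hw₁, hl₁⟩ := key T₁ hT₁.1
        obtain ⟨w₂, hw₂, hl₂⟩ := key T₂ hT₂.1
        refine hb ⟨w₁ + w₂, add_mem hw₁ hw₂, ?_⟩
        have := hL.add (hL.add hT₁.2 hT₂.2) (hL.add hl₁ hl₂)
        have e : w + ∑ l ∈ T₁, Q l (J.erase n) + (w + Q n J + ∑ l ∈ T₂, Q l (J.erase n)) +
            (∑ l ∈ T₁, Q l (J.erase n) + w₁ + (∑ l ∈ T₂, Q l (J.erase n) + w₂)) =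
            Q n J + (w₁ + w₂) + ((w + w) + (∑ l ∈ T₁, Q l (J.erase n) +
              ∑ l ∈ T₁, Q l (J.erase n)) +
              (∑ l ∈ T₂, Q l (J.erase n) + ∑ l ∈ T₂, Q l (J.erase n))) := by abel
        rw [e] at this
        simp only [add_self2, add_zero] at this
        convert this using 1
        ring
    refine ⟨fun J => (if bad J then 2 else 1) * K (J.erase n), hstep, ?_⟩
    rw [range_add_one, sum_powerset_insert notMem_range_self, ← sum_add_distrib, pow_succ]
    refine le_trans (sum_le_sum (g := fun J => K J * 3) fun J hJ => ?_) ?_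
    · have hJn : n ∉ J := fun h => notMem_range_self (mem_powerset.1 hJ h)
      rw [erase_insert hJn, erase_eq_of_notMem hJn]
      have hnb : ¬ (bad J ∧ bad (insert n J)) := by
        rintro ⟨⟨w, hw, h⟩, ⟨w', hw', h'⟩⟩
        refine hnew n hnN J (mem_powerset.1 hJ) (w + w') (add_mem hw hw') ?_
        have := hL.add h h'
        rw [← two_mul] at this
        convert this using 1
        abel
      by_cases h1 : bad J <;> by_cases h2 : bad (insert n J)
      · exact absurd ⟨h1, h2⟩ hnb
      all_goals simp only [h1, h2, if_true, if_false]; omega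
    · rw [← sum_mul]
      exact Nat.mul_le_mul_right _ hsum

lemma greedy_exit (hL : SumFiltration L) (P : X →+ (Y → W)) (r s : ℕ)
    (B : X → Fin r → Y → ZMod 2) (Γ : X → Fin r → W)
    (h : ∀ x y, L s (P x y + ∑ i, B x i y • Γ x i)) (N : ℕ) (hN : N = 3 * (r + 1)) :
    ∃ x : Fin N → X, ∀ x' y, (∀ i j, B (x i) j y = 0) →
      ∃ w ∈ Submodule.span (ZMod 2) (Set.range fun p : Fin N × Fin r => Γ (x p.1) p.2),
        L (2 * (2 * (N * s + N * (N * s)) + 2 * (N * (N * s)))) (P x' y + w) := by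
  classical
  by_contra hcon
  push Not at hcon
  set S := 2 * (2 * (N * s + N * (N * s)) + 2 * (N * (N * s))) with hS
  set Gr : (ℕ → X) → ℕ → Submodule (ZMod 2) W := fun x n =>
    Submodule.span (ZMod 2) {g | ∃ i < n, ∃ j, g = Γ (x i) j} with hGr
  have hseq : ∀ n ≤ N, ∃ (x : ℕ → X) (y : ℕ → Y), ∀ l < n, (∀ i < l, ∀ j, B (x i) j (y l) = 0) ∧
      ∀ w ∈ Gr x l, ¬ L S (P (x l) (y l) + w) := by
    intro n
    induction n with
    | zero =>
      intro _
      obtain ⟨_, y, _⟩ := hcon fun _ => 0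
      exact ⟨fun _ => 0, fun _ => y, by simp⟩
    | succ n ih =>
      intro hn
      obtain ⟨x, y, hxy⟩ := ih (by omega)
      obtain ⟨x', y', hk, hw⟩ := hcon fun i => x i
      have hGe : ∀ l ≤ n, Gr (Function.update x n x') l = Gr x l := by
        intro l hl
        simp only [hGr]
        congr 1
        ext g
        refine exists_congr fun i => and_congr_right fun hi => ?_
        rw [Function.update_of_ne (by omega)]
      refine ⟨Function.update x n x', Function.update y n y', fun l hl => ⟨fun i hi j => ?_, ?_⟩⟩
      · rw [Function.update_of_ne (by omega : i ≠ n)]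
        rcases Nat.lt_succ_iff_lt_or_eq.1 hl with hl | rfl
        · rw [Function.update_of_ne (by omega : l ≠ n)]
          exact (hxy l hl).1 i hi j
        · rw [Function.update_self]
          exact hk ⟨i, by omega⟩ j
      · rw [hGe l (by omega)]
        rcases Nat.lt_succ_iff_lt_or_eq.1 hl with hl | rfl
        · rw [Function.update_of_ne (by omega : l ≠ n), Function.update_of_ne (by omega : l ≠ n)]
          exact (hxy l hl).2
        · rw [Function.update_self, Function.update_self]
          intro w hwG
          refine hw w (Submodule.span_mono ?_ hwG)
          rintro g ⟨i, hi, j, rfl⟩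
          exact ⟨(⟨i, by omega⟩, j), rfl⟩
  obtain ⟨x, y, hxy⟩ := hseq N le_rfl
  have hup := counting_upper hL N (N * s) (N * s + N * (N * s))
    (fun l J => ∑ j ∈ J with j ≤ l, P (x l) (y j)) (Gr x) ?_ ?_ ?_ N le_rfl
  rotate_left
  · intro n hn l hl J hJ
    refine ⟨∑ j ∈ J with j ≤ l, ∑ i, B (x l) i (y j) • Γ (x l) i, sum_mem fun j _ =>
      sum_mem fun i _ => Submodule.smul_mem _ _ (Submodule.subset_span ⟨l, hl, i, rfl⟩), ?_⟩
    rw [← sum_add_distrib]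
    refine hL.sum_le (fun j _ => h _ _) ((card_filter_le _ _).trans ?_)
    simpa using card_le_card hJ
  · intro n hn l hl J
    rw [filter_insert, if_neg (by omega)]
  · intro n hn J hJ w hw
    have hnJ : n ∉ J := fun h => notMem_range_self (hJ h)
    rw [filter_insert, if_pos le_rfl, sum_insert (by simp [hnJ]), add_assoc (P _ _), add_self2,
      add_zero]
    exact (hxy n hn).2 w hw
  obtain ⟨K, hK, hKsum⟩ := hup
  have hlow : ∀ T ∈ (range N).powerset, 2 ^ N ≤ 2 ^ r * ((range N).powerset.filter fun J =>
      L (N * s + N * (N * s)) (0 + ∑ l ∈ T, ∑ j ∈ J with j ≤ l, P (x l) (y j))).card := by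
    intro T hT
    have hT' := mem_powerset.1 hT
    refine (kernel_count N r fun j i => B (∑ l ∈ T, x l) i (y j)).trans ?_
    refine Nat.mul_le_mul_left _ (card_le_card fun J hJ => ?_)
    simp only [mem_filter, mem_powerset] at hJ ⊢
    refine ⟨hJ.1, ?_⟩
    have hJc : J.card ≤ N := by simpa using card_le_card hJ.1
    have hTc : T.card ≤ N := by simpa using card_le_card hT'
    have h1 : L (N * s) (∑ j ∈ J, (P (∑ l ∈ T, x l) (y j) +
        ∑ i, B (∑ l ∈ T, x l) i (y j) • Γ (∑ l ∈ T, x l) i)) :=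
      hL.sum_le (fun j _ => h _ _) hJc
    rw [sum_add_distrib, sum_comm (s := J) (t := univ)] at h1
    simp only [← sum_smul, hJ.2, zero_smul, sum_const_zero, add_zero, map_sum,
      Finset.sum_apply] at h1
    rw [sum_comm] at h1
    have h2 : L (N * (N * s)) (∑ l ∈ T, ∑ j ∈ J with ¬ j ≤ l, P (x l) (y j)) := by
      refine hL.sum_le (fun l hl => hL.sum_le (fun j hj => ?_) ((card_filter_le _ _).trans hJc)) hTc
      have hj' := mem_filter.1 hj
      have := h (x l) (y j)
      have hz := (hxy j (mem_range.1 (hJ.1 hj'.1))).1 l (by omega)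
      simpa [hz] using this
    have h3 := hL.add h1 h2
    convert h3 using 1
    rw [zero_add, ← sum_add_distrib]
    refine sum_congr rfl fun l _ => ?_
    rw [← sum_filter_add_sum_filter_not J (fun j => j ≤ l), add_assoc, add_self2, add_zero]
  have hcount : ∑ T ∈ (range N).powerset, ((range N).powerset.filter fun J =>
      L (N * s + N * (N * s)) (0 + ∑ l ∈ T, ∑ j ∈ J with j ≤ l, P (x l) (y j))).card ≤ 3 ^ N := by
    refine le_trans (le_of_eq ?_) ((sum_le_sum fun J hJ => hK J (mem_powerset.1 hJ) 0).trans hKsum)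
    simp only [card_filter]
    rw [sum_comm]
  have h4 : 2 ^ N * 2 ^ N ≤ 2 ^ r * 3 ^ N := by
    calc 2 ^ N * 2 ^ N = ∑ T ∈ (range N).powerset, 2 ^ N := by simp
      _ ≤ _ := sum_le_sum hlow
      _ ≤ _ := by rw [← mul_sum]; exact Nat.mul_le_mul_left _ hcount
  have h5 : (2 : ℕ) ^ N * 2 ^ N = 64 ^ (r + 1) := by
    rw [hN, ← mul_pow, pow_mul]; norm_num
  have h6 : 2 ^ r * 3 ^ N < 64 ^ (r + 1) := by
    rw [hN, pow_mul]
    calc 2 ^ r * (3 ^ 3) ^ (r + 1) < 2 ^ (r + 1) * (3 ^ 3) ^ (r + 1) :=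
          Nat.mul_lt_mul_of_pos_right (Nat.pow_lt_pow_right (by norm_num) (by omega)) (by positivity)
      _ = 54 ^ (r + 1) := by rw [← mul_pow]; norm_num
      _ ≤ 64 ^ (r + 1) := Nat.pow_le_pow_left (by norm_num) _
  omega

end FL

end

section

/-- Finitely many functions to `𝔽₂` can be recovered from their values at as many points, with
coefficients in the space that they span. -/
lemma exists_dual_points {Y : Type*} [Inhabited Y] (G : Submodule (ZMod 2) (Y → ZMod 2)) :
    ∀ (M : ℕ) (β : Fin M → Y → ZMod 2), (∀ j, β j ∈ G) →
      ∃ (ys : Fin M → Y) (C : Fin M → Y → ZMod 2), (∀ i, C i ∈ G) ∧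
        ∀ j y, β j y = ∑ i, C i y * β j (ys i) := by
  intro M
  induction M with
  | zero => exact fun β _ => ⟨Fin.elim0, Fin.elim0, fun i => i.elim0, fun j => j.elim0⟩
  | succ M ih =>
    intro β hβ
    obtain ⟨ys, C, hC, h⟩ := ih (fun j => β j.succ) fun j => hβ _
    set ρ : Y → ZMod 2 := β 0 + ∑ i, β 0 (ys i) • C i with hρ
    have hρG : ρ ∈ G := add_mem (hβ 0) (sum_mem fun i _ => G.smul_mem _ (hC i))
    have hρa : ∀ y, ρ y = β 0 y + ∑ i, C i y * β 0 (ys i) := fun y => by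
      simp [hρ, Finset.sum_apply, mul_comm]
    by_cases h0 : ∀ y, ρ y = 0
    · refine ⟨Fin.cons default ys, Fin.cons 0 C, fun i => ?_, fun j y => ?_⟩
      · refine Fin.cases ?_ (fun i => ?_) i
        · exact zero_mem _
        · exact hC i
      · rw [Fin.sum_univ_succ]
        refine Fin.cases ?_ (fun j => ?_) j
        · have := hρa y
          rw [h0 y] at this
          simpa using (CharTwo.add_eq_zero).1 this.symm
        · simpa using h j y
    · push Not at h0
      obtain ⟨y₀, hy₀⟩ := h0
      have hy₁ : ρ y₀ = 1 := (zmod2_cases _).resolve_left hy₀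
      refine ⟨Fin.cons y₀ ys, Fin.cons ρ fun i => C i + C i y₀ • ρ, fun i => ?_, fun j y => ?_⟩
      · refine Fin.cases ?_ (fun i => ?_) i
        · exact hρG
        · exact add_mem (hC i) (G.smul_mem _ hρG)
      · rw [Fin.sum_univ_succ]
        simp only [Fin.cons_zero, Fin.cons_succ, Pi.add_apply, Pi.smul_apply, smul_eq_mul, add_mul,
          sum_add_distrib]
        have e : ∀ j', ∑ i, C i y₀ * ρ y * β j' (ys i) = ρ y * ∑ i, C i y₀ * β j' (ys i) :=
          fun j' => by rw [mul_sum]; exact sum_congr rfl fun i _ => by ring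
        rw [e]
        refine Fin.cases ?_ (fun j => ?_) j
        · have h1 := hρa y
          have h2 := hρa y₀
          rw [hy₁] at h2
          have h3 : ∑ i, C i y * β 0 (ys i) = ρ y + β 0 y := by
            rw [h1, add_right_comm, add_self2, zero_add]
          have h4 : ∑ i, C i y₀ * β 0 (ys i) = 1 + β 0 y₀ := by
            rw [h2, add_right_comm, add_self2, zero_add]
          rw [h3, h4]
          linear_combination (-(ρ y) * β 0 y₀ - ρ y) * (add_self2 (1 : ZMod 2))
        · rw [← h j y, ← h j y₀]
          linear_combination (- ρ y * β j.succ y₀) * (add_self2 (1 : ZMod 2))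

variable {X Y Z W : Type*} [AddCommGroup X] [AddCommGroup W] [Module (ZMod 2) W]
  {L : ℕ → W → Prop}

lemma SumFiltration.smul (hL : SumFiltration L) {s : ℕ} {w : W} (h : L s w) (c : ZMod 2) :
    L s (c • w) := by
  rcases zmod2_cases c with rfl | rfl
  · simpa using hL.mono hL.zero (Nat.zero_le _)
  · simpa using h

lemma exists_unique_coefficients (hL : SumFiltration L) (D : Z → W) (U : Set W) :
    ∀ (M : ℕ) (γ : Fin M → W) (S : ℕ), (∀ j, γ j ∈ U) →
      (∀ z, ∃ c : Fin M → ZMod 2, L S (D z + ∑ j, c j • γ j)) →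
      ∃ M' ≤ M, ∃ (γ' : Fin M' → W) (ω : Z → Fin M' → ZMod 2), (∀ j, γ' j ∈ U) ∧
        (∀ z, L (4 ^ M * S) (D z + ∑ j, ω z j • γ' j)) ∧
        (∀ z z', D z = D z' → ω z = ω z') ∧
        (∀ z z₁ z₂, D z = D z₁ + D z₂ → ω z = ω z₁ + ω z₂) := by
  intro M
  induction M with
  | zero =>
    intro γ S hγ h
    refine ⟨0, le_rfl, γ, fun _ => Fin.elim0, hγ, fun z => ?_, fun _ _ _ => rfl, fun _ _ _ _ =>
      Subsingleton.elim _ _⟩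
    obtain ⟨c, hc⟩ := h z
    simpa using hc
  | succ M ih =>
    intro γ S hγ h
    by_cases hreg : ∀ c : Fin (M + 1) → ZMod 2, L (3 * S) (∑ j, c j • γ j) → c = 0
    · choose ω hω using h
      refine ⟨M + 1, le_rfl, γ, ω, hγ, fun z => hL.mono (hω z) (Nat.le_mul_of_pos_left _
        (by positivity)), fun z z' hz => ?_, fun z z₁ z₂ hz => ?_⟩
      · have h1 := hL.add (hω z) (hω z')
        have e : D z + ∑ j, ω z j • γ j + (D z' + ∑ j, ω z' j • γ j) =
            ∑ j, (ω z + ω z') j • γ j := by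
          simp only [Pi.add_apply, add_smul, sum_add_distrib, hz]
          rw [add_add_add_comm, add_self2, zero_add]
        rw [e] at h1
        have := hreg _ (hL.mono h1 (by omega))
        rwa [CharTwo.add_eq_zero] at this
      · have h1 := hL.add (hω z) (hL.add (hω z₁) (hω z₂))
        have e : D z + ∑ j, ω z j • γ j + (D z₁ + ∑ j, ω z₁ j • γ j +
            (D z₂ + ∑ j, ω z₂ j • γ j)) = ∑ j, (ω z + (ω z₁ + ω z₂)) j • γ j := by
          simp only [Pi.add_apply, add_smul, sum_add_distrib, hz]
          calc _ = (D z₁ + D z₁) + (D z₂ + D z₂) + (∑ j, ω z j • γ j + (∑ j, ω z₁ j • γ j +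
                ∑ j, ω z₂ j • γ j)) := by abel
            _ = _ := by rw [add_self2, add_self2, zero_add, zero_add]
        rw [e] at h1
        have := hreg _ (hL.mono h1 (by omega))
        rwa [CharTwo.add_eq_zero] at this
    · push Not at hreg
      obtain ⟨c, hc, hc0⟩ := hreg
      obtain ⟨j₀, hj₀⟩ := Function.ne_iff.1 hc0
      have hj₁ : c j₀ = 1 := (zmod2_cases _).resolve_left hj₀
      obtain ⟨M', hM', γ', ω, hγ', h1, h2, h3⟩ := ih (fun j => γ (j₀.succAbove j)) (4 * S)
        (fun j => hγ _) fun z => by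
          obtain ⟨d, hd⟩ := h z
          refine ⟨fun j => d (j₀.succAbove j) + d j₀ * c (j₀.succAbove j), ?_⟩
          have h4 := hL.add hd (hL.smul hc (d j₀))
          have e : D z + ∑ j, d j • γ j + d j₀ • ∑ j, c j • γ j = D z + ∑ j,
              (d (j₀.succAbove j) + d j₀ * c (j₀.succAbove j)) • γ (j₀.succAbove j) := by
            rw [add_assoc, smul_sum, ← sum_add_distrib, Fin.sum_univ_succAbove _ j₀]
            simp only [hj₁, one_smul, add_self2, zero_add, add_smul, mul_smul]
          rw [e] at h4
          exact hL.mono h4 (by omega)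
      refine ⟨M', by omega, γ', ω, hγ', fun z => ?_, h2, h3⟩
      have := h1 z
      rwa [← mul_assoc, ← pow_succ] at this

lemma exists_approx (hL : SumFiltration L) [Inhabited Y] (G : Submodule (ZMod 2) (Y → ZMod 2))
    (P : X →+ (Y → W)) (r s : ℕ) (B : X → Fin r → Y → ZMod 2) (Γ : X → Fin r → W)
    (hB : ∀ x i, B x i ∈ G)
    (h : ∀ x y, L s (P x y + ∑ i, B x i y • Γ x i)) (M K S : ℕ) (hM : M = 3 * (r + 1) * r)
    (hK : K = 3 * (r + 1))
    (hS : S = 2 * (2 * (K * ((M + 1) * s) + K * (K * ((M + 1) * s))) +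
      2 * (K * (K * ((M + 1) * s))))) :
    ∃ (ys : Fin M → Y) (C : Fin M → Y → ZMod 2) (γ : Fin M → W), (∀ i, C i ∈ G) ∧
      (∀ j, ∃ x i, γ j = Γ x i) ∧ ∀ x y, ∃ c : Fin M → ZMod 2,
        L S (P x y + ∑ i, C i y • P x (ys i) + ∑ j, c j • γ j) := by
  classical
  let P' : X →+ ((Fin (M + 1) → Y × ZMod 2) → W) :=
    { toFun := fun x z => ∑ i, (z i).2 • P x (z i).1
      map_zero' := by ext; simp
      map_add' := fun x x' => by ext z; simp [sum_add_distrib] }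
  obtain ⟨x, hx⟩ := greedy_exit hL P' r ((M + 1) * s)
    (fun x i z => ∑ l, (z l).2 * B x i (z l).1) Γ (fun x z => by
      have h1 : L ((M + 1) * s) (∑ l, (z l).2 • (P x (z l).1 + ∑ i, B x i (z l).1 • Γ x i)) :=
        hL.sum_le (fun l _ => hL.smul (h _ _) _) (by simp)
      convert h1 using 1
      simp only [smul_add, sum_add_distrib, smul_sum, sum_smul, mul_smul]
      congr 1
      rw [sum_comm]) K hK
  rw [← hS] at hx
  subst hK
  let e : Fin M ≃ Fin (3 * (r + 1)) × Fin r := (finCongr hM).trans finProdFinEquiv.symm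
  obtain ⟨ys, C, hC, hCe⟩ := exists_dual_points G M (fun j => B (x (e j).1) (e j).2)
    fun j => hB _ _
  refine ⟨ys, C, fun j => Γ (x (e j).1) (e j).2, hC, fun j => ⟨_, _, rfl⟩, fun x' y => ?_⟩
  obtain ⟨w, hw, hw'⟩ := hx x' (Fin.cons (y, 1) fun i => (ys i, C i y)) fun i j => by
    have := hCe (e.symm (i, j)) y
    simp only [Equiv.apply_symm_apply] at this
    rw [Fin.sum_univ_succ]
    simp only [Fin.cons_zero, Fin.cons_succ, one_mul]
    rw [this, add_self2]
  have hr : (Set.range fun p : Fin (3 * (r + 1)) × Fin r => Γ (x p.1) p.2) =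
      Set.range fun j => Γ (x (e j).1) (e j).2 := (e.surjective.range_comp _).symm
  rw [hr, Submodule.mem_span_range_iff_exists_fun] at hw
  obtain ⟨c, rfl⟩ := hw
  refine ⟨c, ?_⟩
  convert hw' using 2
  simp [P', Fin.sum_univ_succ]

/-- An additive family of elements which is approximated by few products is, up to replacing
`P x y` by a combination of `P x` at few points, uniquely a combination of few elements. -/
lemma exists_regular_approx (hL : SumFiltration L) [Inhabited Y]
    (G : Submodule (ZMod 2) (Y → ZMod 2)) (U : Set W)
    (P : X →+ (Y → W)) (r s : ℕ) (B : X → Fin r → Y → ZMod 2) (Γ : X → Fin r → W)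
    (hB : ∀ x i, B x i ∈ G) (hΓ : ∀ x i, Γ x i ∈ U)
    (h : ∀ x y, L s (P x y + ∑ i, B x i y • Γ x i)) (M K S : ℕ) (hM : M = 3 * (r + 1) * r)
    (hK : K = 3 * (r + 1))
    (hS : S = 4 ^ M * (2 * (2 * (K * ((M + 1) * s) + K * (K * ((M + 1) * s))) +
      2 * (K * (K * ((M + 1) * s)))))) :
    ∃ (ys : Fin M → Y) (C : Fin M → Y → ZMod 2), (∀ i, C i ∈ G) ∧
      ∃ M' ≤ M, ∃ (γ : Fin M' → W) (ω : X → Y → Fin M' → ZMod 2), (∀ j, γ j ∈ U) ∧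
      ∀ D : X → Y → W, (D = fun x y => P x y + ∑ i, C i y • P x (ys i)) →
      (∀ x y, L S (D x y + ∑ j, ω x y j • γ j)) ∧
      (∀ x x' y y', D x y = D x' y' → ω x y = ω x' y') ∧
      (∀ x x₁ x₂ y y₁ y₂, D x y = D x₁ y₁ + D x₂ y₂ → ω x y = ω x₁ y₁ + ω x₂ y₂) := by
  obtain ⟨ys, C, γ, hC, hγ, hc⟩ := exists_approx hL G P r s B Γ hB h M K _ hM hK rfl
  obtain ⟨M', hM', γ', ω, h0, h1, h2, h3⟩ := exists_unique_coefficients hL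
    (fun z : X × Y => P z.1 z.2 + ∑ i, C i z.2 • P z.1 (ys i)) U M γ _
    (fun j => by obtain ⟨x, i, h⟩ := hγ j; exact h ▸ hΓ x i) fun z => hc z.1 z.2
  refine ⟨ys, C, hC, M', hM', γ', fun x y => ω (x, y), h0, ?_⟩
  rintro D rfl
  refine ⟨fun x y => hS ▸ h1 (x, y), fun x x' y y' h => h2 (x, y) (x', y') h,
    fun x x₁ x₂ y y₁ y₂ h => h3 (x, y) (x₁, y₁) (x₂, y₂) h⟩

end

section

variable {k : ℕ} {V : Type} [AddCommGroup V] [Module (ZMod 2) V]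

lemma PR.sumFiltration (R : Finset (Fin k)) : SumFiltration (PR (V := V) R) :=
  ⟨PR.zero 0, PR.add, PR.mono⟩

lemma ML.fz_update_add {T A : Finset (Fin k)} {φ : (Fin k → V) → ZMod 2} (h : ML T φ) {i : Fin k}
    (hi : i ∈ T) (hA : i ∈ A) (a : Fin k → V) (u v : V) :
    _root_.fz A (Function.update a i (u + v)) φ =
      _root_.fz A (Function.update a i u) φ + _root_.fz A (Function.update a i v) φ := by
  ext x
  have e : ∀ w, A.piecewise (Function.update a i w) x = Function.update (A.piecewise a x) i w :=
    fun w => (update_piecewise_of_mem _ _ _ hA _).symm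
  simp only [_root_.fz, e, Pi.add_apply]
  exact h.2 i hi _ _ _

lemma smul_eq_const_mul (c : ZMod 2) (γ : (Fin k → V) → ZMod 2) : c • γ = (fun _ => c) * γ := by
  ext; simp

/-- Freezing the variables in `S` turns `ψ` into a form in the variables in `R` which is, up to
low partition rank, a combination of few fixed forms. -/
def Apx (S R : Finset (Fin k)) (s : ℕ) (ψ : (Fin k → V) → ZMod 2) : Prop :=
  ∃ β γ : Fin s → (Fin k → V) → ZMod 2, (∀ i, ML S (β i)) ∧ (∀ i, ML R (γ i)) ∧
    ∀ a, PR R s (fz S a ψ + ∑ i, β i a • γ i)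

namespace Apx

variable {S R : Finset (Fin k)} {s s' : ℕ} {φ ψ : (Fin k → V) → ZMod 2}

lemma of_fintype {ι : Type*} [Fintype ι] (hι : Fintype.card ι ≤ s)
    (β γ : ι → (Fin k → V) → ZMod 2) (hβ : ∀ i, ML S (β i)) (hγ : ∀ i, ML R (γ i))
    (h : ∀ a, PR R s (fz S a ψ + ∑ i, β i a • γ i)) : Apx S R s ψ := by
  obtain ⟨d, rfl⟩ := Nat.exists_eq_add_of_le hι
  let e := Fintype.equivFin ι
  refine ⟨Fin.append (fun i => β (e.symm i)) 0, Fin.append (fun i => γ (e.symm i)) 0,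
    fun i => ?_, fun i => ?_, fun a => ?_⟩
  · refine Fin.addCases (fun i => ?_) (fun i => ?_) i
    · simpa using hβ _
    · simpa using ML.zero
  · refine Fin.addCases (fun i => ?_) (fun i => ?_) i
    · simpa using hγ _
    · simpa using ML.zero
  · convert h a using 2
    rw [Fin.sum_univ_add]
    simp only [Fin.append_left, Fin.append_right, Pi.zero_apply, smul_zero, sum_const_zero,
      add_zero]
    exact e.symm.sum_comp fun i => β i a • γ i

lemma add (h : Apx S R s φ) (h' : Apx S R s' ψ) : Apx S R (s + s') (φ + ψ) := by
  obtain ⟨β, γ, hβ, hγ, h⟩ := h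
  obtain ⟨β', γ', hβ', hγ', h'⟩ := h'
  refine of_fintype (ι := Fin s ⊕ Fin s') (by simp) (Sum.elim β β') (Sum.elim γ γ')
    (by rintro (i | i) <;> simp [hβ, hβ']) (by rintro (i | i) <;> simp [hγ, hγ']) fun a => ?_
  convert (h a).add (h' a) using 1
  simp only [fz_add, Fintype.sum_sum_type, Sum.elim_inl, Sum.elim_inr]
  abel

lemma of_pr {Z : Finset (Fin k)} {u : Fin k} (hu : u ∈ Z) (h : PR Z s ψ) :
    Apx {u} (Z \ {u}) s ψ := by
  induction h with
  | zero s =>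
    refine of_fintype (V := V) (ι := Empty) (by simp) Empty.elim Empty.elim (by simp) (by simp)
      fun a => ?_
    simpa using PR.zero s
  | @cons s I β γ φ hI h0 h1 hβ hγ _ ih =>
    rw [add_comm s 1]
    refine add ?_ ih
    clear ih
    have key : ∀ I J : Finset (Fin k), ∀ β γ : (Fin k → V) → ZMod 2, I ∪ J = Z → Disjoint I J →
        J.Nonempty → ML I β → ML J γ → u ∈ I → Apx {u} (Z \ {u}) 1 (β * γ) := by
      intro I J β γ hU hd hJ hβ hγ huI
      have huJ : u ∉ J := disjoint_left.1 hd huI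
      have hfγ : ∀ a, fz {u} a γ = γ := fun a =>
        hγ.fz_eq_of_disjoint (disjoint_singleton_left.2 huJ)
      have hJu : J \ {u} = J := sdiff_eq_self_of_disjoint (disjoint_singleton_right.2 huJ)
      by_cases hIu : I = {u}
      · subst hIu
        have hZJ : Z \ {u} = J := by rw [← hU, union_sdiff_distrib, hJu]; simp
        refine of_fintype (ι := Unit) (by simp) (fun _ => β) (fun _ => γ) (fun _ => hβ)
          (fun _ => hZJ ▸ hγ) fun a => ?_
        rw [fz_mul, hfγ, hβ.fz_of_subset' subset_rfl, ← smul_eq_const_mul]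
        simpa [add_self2] using PR.zero 1
      · refine of_fintype (ι := Empty) (by simp) Empty.elim Empty.elim (by simp) (by simp)
          fun a => ?_
        rw [fz_mul, hfγ]
        simp only [univ_eq_empty, sum_empty, add_zero]
        refine PR.single' (I := I \ {u}) (J := J) ?_ (hd.mono_left sdiff_subset) ?_ hJ
          (hβ.fz _ _) hγ
        · rw [← hU, union_sdiff_distrib, hJu]
        · rw [sdiff_nonempty]
          exact fun h => hIu (Subset.antisymm h (singleton_subset_iff.2 huI))
    by_cases huI : u ∈ I
    · exact key I (Z \ I) β γ (union_sdiff_of_subset hI) disjoint_sdiff h1 hβ hγ huI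
    · rw [mul_comm]
      exact key (Z \ I) I γ β (sdiff_union_of_subset hI) sdiff_disjoint h0 hγ hβ
        (mem_sdiff.2 ⟨hu, huI⟩)

end Apx

end

section
variable {k : ℕ}

/-- If all slices of `φ` at `t` are approximated on `S`, a modification of `φ` has low partition
rank whenever the variables in `insert t S` are frozen. -/
lemma exists_modification {t : Fin k} {S T : Finset (Fin k)} (ht : t ∈ T) (hS : S ⊆ T)
    (htS : t ∉ S) : ∃ F : ℕ → ℕ, TowerBounded F ∧
      ∀ (V : Type) [AddCommGroup V] [Module (ZMod 2) V] (φ : (Fin k → V) → ZMod 2) (s : ℕ),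
      ML T φ → (∀ x, Apx S (T \ insert t S) s (fz {t} x φ)) →
      ∃ m ≤ F s, ∃ m' ≤ F s, ∃ (ys : Fin m → Fin k → V) (C : Fin m → (Fin k → V) → ZMod 2)
        (Ω γ : Fin m' → (Fin k → V) → ZMod 2), (∀ i, ML S (C i)) ∧ (∀ j, ML (insert t S) (Ω j)) ∧
        (∀ j, ML (T \ insert t S) (γ j)) ∧ ∀ a, PR (T \ insert t S) (F s)
          (fz (insert t S) a (φ + ∑ i, C i * fz S (ys i) φ + ∑ j, Ω j * γ j)) := by
  set M : ℕ → ℕ := fun s => 3 * (s + 1) * s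
  set K : ℕ → ℕ := fun s => 3 * (s + 1)
  set F : ℕ → ℕ := fun s => 4 ^ M s * (2 * (2 * (K s * ((M s + 1) * s) +
    K s * (K s * ((M s + 1) * s))) + 2 * (K s * (K s * ((M s + 1) * s)))))
  refine ⟨fun s => M s + F s, by fun_prop, ?_⟩
  intro V _ _ φ s hφ hx
  set A := insert t S with hA
  have htA : t ∈ A := mem_insert_self _ _
  have hSA : S ⊆ A := subset_insert _ _
  let P : V →+ ((Fin k → V) → (Fin k → V) → ZMod 2) := AddMonoidHom.mk'
    (fun x y => fz A (Function.update y t x) φ) fun x x' => by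
      ext1 y; exact hφ.fz_update_add ht htA y x x'
  have hx' : ∀ x : V, Apx S (T \ A) s (fz {t} (fun _ => x) φ) := fun x => hx _
  have : Inhabited (Fin k → V) := ⟨0⟩
  choose B Γ hB hΓ hBΓ using hx'
  obtain ⟨ys, C, hC, M', hM', γ, ω, hγ, hD⟩ := exists_regular_approx (PR.sumFiltration (T \ A))
    (ML.submodule S) {φ | ML (T \ A) φ} P s s B Γ hB hΓ (fun x y => by
      convert hBΓ x y using 2
      simp only [P, AddMonoidHom.mk'_apply]
      rw [fz_fz, hA, insert_eq]
      refine fz_congr fun i hi => ?_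
      by_cases hit : i = t
      · subst hit; simp
      · simp [hit]) (M s) (K s) (F s) rfl rfl rfl
  obtain ⟨h1, h2, h3⟩ := hD _ rfl
  set φ₁ := φ + ∑ i, C i * fz S (ys i) φ with hφ₁
  have hφ₁ML : ML T φ₁ := hφ.add (ML.sum fun i _ =>
    ML.mul' (hC i) (hφ.fz S (ys i)) disjoint_sdiff (union_sdiff_of_subset hS))
  have hDe : ∀ v : Fin k → V, P (v t) v + ∑ i, C i v • P (v t) (ys i) = fz A v φ₁ := by
    intro v
    simp only [hφ₁, fz_add, fz_sum, P, AddMonoidHom.mk'_apply, Function.update_eq_self, fz_mul]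
    congr 1
    refine sum_congr rfl fun i _ => ?_
    rw [ML.fz_of_subset' (hC i) hSA, ← smul_eq_const_mul, fz_fz, union_eq_right.2 hSA]
    congr 1
    refine fz_congr fun j hj => ?_
    rcases mem_insert.1 hj with rfl | hj
    · simp [htS]
    · have : j ≠ t := fun h => htS (h ▸ hj)
      simp [this, hj]
  refine ⟨M s, Nat.le_add_right _ _, M', hM'.trans (Nat.le_add_right _ _), ys, C,
    fun j v => ω (v t) v j, γ, hC, fun j => ⟨fun x y hxy => ?_, fun i hi x u v => ?_⟩, hγ,
    fun a => ?_⟩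
  · refine congrFun (h2 _ _ _ _ ?_) j
    rw [hDe, hDe]
    exact fz_congr hxy
  · rw [← Pi.add_apply (ω _ _)]
    refine congrFun (h3 _ _ _ _ _ _ ?_) j
    rw [hDe, hDe, hDe]
    exact hφ₁ML.fz_update_add (insert_subset ht hS hi) hi _ _ _
  · refine PR.mono ?_ (Nat.le_add_left _ _)
    rw [fz_add, ← hDe, fz_sum]
    convert h1 (a t) a using 2
    refine sum_congr rfl fun j _ => ?_
    rw [fz_mul, (show ML (T \ A) (γ j) from hγ j).fz_eq_of_disjoint disjoint_sdiff,
      smul_eq_const_mul]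
    congr 1
    ext v
    have e : ∀ w : Fin k → V, P (w t) w + ∑ i, C i w • P (w t) (ys i) =
        P (a t) a + ∑ i, C i a • P (a t) (ys i) → ω (w t) w j = ω (a t) a j :=
      fun w hw => congrFun (h2 _ _ _ _ hw) j
    refine e _ ?_
    rw [hDe, hDe]
    exact fz_congr fun i hi => by simp [hi]

/-- If freezing any proper subset of `S` leaves a form of low partition rank, freezing `S` leaves
a combination of few forms up to low partition rank. -/
lemma apx_of_proper_subsets (S : Finset (Fin k)) : ∀ Z : Finset (Fin k), S ⊆ Z → S.Nonempty →
    (Z \ S).Nonempty → ∃ F : ℕ → ℕ, TowerBounded F ∧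
      ∀ (V : Type) [AddCommGroup V] [Module (ZMod 2) V] (ψ : (Fin k → V) → ZMod 2) (s : ℕ),
      ML Z ψ → (∀ A ⊂ S, ∀ a, PR (Z \ A) s (fz A a ψ)) → Apx S (Z \ S) (F s) ψ := by
  induction S using Finset.induction_on with
  | empty => intro Z _ h; exact absurd h not_nonempty_empty
  | insert u S hu ih =>
    intro Z hSZ _ hZS
    have huZ : u ∈ Z := hSZ (mem_insert_self _ _)
    have hSZ' : S ⊆ Z := (subset_insert _ _).trans hSZ
    rcases S.eq_empty_or_nonempty with rfl | hS
    · refine ⟨fun s => s, by fun_prop, fun V _ _ ψ s hψ h => ?_⟩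
      have := h ∅ (by simp) 0
      rw [fz_empty, sdiff_empty] at this
      exact Apx.of_pr huZ this
    · have hZu : (Z \ {u}) \ S = Z \ insert u S := by
        rw [sdiff_sdiff_left, insert_eq]; rfl
      obtain ⟨F₁, hF₁, h₁⟩ := ih (Z \ {u}) (fun i hi => mem_sdiff.2 ⟨hSZ' hi, fun h =>
        hu (mem_singleton.1 h ▸ hi)⟩) hS (hZu ▸ hZS)
      obtain ⟨F₂, hF₂, h₂⟩ := exists_modification huZ hSZ' hu
      refine ⟨fun s => F₂ (F₁ s) + F₂ (F₁ s) * s + F₂ (F₁ s), by fun_prop,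
        fun V _ _ ψ s hψ h => ?_⟩
      obtain ⟨m, hm, m', hm', ys, C, Ω, γ, hC, hΩ, hγ, hPR⟩ := h₂ V ψ (F₁ s) hψ fun x => by
        rw [← hZu]
        refine h₁ V _ s (hψ.fz _ _) fun A hA a => ?_
        rw [fz_fz, sdiff_sdiff_left]
        refine h _ ?_ _
        change {u} ∪ A ⊂ insert u S
        rw [← insert_eq]
        exact ⟨insert_subset_insert _ hA.1, fun h' => hA.2 fun i hi => by
          have := h' (mem_insert_of_mem hi)
          exact (mem_insert.1 this).resolve_left fun hh => hu (hh ▸ hi)⟩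
      have hap : ∀ i, Apx {u} (Z \ insert u S) s (fz S (ys i) ψ) := fun i => by
        have := Apx.of_pr (u := u) (mem_sdiff.2 ⟨huZ, hu⟩) (h S (ssubset_insert hu) (ys i))
        rwa [sdiff_sdiff_left, sup_eq_union, union_comm, ← insert_eq] at this
      choose b g hb hg hbg using hap
      refine Apx.of_fintype (ι := Fin m' ⊕ (Fin m × Fin s)) ?_
        (Sum.elim Ω fun p => C p.1 * b p.1 p.2) (Sum.elim γ fun p => g p.1 p.2) ?_ ?_ fun a => ?_
      · simp only [Fintype.card_sum, Fintype.card_fin, Fintype.card_prod]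
        have := Nat.mul_le_mul_right s hm
        omega
      · rintro (j | ⟨i, l⟩)
        · exact hΩ j
        · refine (hC i).mul' (hb i l) (disjoint_singleton_right.2 hu) ?_
          rw [union_comm, ← insert_eq]
      · rintro (j | ⟨i, l⟩)
        · exact hγ j
        · exact hg i l
      · have e1 : PR (Z \ insert u S) (m * s)
            (∑ i, C i a • (fz {u} a (fz S (ys i) ψ) + ∑ l, b i l a • g i l)) :=
          PR.sum_fin fun i => (hbg i a).smul _
        have hle : F₂ (F₁ s) + m * s ≤ F₂ (F₁ s) + F₂ (F₁ s) * s + F₂ (F₁ s) := by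
          have := Nat.mul_le_mul_right s hm
          omega
        convert ((hPR a).add e1).mono hle using 1
        simp only [fz_add, fz_sum, fz_mul, Fintype.sum_sum_type, Sum.elim_inl, Sum.elim_inr,
          Fintype.sum_prod_type, smul_add, sum_add_distrib, smul_sum, Pi.mul_apply, mul_smul]
        have e2 : ∀ j, fz (insert u S) a (Ω j) * fz (insert u S) a (γ j) = Ω j a • γ j := fun j => by
          rw [(hΩ j).fz_of_subset' subset_rfl, (hγ j).fz_eq_of_disjoint disjoint_sdiff,
            smul_eq_const_mul]
        have e3 : ∀ i, fz (insert u S) a (C i) * fz (insert u S) a (fz S (ys i) ψ) =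
            C i a • fz {u} a (fz S (ys i) ψ) := fun i => by
          rw [(hC i).fz_of_subset' (subset_insert _ _), smul_eq_const_mul, fz_fz, fz_fz]
          congr 2
          ext j; simp
        simp only [e2, e3]
        set A1 := ∑ i, C i a • fz {u} a (fz S (ys i) ψ)
        calc _ = fz (insert u S) a ψ + (∑ j, Ω j a • γ j + ∑ i, ∑ l, C i a • b i l a • g i l) +
              (A1 + A1) := by rw [add_self2, add_zero]
          _ = _ := by abel

/-- If all slices of `φ` in direction `t` have low partition rank, so has `φ`. -/
theorem pr_of_slices {t : Fin k} {T : Finset (Fin k)} (ht : t ∈ T) (hT : 2 ≤ T.card) :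
    ∃ F : ℕ → ℕ, TowerBounded F ∧
      ∀ (V : Type) [AddCommGroup V] [Module (ZMod 2) V] (φ : (Fin k → V) → ZMod 2) (s : ℕ),
      ML T φ → (∀ x, PR (T \ {t}) s (fz {t} x φ)) → PR T (F s) φ := by
  obtain ⟨z, hz, hzt⟩ : ∃ z ∈ T, z ≠ t := exists_mem_ne (by omega) t
  have key : ∀ 𝓕 : Finset (Finset (Fin k)), (∀ A ∈ 𝓕, A ⊆ T \ {t, z}) →
      (∀ A ∈ 𝓕, ∀ B ⊆ A, B ∈ 𝓕) → ∅ ∈ 𝓕 → ∃ F : ℕ → ℕ, TowerBounded F ∧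
      ∀ (V : Type) [AddCommGroup V] [Module (ZMod 2) V] (φ : (Fin k → V) → ZMod 2) (s : ℕ),
      ML T φ → (∀ x, PR (T \ {t}) s (fz {t} x φ)) → ∃ φ', ML T φ' ∧ PR T (F s) (φ + φ') ∧
        ∀ A ∈ 𝓕, ∀ a, PR (T \ insert t A) (F s) (fz (insert t A) a φ') := by
    intro 𝓕
    induction 𝓕 using Finset.strongInduction with
    | H 𝓕 ih =>
      intro hsub hlow hemp
      obtain ⟨S, hS, hmax⟩ := exists_max_image 𝓕 card ⟨∅, hemp⟩
      rcases S.eq_empty_or_nonempty with rfl | hS0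
      · refine ⟨fun s => s, by fun_prop, fun V _ _ φ s hφ h => ⟨φ, hφ, ?_, fun A hA a => ?_⟩⟩
        · rw [add_self2]; exact .zero _
        · have : A = ∅ := by simpa using hmax A hA
          subst this
          exact h a
      have hST := hsub S hS
      have hSt : t ∉ S := fun h => by simpa using hST h
      have hSz : z ∉ S := fun h => by simpa using hST h
      have hSsub : S ⊆ T := hST.trans sdiff_subset
      obtain ⟨F₁, hF₁, h₁⟩ := ih (𝓕.erase S) (erase_ssubset hS)
        (fun A hA => hsub A (mem_of_mem_erase hA))
        (fun A hA B hB => mem_erase.2 ⟨fun h => (mem_erase.1 hA).1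
          (eq_of_subset_of_card_le (h ▸ hB) (hmax A (mem_of_mem_erase hA))).symm,
          hlow A (mem_of_mem_erase hA) B hB⟩)
        (mem_erase.2 ⟨hS0.ne_empty.symm, hemp⟩)
      have hzR : z ∈ T \ insert t S := by simp [hz, hzt, hSz]
      have hTt : (T \ {t}) \ S = T \ insert t S := by
        rw [sdiff_sdiff_left, insert_eq]; rfl
      obtain ⟨F₂, hF₂, h₂⟩ := apx_of_proper_subsets S (T \ {t}) (fun i hi => mem_sdiff.2
        ⟨hSsub hi, fun h => hSt (mem_singleton.1 h ▸ hi)⟩) hS0 (hTt ▸ ⟨z, hzR⟩)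
      obtain ⟨F₃, hF₃, h₃⟩ := exists_modification ht hSsub hSt
      refine ⟨fun s => F₁ s + (F₃ (F₂ (F₁ s)) + F₃ (F₂ (F₁ s))) + F₃ (F₂ (F₁ s)), by fun_prop,
        fun V _ _ φ s hφ h => ?_⟩
      obtain ⟨φ₁, hφ₁, hr₁, hl₁⟩ := h₁ V φ s hφ h
      obtain ⟨m, hm, m', hm', ys, C, Ω, γ, hC, hΩ, hγ, hPR⟩ := h₃ V φ₁ (F₂ (F₁ s)) hφ₁ fun x => by
        rw [← hTt]
        refine h₂ V _ _ (hφ₁.fz _ _) fun A hA a => ?_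
        rw [fz_fz, sdiff_sdiff_left, sup_eq_union, ← insert_eq]
        exact hl₁ A (mem_erase.2 ⟨hA.ne, hlow S hS A hA.1⟩) _
      have hCs : ∀ i, PR T 1 (C i * fz S (ys i) φ₁) := fun i =>
        PR.single hSsub hS0 ⟨z, mem_sdiff.2 ⟨hz, hSz⟩⟩ (hC i) (hφ₁.fz _ _)
      have hΩs : ∀ j, PR T 1 (Ω j * γ j) := fun j =>
        PR.single (insert_subset ht hSsub) (insert_nonempty _ _) ⟨z, hzR⟩ (hΩ j) (hγ j)
      have hsum : PR T (m + m') (∑ i, C i * fz S (ys i) φ₁ + ∑ j, Ω j * γ j) := by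
        simpa using (PR.sum_fin hCs).add (PR.sum_fin hΩs)
      refine ⟨φ₁ + ∑ i, C i * fz S (ys i) φ₁ + ∑ j, Ω j * γ j, ?_, ?_, fun A hA a => ?_⟩
      · rw [add_assoc]
        exact hφ₁.add hsum.ml
      · rw [add_assoc, ← add_assoc φ]
        exact (hr₁.add hsum).mono (by dsimp only; omega)
      · by_cases hAS : A = S
        · subst hAS
          exact (hPR a).mono (by dsimp only; omega)
        have hSA : ¬ S ⊆ A := fun h => hAS (eq_of_subset_of_card_le h (hmax A hA)).symm
        obtain ⟨y, hyS, hyA⟩ := not_subset.1 hSA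
        have hyt : y ≠ t := fun h => hSt (h ▸ hyS)
        have hAz : z ∉ A := fun h => by simpa using hsub A hA h
        have hne : (S \ insert t A).Nonempty := ⟨y, by simp [hyS, hyA, hyt]⟩
        have e1 : PR (T \ insert t A) m
            (∑ i, fz (insert t A) a (C i) * fz (insert t A) a (fz S (ys i) φ₁)) := by
          have : ∀ i, PR (T \ insert t A) 1
              (fz (insert t A) a (C i) * fz (insert t A) a (fz S (ys i) φ₁)) := fun i => by
            refine PR.single' (I := S \ insert t A) (J := (T \ S) \ insert t A) ?_ ?_ hne
              ⟨z, by simp [hz, hSz, hzt, hAz]⟩ ((hC i).fz _ _) ((hφ₁.fz _ _).fz _ _)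
            · rw [← union_sdiff_distrib, union_sdiff_of_subset hSsub]
            · exact disjoint_sdiff.mono sdiff_subset sdiff_subset
          simpa using PR.sum_fin this
        have e2 : PR (T \ insert t A) m'
            (∑ j, fz (insert t A) a (Ω j) * fz (insert t A) a (γ j)) := by
          have : ∀ j, PR (T \ insert t A) 1
              (fz (insert t A) a (Ω j) * fz (insert t A) a (γ j)) := fun j => by
            refine PR.single' (I := insert t S \ insert t A)
              (J := (T \ insert t S) \ insert t A) ?_ ?_ ?_
              ⟨z, by simp [hz, hSz, hzt, hAz]⟩ ((hΩ j).fz _ _) ((hγ j).fz _ _)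
            · rw [← union_sdiff_distrib, union_sdiff_of_subset (insert_subset ht hSsub)]
            · exact disjoint_sdiff.mono sdiff_subset sdiff_subset
            · exact hne.mono (sdiff_subset_sdiff (subset_insert _ _) subset_rfl)
          simpa using PR.sum_fin this
        have := ((hl₁ A (mem_erase.2 ⟨hAS, hA⟩) a).add e1).add e2
        simp only [fz_add, fz_sum, fz_mul]
        exact this.mono (by omega)
  obtain ⟨F, hF, h⟩ := key (T \ {t, z}).powerset (fun A hA => mem_powerset.1 hA)
    (fun A hA B hB => mem_powerset.2 (hB.trans (mem_powerset.1 hA))) (empty_mem_powerset _)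
  refine ⟨F, hF, fun V _ _ φ s hφ hs => ?_⟩
  obtain ⟨φ', hφ', hr, hl⟩ := h V φ s hφ hs
  have h0 : φ' = 0 := by
    ext v
    have := hl _ (mem_powerset_self _) v
    have hc : (T \ insert t (T \ {t, z})).card ≤ 1 := by
      refine (card_le_card (t := {z}) fun i hi => ?_).trans (by simp)
      simp only [mem_sdiff, mem_insert, mem_singleton, not_or, not_and, not_not] at hi ⊢
      exact hi.2.2 hi.1 hi.2.1
    have h2 := congrFun (this.eq_zero_of_card_le_one hc) v
    simpa [fz, Finset.piecewise_same] using h2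
  rw [h0, add_zero] at hr
  exact hr

end

section
open scoped Pointwise

variable {k : ℕ}

/-- The character `(-1) ^ e` with real values. -/
noncomputable def sgn (e : ZMod 2) : ℝ := (-1) ^ e.val

lemma sgn_zero : sgn 0 = 1 := by simp [sgn]

lemma sgn_one : sgn 1 = -1 := by simp [sgn, ZMod.val_one]

lemma sgn_add (a b : ZMod 2) : sgn (a + b) = sgn a * sgn b := by
  rcases zmod2_cases a with rfl | rfl <;> rcases zmod2_cases b with rfl | rfl <;>
    simp [sgn_zero, sgn_one, show (1 + 1 : ZMod 2) = 0 from rfl]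

lemma sgn_le_one (a : ZMod 2) : sgn a ≤ 1 := by
  rcases zmod2_cases a with rfl | rfl <;> norm_num [sgn_zero, sgn_one]

variable {V : Type} [AddCommGroup V] [Module (ZMod 2) V] [Fintype V]

lemma sum_update (l : Fin k) (g : (Fin k → V) → ℝ) :
    ∑ x : V, ∑ v, g (Function.update v l x) = Fintype.card V * ∑ v, g v := by
  rw [← Fintype.sum_prod_type' fun x v => g (Function.update v l x)]
  have e : ∑ p : V × (Fin k → V), g (Function.update p.2 l p.1) =
      ∑ p : V × (Fin k → V), g p.2 := by
    refine Fintype.sum_bijective (fun p => (p.2 l, Function.update p.2 l p.1)) ?_ _ _ fun p => rfl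
    refine Function.Involutive.bijective fun p => ?_
    simp
  rw [e, Fintype.sum_prod_type]
  simp

lemma card_le_of_bias {t : Fin k} {φ : (Fin k → V) → ZMod 2} {s : ℕ}
    (h : (Fintype.card V : ℝ) ^ k ≤ 2 ^ s * ∑ v, sgn (φ v)) [DecidableEq V] :
    Fintype.card V ≤ 2 ^ (s + 1) * #{x : V | (Fintype.card V : ℝ) ^ k ≤
      2 ^ (s + 1) * ∑ v, sgn (fz {t} (fun _ => x) φ v)} := by
  set q : ℝ := (Fintype.card V : ℝ) with hq
  set X : Finset V := {x : V | q ^ k ≤ 2 ^ (s + 1) * ∑ v, sgn (fz {t} (fun _ => x) φ v)} with hX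
  have hq0 : 0 < q := by
    have : 0 < Fintype.card V := Fintype.card_pos_iff.2 ⟨0⟩
    rw [hq]; exact_mod_cast this
  have e : ∀ (x : V) v, fz {t} (fun _ => x) φ v = φ (Function.update v t x) := fun x v => by
    simp only [fz]
    congr 1
    ext i
    by_cases hi : i = t
    · subst hi; simp
    · simp [hi]
  have h1 : ∑ x : V, ∑ v, sgn (fz {t} (fun _ => x) φ v) = q * ∑ v, sgn (φ v) := by
    simp only [e]
    exact sum_update t fun v => sgn (φ v)
  have h2 : ∀ x : V, 2 ^ (s + 1) * ∑ v, sgn (fz {t} (fun _ => x) φ v) ≤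
      q ^ k + if x ∈ X then 2 ^ (s + 1) * q ^ k else 0 := fun x => by
    split_ifs with hx
    · have : ∑ v, sgn (fz {t} (fun _ => x) φ v) ≤ ∑ v : Fin k → V, 1 :=
        sum_le_sum fun v _ => sgn_le_one _
      have h3 : ∑ v : Fin k → V, (1 : ℝ) = q ^ k := by simp [hq]
      rw [h3] at this
      have := mul_le_mul_of_nonneg_left this (show (0 : ℝ) ≤ 2 ^ (s + 1) by positivity)
      have : 0 < q ^ k := by positivity
      linarith
    · have : ¬ q ^ k ≤ 2 ^ (s + 1) * ∑ v, sgn (fz {t} (fun _ => x) φ v) := fun h =>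
        hx (by simp [hX, h])
      linarith
  have h3 := sum_le_sum fun x (_ : x ∈ univ) => h2 x
  rw [← mul_sum, h1, sum_add_distrib, sum_ite_mem, univ_inter, sum_const, sum_const, card_univ,
    nsmul_eq_mul, nsmul_eq_mul, ← hq] at h3
  have h4 : 2 * (q * q ^ k) ≤ q * q ^ k + (#X : ℝ) * (2 ^ (s + 1) * q ^ k) := by
    refine le_trans ?_ h3
    have := mul_le_mul_of_nonneg_left h hq0.le
    rw [pow_succ]
    nlinarith
  have h5 : q * q ^ k ≤ (2 ^ (s + 1) * #X : ℝ) * q ^ k := by linarith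
  have h6 := le_of_mul_le_mul_right h5 (by positivity)
  rw [hq] at h6
  exact_mod_cast h6

end

section
open scoped Pointwise
variable {k : ℕ}

lemma eq_zero_of_bias {t : Fin k} {V : Type} [AddCommGroup V] [Module (ZMod 2) V] [Fintype V]
    {φ : (Fin k → V) → ZMod 2} {s : ℕ} (hφ : ML {t} φ)
    (h : (Fintype.card V : ℝ) ^ k ≤ 2 ^ s * ∑ v, sgn (φ v)) : φ = 0 := by
  ext w
  refine (zmod2_cases (φ w)).resolve_right fun hw => ?_
  have hadd : ∀ v, φ (v + w) = φ v + φ w := fun v => by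
    have e : ∀ u : Fin k → V, φ u = φ (Function.update 0 t (u t)) := fun u =>
      hφ.1 _ _ fun i hi => by simp [mem_singleton.1 hi]
    rw [e (v + w), e v, e w]
    exact hφ.2 t (mem_singleton_self t) _ _ _
  have h1 : ∑ v, sgn (φ (v + w)) = ∑ v, sgn (φ v) :=
    Equiv.sum_comp (Equiv.addRight w) fun v => sgn (φ v)
  simp only [hadd, hw, sgn_add, sgn_one, ← sum_mul] at h1
  have h2 : ∑ v, sgn (φ v) = 0 := by linarith
  rw [h2, mul_zero] at h
  have : 0 < Fintype.card V := Fintype.card_pos_iff.2 ⟨0⟩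
  have : 0 < (Fintype.card V : ℝ) ^ k := by positivity
  linarith

/-- A multilinear form with large bias has low partition rank. -/
theorem pr_of_bias (T : Finset (Fin k)) (hT : T.Nonempty) :
    ∃ F : ℕ → ℕ, TowerBounded F ∧
      ∀ (V : Type) [AddCommGroup V] [Module (ZMod 2) V] [Fintype V] (φ : (Fin k → V) → ZMod 2)
        (s : ℕ), ML T φ → (Fintype.card V : ℝ) ^ k ≤ 2 ^ s * ∑ v, sgn (φ v) → PR T (F s) φ := by
  classical
  induction T using Finset.induction_on with
  | empty => exact absurd hT not_nonempty_empty
  | insert t T ht ih =>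
    rcases T.eq_empty_or_nonempty with rfl | hT'
    · refine ⟨fun s => s, by fun_prop, fun V _ _ _ φ s hφ h => ?_⟩
      rw [eq_zero_of_bias hφ h]
      exact .zero _
    obtain ⟨F, hF, hb⟩ := ih hT'
    have htT : t ∈ insert t T := mem_insert_self _ _
    have hTt : insert t T \ {t} = T := by
      rw [insert_sdiff_of_mem _ (mem_singleton_self t)]
      exact sdiff_eq_self_of_disjoint (disjoint_singleton_right.2 ht)
    obtain ⟨F₁, hF₁, h₁⟩ := pr_of_slices htT (by
      rw [card_insert_of_notMem ht]; have := hT'.card_pos; omega)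
    refine ⟨fun s => F₁ (4 ^ (2 ^ (s + 1)) * (F (s + 1) + F (s + 1))) + 2 ^ (s + 1), ?_,
      fun V _ _ _ φ s hφ h => ?_⟩
    · have : TowerBounded fun s => F (s + 1) := by fun_prop
      fun_prop
    let D : V → (Fin k → V) → ZMod 2 := fun x => fz {t} (fun _ => x) φ
    have hDadd : ∀ x y, D (x + y) = D x + D y := fun x y => by
      have := hφ.fz_update_add htT (mem_singleton_self t) 0 x y
      simp only [D]
      convert this using 1
      · exact fz_congr fun i hi => by simp [mem_singleton.1 hi]
      · congr 1 <;> exact fz_congr fun i hi => by simp [mem_singleton.1 hi]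
    have hDML : ∀ x, ML T (D x) := fun x => hTt ▸ hφ.fz _ _
    set X : Finset V := {x : V | (Fintype.card V : ℝ) ^ k ≤
      2 ^ (s + 1) * ∑ v, sgn (fz {t} (fun _ => x) φ v)} with hX
    have hcard : Fintype.card V ≤ 2 ^ (s + 1) * #X := card_le_of_bias h
    have hXne : X.Nonempty := by
      rw [← card_pos]
      by_contra h0
      have : 0 < Fintype.card V := Fintype.card_pos_iff.2 ⟨0⟩
      simp only [not_lt, nonpos_iff_eq_zero] at h0
      rw [h0] at hcard
      omega
    have hXPR : ∀ x ∈ X, PR T (F (s + 1)) (D x) := fun x hx =>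
      hb V _ _ (hDML x) (mem_filter.1 hx).2
    obtain ⟨A, -, hA, hcov⟩ := ruzsa_covering_add (A := univ) (B := X) (K := (2 ^ (s + 1) : ℕ))
      hXne (by
        refine le_trans ?_ (show ((Fintype.card V : ℕ) : ℝ) ≤ _ by exact_mod_cast hcard)
        exact_mod_cast card_le_univ _)
    have hA' : #A ≤ 2 ^ (s + 1) := by exact_mod_cast hA
    obtain ⟨M, hM, γ, ω, hγ, hω, hω1, hω2⟩ := exists_unique_coefficients (PR.sumFiltration T) D
      {φ | ML T φ} (#A) (fun i => D (A.equivFin.symm i)) (F (s + 1) + F (s + 1))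
      (fun i => hDML _) fun v => by
        have hv : v ∈ A + (X - X) := hcov (mem_univ v)
        obtain ⟨a, ha, d, hd, rfl⟩ := mem_add.1 hv
        obtain ⟨x, hx, y, hy, rfl⟩ := mem_sub.1 hd
        refine ⟨Pi.single (A.equivFin ⟨a, ha⟩) 1, ?_⟩
        convert (hXPR x hx).add (hXPR y hy) using 1
        rw [Finset.sum_eq_single (A.equivFin ⟨a, ha⟩)]
        · simp only [Pi.single_eq_same, one_smul, Equiv.symm_apply_apply]
          have : x - y = x + y := by rw [sub_eq_add_neg, neg_eq_of_add_eq_zero_left (add_self2 y)]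
          rw [this, hDadd, hDadd, add_comm (D a), add_assoc, add_self2, add_zero]
        · intro i _ hi
          simp [Pi.single_eq_of_ne hi]
        · simp
    have hM' : M ≤ 2 ^ (s + 1) := hM.trans hA'
    have hS : 4 ^ #A * (F (s + 1) + F (s + 1)) ≤
        4 ^ 2 ^ (s + 1) * (F (s + 1) + F (s + 1)) :=
      Nat.mul_le_mul_right _ (Nat.pow_le_pow_right (by norm_num) hA')
    have hΩML : ∀ j, ML {t} fun v => ω (v t) j := fun j => by
      refine ⟨fun x y hxy => ?_, fun i hi x u v => ?_⟩
      · simp only [hxy t (mem_singleton_self t)]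
      · obtain rfl := mem_singleton.1 hi
        simp only [Function.update_self]
        exact congrFun (hω2 _ _ _ (hDadd u v)) j
    have hsum : PR (insert t T) M (∑ j, (fun v => ω (v t) j) * γ j) := by
      have : ∀ j, PR (insert t T) 1 ((fun v => ω (v t) j) * γ j) := fun j =>
        PR.single' rfl (disjoint_singleton_left.2 ht) (singleton_nonempty t) hT' (hΩML j) (hγ j)
      simpa using PR.sum_fin this
    have hφ' := h₁ V (φ + ∑ j, (fun v => ω (v t) j) * γ j) _ (hφ.add hsum.ml) fun x => by
      rw [fz_add, fz_sum, hTt]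
      refine PR.mono ?_ hS
      convert hω (x t) using 2
      · exact fz_congr fun i hi => by simp [mem_singleton.1 hi]
      · refine sum_congr rfl fun j _ => ?_
        rw [fz_mul, (hΩML j).fz_of_subset' subset_rfl, (show ML T (γ j) from hγ j).fz_eq_of_disjoint
          (disjoint_singleton_left.2 ht), smul_eq_const_mul]
    have := (hφ'.add hsum).mono (show _ ≤ F₁ (4 ^ (2 ^ (s + 1)) * (F (s + 1) + F (s + 1))) +
      2 ^ (s + 1) from by omega)
    rwa [add_assoc, add_self2, add_zero] at this

end

section

lemma chF2_eq_sgn (e : ZMod 2) : chF2 e = (sgn e : ℂ) := by simp [chF2, sgn]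

lemma chF2_add (a b : ZMod 2) : chF2 (a + b) = chF2 a * chF2 b := by
  simp [chF2_eq_sgn, sgn_add]

lemma norm_chF2 (a : ZMod 2) : ‖chF2 a‖ = 1 := by simp [chF2]

lemma sgn_two : sgn 2 = 1 := sgn_zero

lemma chF2_mul (a b : ZMod 2) :
    chF2 (a * b) = (1 / 2) * (1 + chF2 a + chF2 b - chF2 (a + b)) := by
  rcases zmod2_cases a with rfl | rfl <;> rcases zmod2_cases b with rfl | rfl <;>
    norm_num [chF2_eq_sgn, sgn_zero, sgn_one, show (1 + 1 : ZMod 2) = 2 from rfl, sgn_two]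

variable {V : Type} [AddCommGroup V] [Module (ZMod 2) V]

lemma add_add_cancel2 (x y : V) : x + y + y = x := by rw [add_assoc, add_self2, add_zero]

/-- Iterated derivatives split along the directions moved by `h`. -/
lemma mderIter_split {k : ℕ} (J : Fin k → Prop) [DecidablePred J] (u : Fin k → V) :
    ∀ F : V → V → ℂ, (∃ A B : V → ℂ, (∀ x, ‖A x‖ = 1) ∧ (∀ x, ‖B x‖ = 1) ∧
      ∀ h x, F h x = A x * B (x + h)) → ∃ A B : V → ℂ, (∀ x, ‖A x‖ = 1) ∧ (∀ x, ‖B x‖ = 1) ∧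
      ∀ h x, mderIter k (F h) (fun i => u i + if J i then h else 0) x = A x * B (x + h) := by
  induction k with
  | zero => exact fun F hF => hF
  | succ k ih =>
    rintro F ⟨A, B, hA, hB, hF⟩
    refine ih (fun i => J i.succ) (fun i => u i.succ)
      (fun h => mder (F h) (u 0 + if J 0 then h else 0)) ?_
    by_cases h0 : J 0
    · refine ⟨fun x => starRingEnd ℂ (A x) * B (x + u 0), fun x => A (x + u 0) *
        starRingEnd ℂ (B x), fun x => by simp [hA, hB], fun x => by simp [hA, hB], fun h x => ?_⟩
      have e1 : x + (u 0 + h) + h = x + u 0 := by rw [← add_assoc, add_add_cancel2]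
      have e2 : x + (u 0 + h) = x + h + u 0 := by abel
      simp only [mder, h0, if_true, hF, map_mul, e1]
      rw [e2]; ring
    · refine ⟨fun x => A (x + u 0) * starRingEnd ℂ (A x), fun x => B (x + u 0) *
        starRingEnd ℂ (B x), fun x => by simp [hA], fun x => by simp [hB], fun h x => ?_⟩
      simp only [mder, h0, if_false, hF, map_mul, add_zero, add_right_comm x (u 0) h]
      ring

lemma mderIter_shift_mul_conj {k : ℕ} (u : Fin k → V) (h : V) : ∀ (g : V → ℂ) (x : V),
    mderIter k (fun x => g (x + h) * starRingEnd ℂ (g x)) u x =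
      mderIter k g u (x + h) * starRingEnd ℂ (mderIter k g u x) := by
  induction k with
  | zero => exact fun g x => rfl
  | succ k ih =>
    intro g x
    simp only [mderIter]
    rw [← ih]
    congr 1
    ext y
    simp only [mder, map_mul, Complex.conj_conj, add_right_comm y (u 0) h]
    ring

lemma mderIter_update {k : ℕ} (l : Fin k) (a : Fin k → V) : ∀ f : V → ℂ, ∃ G : V → ℂ,
    ∀ h x, mderIter k f (Function.update a l h) x = G (x + h) * starRingEnd ℂ (G x) := by
  induction k with
  | zero => exact l.elim0
  | succ k ih =>
    intro f
    induction l using Fin.cases with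
    | zero =>
      refine ⟨mderIter k f fun i => a i.succ, fun h x => ?_⟩
      simp only [mderIter, Function.update_self]
      rw [← mderIter_shift_mul_conj]
      congr 1
    | succ l =>
      obtain ⟨G, hG⟩ := ih l (fun i => a i.succ) (mder f (a 0))
      refine ⟨G, fun h x => ?_⟩
      rw [← hG]
      simp only [mderIter]
      congr 1
      ext i
      simp [Function.update_apply]

variable [Fintype V] {k : ℕ}

/-- The unnormalised correlation of the derivatives of `f` with `(-1) ^ θ`. -/
noncomputable def corrSum (f : V → ℂ) (θ : (Fin k → V) → ZMod 2) : ℂ :=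
  ∑ x, ∑ a : Fin k → V, mderIter k f a x * chF2 (θ a)

lemma sum_update_complex (l : Fin k) (g : (Fin k → V) → ℂ) :
    ∑ v : Fin k → V, ∑ x : V, g (Function.update v l x) = Fintype.card V * ∑ v, g v := by
  rw [sum_comm, ← Fintype.sum_prod_type' fun x v => g (Function.update v l x)]
  have e : ∑ p : V × (Fin k → V), g (Function.update p.2 l p.1) =
      ∑ p : V × (Fin k → V), g p.2 := by
    refine Fintype.sum_bijective (fun p => (p.2 l, Function.update p.2 l p.1)) ?_ _ _ fun p => rfl
    refine Function.Involutive.bijective fun p => ?_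
    simp
  rw [e, Fintype.sum_prod_type]
  simp

/-- Terms which do not depend on every variable do not matter. -/
lemma norm_corrSum_add_le (f : V → ℂ) {l : Fin k} {θ ψ : (Fin k → V) → ZMod 2}
    (hθ : ∀ a (u v : V), θ (Function.update a l (u + v)) =
      θ (Function.update a l u) + θ (Function.update a l v))
    (hψ : ∀ a (u : V), ψ (Function.update a l u) = ψ a) :
    ‖corrSum f (θ + ψ)‖ ≤ ‖corrSum f θ‖ := by
  choose G hG using fun a => mderIter_update l a f
  let r : (Fin k → V) → ℝ := fun a =>
    Complex.normSq (∑ x, G a x * chF2 (θ (Function.update a l x)))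
  have hr : ∀ a, ∑ h, ∑ x, mderIter k f (Function.update a l h) x *
      chF2 (θ (Function.update a l h)) = r a := fun a => by
    simp only [r]
    rw [← Complex.mul_conj, map_sum, sum_mul_sum, sum_comm]
    conv_rhs => rw [sum_comm]
    refine sum_congr rfl fun x _ => ?_
    rw [← Equiv.sum_comp (Equiv.addLeft x)]
    refine sum_congr rfl fun h _ => ?_
    simp only [Equiv.coe_addLeft, hG, map_mul]
    have e : starRingEnd ℂ (chF2 (θ (Function.update a l x))) =
        chF2 (θ (Function.update a l x)) := by simp [chF2_eq_sgn]
    rw [e, hθ, chF2_add]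
    rw [← add_assoc, add_self2, zero_add]
    ring
  have key : ∀ ψ : (Fin k → V) → ZMod 2, (∀ a (u : V), ψ (Function.update a l u) = ψ a) →
      Fintype.card V * corrSum f (θ + ψ) = ∑ a, chF2 (ψ a) * r a := fun ψ hψ => by
    have : corrSum f (θ + ψ) = ∑ a, ∑ x, mderIter k f a x * chF2 ((θ + ψ) a) := sum_comm
    rw [this, ← sum_update_complex l]
    refine sum_congr rfl fun a _ => ?_
    rw [← hr, mul_sum]
    refine sum_congr rfl fun h _ => ?_
    rw [mul_sum]
    refine sum_congr rfl fun x _ => ?_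
    rw [Pi.add_apply, hψ, chF2_add]
    ring
  have hr0 : ∀ a, 0 ≤ r a := fun a => Complex.normSq_nonneg _
  have h1 : ‖(Fintype.card V : ℂ) * corrSum f (θ + ψ)‖ ≤ ∑ a, r a := by
    rw [key ψ hψ]
    refine (norm_sum_le _ _).trans (sum_le_sum fun a _ => ?_)
    rw [norm_mul, norm_chF2, one_mul, Complex.norm_real, Real.norm_of_nonneg (hr0 a)]
  have h2 : ‖(Fintype.card V : ℂ) * corrSum f θ‖ = ∑ a, r a := by
    have := key 0 fun _ _ => rfl
    rw [add_zero] at this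
    have e : ∑ a, chF2 ((0 : (Fin k → V) → ZMod 2) a) * (r a : ℂ) = ((∑ a, r a : ℝ) : ℂ) := by
      simp [chF2]
    rw [this, e, Complex.norm_real, Real.norm_of_nonneg (sum_nonneg fun a _ => hr0 a)]
  rw [← h2, norm_mul, norm_mul] at h1
  have : 0 < Fintype.card V := Fintype.card_pos_iff.2 ⟨0⟩
  exact le_of_mul_le_mul_left h1 (by simpa using this)

lemma norm_corrSum_add_mul_le (f : V → ℂ) {I : Finset (Fin k)} {θ β γ : (Fin k → V) → ZMod 2}
    (hθ : ML univ θ) (h0 : I.Nonempty) (h1 : (univ \ I).Nonempty) (hβ : ML I β)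
    (hγ : ML (univ \ I) γ) : ‖corrSum f (θ + β * γ)‖ ≤ 2 * ‖corrSum f θ‖ := by
  obtain ⟨i, hi⟩ := h0
  obtain ⟨j, hj⟩ := h1
  have hb : ‖corrSum f (θ + β)‖ ≤ ‖corrSum f θ‖ :=
    norm_corrSum_add_le f (l := j) (hθ.2 j (mem_univ _))
      fun a u => hβ.update_notMem (mem_sdiff.1 hj).2 _ _
  have hc : ‖corrSum f (θ + γ)‖ ≤ ‖corrSum f θ‖ :=
    norm_corrSum_add_le f (l := i) (hθ.2 i (mem_univ _))
      fun a u => hγ.update_notMem (fun h => (mem_sdiff.1 h).2 hi) _ _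
  have hbc : ‖corrSum f (θ + β + γ)‖ ≤ ‖corrSum f (θ + β)‖ :=
    norm_corrSum_add_le f (l := i) (fun a u v => by
      simp only [Pi.add_apply, hθ.2 i (mem_univ _), hβ.2 i hi]; abel)
      fun a u => hγ.update_notMem (fun h => (mem_sdiff.1 h).2 hi) _ _
  have e : corrSum f (θ + β * γ) = (1 / 2) * (corrSum f θ + corrSum f (θ + β) +
      corrSum f (θ + γ) - corrSum f (θ + β + γ)) := by
    simp only [corrSum, ← sum_add_distrib, ← sum_sub_distrib, mul_sum]
    refine sum_congr rfl fun x _ => sum_congr rfl fun a _ => ?_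
    simp only [Pi.add_apply, Pi.mul_apply, add_assoc, chF2_add _ (_ + _), chF2_add (θ a)]
    rw [chF2_mul, chF2_add]
    ring
  rw [e, norm_mul]
  have h2 := norm_sub_le (corrSum f θ + corrSum f (θ + β) + corrSum f (θ + γ))
    (corrSum f (θ + β + γ))
  have h3 := norm_add_le (corrSum f θ + corrSum f (θ + β)) (corrSum f (θ + γ))
  have h4 := norm_add_le (corrSum f θ) (corrSum f (θ + β))
  have h5 : ‖(1 / 2 : ℂ)‖ = 1 / 2 := by norm_num
  rw [h5]
  linarith

/-- `θ` correlates with the `k`-fold derivatives of some unimodular function. -/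
def Corr (s : ℕ) (θ : (Fin k → V) → ZMod 2) : Prop :=
  ∃ f : V → ℂ, (∀ x, ‖f x‖ = 1) ∧ (Fintype.card V : ℝ) ^ (k + 1) ≤ 2 ^ s * ‖corrSum f θ‖

lemma Corr.of_pr {s m : ℕ} {θ θ' : (Fin k → V) → ZMod 2} (h : Corr s θ) (hθ : ML univ θ)
    (hm : PR univ m (θ + θ')) : Corr (s + m) θ' := by
  obtain ⟨f, hf, h⟩ := h
  refine ⟨f, hf, ?_⟩
  have key : ∀ m (φ : (Fin k → V) → ZMod 2), PR univ m φ → ∀ θ', ML univ θ' →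
      ‖corrSum f (θ' + φ)‖ ≤ 2 ^ m * ‖corrSum f θ'‖ := by
    intro m φ hφ
    induction hφ with
    | zero s =>
      intro θ' _
      rw [add_zero]
      exact le_mul_of_one_le_left (norm_nonneg _) (one_le_pow₀ (by norm_num))
    | @cons s I β γ φ hI h0 h1 hβ hγ h ih =>
      intro θ' hθ'
      rw [add_comm _ φ, ← add_assoc]
      refine (norm_corrSum_add_mul_le f (hθ'.add h.ml) h0 h1 hβ hγ).trans ?_
      rw [pow_succ]
      linarith [ih θ' hθ']
  have h1 := key m _ hm θ' (by
    have := hθ.add hm.ml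
    rwa [← add_assoc, add_self2, zero_add] at this)
  have e : θ' + (θ + θ') = θ := by rw [add_comm θ, ← add_assoc, add_self2, zero_add]
  rw [e] at h1
  refine h.trans ?_
  rw [pow_add, mul_assoc]
  exact mul_le_mul_of_nonneg_left h1 (by positivity)

lemma norm_sum_mul_sq_le {ι : Type*} (s : Finset ι) (A B : ι → ℂ) (hA : ∀ x, ‖A x‖ = 1) :
    ‖∑ x ∈ s, A x * B x‖ ^ 2 ≤ #s * ∑ x ∈ s, ‖B x‖ ^ 2 := by
  have h1 : ‖∑ x ∈ s, A x * B x‖ ≤ ∑ x ∈ s, ‖B x‖ :=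
    (norm_sum_le _ _).trans (sum_le_sum fun x _ => by rw [norm_mul, hA, one_mul])
  exact (pow_le_pow_left₀ (norm_nonneg _) h1 2).trans sq_sum_le_card_mul_sum_sq

/-- The box norm controls bilinear sums. -/
lemma box_bound (A B : V → ℂ) (c : V → ℝ) (hA : ∀ x, ‖A x‖ = 1) (hB : ∀ x, ‖B x‖ = 1) :
    ‖∑ x, ∑ h, A x * B (x + h) * c h‖ ^ 4 ≤ (Fintype.card V : ℝ) ^ 5 *
      ∑ h, ∑ s, ∑ t, c h * c (h + s) * c (h + t) * c (h + s + t) := by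
  set q : ℝ := (Fintype.card V : ℝ) with hq
  have e0 : ∑ x, ∑ h, A x * B (x + h) * c h = ∑ x, A x * ∑ y, B y * c (x + y) := by
    refine sum_congr rfl fun x _ => ?_
    rw [mul_sum, ← Equiv.sum_comp (Equiv.addLeft x)]
    refine sum_congr rfl fun h _ => ?_
    simp only [Equiv.coe_addLeft]
    rw [← add_assoc, add_self2, zero_add, mul_assoc]
  have h1 : ‖∑ x, ∑ h, A x * B (x + h) * c h‖ ^ 2 ≤ q * ∑ x, ‖∑ y, B y * c (x + y)‖ ^ 2 := by
    rw [e0]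
    exact norm_sum_mul_sq_le univ A (fun x => ∑ y, B y * c (x + y)) hA
  have e1 : ((∑ x, ‖∑ y, B y * (c (x + y) : ℂ)‖ ^ 2 : ℝ) : ℂ) =
      ∑ p : V × V, (B p.1 * starRingEnd ℂ (B p.2)) *
        ((∑ x, c (x + p.1) * c (x + p.2) : ℝ) : ℂ) := by
    push_cast
    simp only [← Complex.mul_conj', map_sum, sum_mul_sum]
    rw [sum_comm, Fintype.sum_prod_type]
    refine sum_congr rfl fun y _ => ?_
    rw [sum_comm]
    refine sum_congr rfl fun y' _ => ?_
    rw [mul_sum]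
    refine sum_congr rfl fun x _ => ?_
    simp only [map_mul, Complex.conj_ofReal]
    ring
  have h2 : (∑ x, ‖∑ y, B y * (c (x + y) : ℂ)‖ ^ 2) ^ 2 ≤
      q ^ 2 * ∑ p : V × V, (∑ x, c (x + p.1) * c (x + p.2)) ^ 2 := by
    have h3 := norm_sum_mul_sq_le univ (fun p : V × V => B p.1 * starRingEnd ℂ (B p.2))
      (fun p => ((∑ x, c (x + p.1) * c (x + p.2) : ℝ) : ℂ)) fun p => by simp [hB]
    rw [← e1, Complex.norm_real, Real.norm_eq_abs, sq_abs] at h3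
    refine h3.trans_eq ?_
    simp only [Complex.norm_real, Real.norm_eq_abs, sq_abs, card_univ, Fintype.card_prod]
    push_cast
    ring
  have e2 : ∑ p : V × V, (∑ x, c (x + p.1) * c (x + p.2)) ^ 2 =
      q * ∑ h, ∑ s, ∑ t, c h * c (h + s) * c (h + t) * c (h + s + t) := by
    calc ∑ p : V × V, (∑ x, c (x + p.1) * c (x + p.2)) ^ 2
        = ∑ y, ∑ t, ∑ x, ∑ s, c (x + y) * c (x + (y + t)) * (c (x + s + y) *
            c (x + s + (y + t))) := by
          rw [Fintype.sum_prod_type]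
          refine sum_congr rfl fun y _ => ?_
          rw [← Equiv.sum_comp (Equiv.addLeft y)]
          refine sum_congr rfl fun t _ => ?_
          rw [sq, sum_mul_sum]
          refine sum_congr rfl fun x _ => ?_
          rw [← Equiv.sum_comp (Equiv.addLeft x)]
          simp
      _ = ∑ y, ∑ h, ∑ s, ∑ t, c h * c (h + s) * c (h + t) * c (h + s + t) := by
          refine sum_congr rfl fun y _ => ?_
          rw [sum_comm, ← Equiv.sum_comp (Equiv.addRight y)]
          refine sum_congr rfl fun x _ => ?_
          rw [sum_comm]
          refine sum_congr rfl fun s _ => sum_congr rfl fun t _ => ?_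
          have f1 : x + y + y = x := add_add_cancel2 x y
          have f2 : x + y + (y + t) = x + t := by rw [← add_assoc, f1]
          have f3 : x + y + s + y = x + s := by rw [add_right_comm, f1]
          have f4 : x + y + s + (y + t) = x + s + t := by rw [← add_assoc, f3]
          simp only [Equiv.coe_addRight, f1, f2, f3, f4]
          ring
      _ = _ := by simp [hq]
  have h0 : 0 ≤ ∑ x, ‖∑ y, B y * (c (x + y) : ℂ)‖ ^ 2 := by positivity
  calc ‖∑ x, ∑ h, A x * B (x + h) * c h‖ ^ 4
      = (‖∑ x, ∑ h, A x * B (x + h) * c h‖ ^ 2) ^ 2 := by ring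
    _ ≤ (q * ∑ x, ‖∑ y, B y * (c (x + y) : ℂ)‖ ^ 2) ^ 2 := pow_le_pow_left₀ (by positivity) h1 2
    _ = q ^ 2 * (∑ x, ‖∑ y, B y * (c (x + y) : ℂ)‖ ^ 2) ^ 2 := by ring
    _ ≤ q ^ 2 * (q ^ 2 * ∑ p : V × V, (∑ x, c (x + p.1) * c (x + p.2)) ^ 2) :=
        mul_le_mul_of_nonneg_left h2 (by positivity)
    _ = _ := by rw [e2]; ring

/-- Move the variables indexed by `J` by `h`. -/
def shiftOn (J : Finset (Fin k)) (u : Fin k → V) (h : V) : Fin k → V :=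
  fun i => u i + if i ∈ J then h else 0

lemma shiftOn_shiftOn (J : Finset (Fin k)) (u : Fin k → V) (h h' : V) :
    shiftOn J (shiftOn J u h) h' = shiftOn J u (h + h') := by
  ext i
  by_cases hi : i ∈ J <;> simp [shiftOn, hi, add_assoc]

/-- A correlated form has a biased second difference along every diagonal. -/
theorem Corr.parity {s : ℕ} {θ : (Fin k → V) → ZMod 2} (h : Corr s θ) (J : Finset (Fin k)) :
    (Fintype.card V : ℝ) ^ (k + 2) ≤ 2 ^ (4 * s) * ∑ u, ∑ x, ∑ y, sgn (θ u +
      θ (shiftOn J u x) + θ (shiftOn J u y) + θ (shiftOn J u (x + y))) := by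
  obtain ⟨f, hf, h⟩ := h
  set q : ℝ := (Fintype.card V : ℝ) with hq
  have hq0 : 0 < q := by
    have : 0 < Fintype.card V := Fintype.card_pos_iff.2 ⟨0⟩
    rw [hq]; exact_mod_cast this
  have hbij : ∀ z : V, Function.Bijective fun u : Fin k → V => shiftOn J u z := fun z =>
    Function.Involutive.bijective fun u => by
      simp only [shiftOn_shiftOn, add_self2]; ext i; simp [shiftOn]
  set E : (Fin k → V) → ℂ := fun u => ∑ x, ∑ z, mderIter k f (shiftOn J u z) x *
    chF2 (θ (shiftOn J u z)) with hE
  have h1 : q * ‖corrSum f θ‖ ≤ ∑ u, ‖E u‖ := by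
    have : (Fintype.card V : ℂ) * corrSum f θ = ∑ u, E u := by
      simp only [hE]
      rw [sum_comm, corrSum, mul_sum]
      refine sum_congr rfl fun x _ => ?_
      rw [sum_comm]
      have : ∀ z : V, ∑ u, mderIter k f (shiftOn J u z) x * chF2 (θ (shiftOn J u z)) =
          ∑ a, mderIter k f a x * chF2 (θ a) := fun z =>
        Function.Bijective.sum_comp (hbij z) fun a => mderIter k f a x * chF2 (θ a)
      simp [this]
    have h2 : q * ‖corrSum f θ‖ = ‖∑ u, E u‖ := by rw [← this, norm_mul]; simp [hq]
    rw [h2]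
    exact norm_sum_le _ _
  have h2 : ∀ u, ‖E u‖ ^ 4 ≤ q ^ 5 * ∑ z, ∑ x, ∑ y, sgn (θ (shiftOn J u z) +
      θ (shiftOn J (shiftOn J u z) x) + θ (shiftOn J (shiftOn J u z) y) +
      θ (shiftOn J (shiftOn J u z) (x + y))) := fun u => by
    obtain ⟨A, B, hA, hB, hAB⟩ := mderIter_split (· ∈ J) u (fun _ => f)
      ⟨f, 1, hf, by simp, by simp⟩
    have := box_bound A B (fun z => sgn (θ (shiftOn J u z))) hA hB
    simp only [← hAB, ← chF2_eq_sgn] at this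
    refine this.trans_eq ?_
    simp only [shiftOn_shiftOn, sgn_add, add_assoc, mul_assoc, hq]
  have h3 : (q * ‖corrSum f θ‖) ^ 4 ≤ (q ^ k) ^ 3 * ∑ u, ‖E u‖ ^ 4 := by
    refine (pow_le_pow_left₀ (by positivity) h1 4).trans ?_
    have a1 := sq_sum_le_card_mul_sum_sq (s := univ) (f := fun u => ‖E u‖)
    have a2 := sq_sum_le_card_mul_sum_sq (s := univ) (f := fun u => ‖E u‖ ^ 2)
    have hc : ((#(univ : Finset (Fin k → V)) : ℕ) : ℝ) = q ^ k := by simp [hq]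
    rw [hc] at a1 a2
    calc (∑ u, ‖E u‖) ^ 4 = ((∑ u, ‖E u‖) ^ 2) ^ 2 := by ring
      _ ≤ (q ^ k * ∑ u, ‖E u‖ ^ 2) ^ 2 := pow_le_pow_left₀ (by positivity) a1 2
      _ = (q ^ k) ^ 2 * (∑ u, ‖E u‖ ^ 2) ^ 2 := by ring
      _ ≤ (q ^ k) ^ 2 * (q ^ k * ∑ u, (‖E u‖ ^ 2) ^ 2) :=
        mul_le_mul_of_nonneg_left a2 (by positivity)
      _ = _ := by simp only [← pow_mul]; ring
  have h4 : ∑ u, ‖E u‖ ^ 4 ≤ q ^ 5 * (q * ∑ u, ∑ x, ∑ y, sgn (θ u +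
      θ (shiftOn J u x) + θ (shiftOn J u y) + θ (shiftOn J u (x + y)))) := by
    refine (sum_le_sum fun u _ => h2 u).trans_eq ?_
    rw [← mul_sum, sum_comm]
    congr 1
    have : ∀ z : V, ∑ u, ∑ x, ∑ y, sgn (θ (shiftOn J u z) +
        θ (shiftOn J (shiftOn J u z) x) + θ (shiftOn J (shiftOn J u z) y) +
        θ (shiftOn J (shiftOn J u z) (x + y))) = ∑ u, ∑ x, ∑ y, sgn (θ u +
        θ (shiftOn J u x) + θ (shiftOn J u y) + θ (shiftOn J u (x + y))) := fun z =>
      Function.Bijective.sum_comp (hbij z) fun u => ∑ x, ∑ y, sgn (θ u +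
        θ (shiftOn J u x) + θ (shiftOn J u y) + θ (shiftOn J u (x + y)))
    simp [this, hq]
  set Sg := ∑ u, ∑ x, ∑ y, sgn (θ u +
      θ (shiftOn J u x) + θ (shiftOn J u y) + θ (shiftOn J u (x + y))) with hSg
  have h5 : (q * q ^ (k + 1)) ^ 4 ≤ 2 ^ (4 * s) * ((q ^ k) ^ 3 * (q ^ 5 * (q * Sg))) := by
    calc (q * q ^ (k + 1)) ^ 4 ≤ (q * (2 ^ s * ‖corrSum f θ‖)) ^ 4 :=
          pow_le_pow_left₀ (by positivity) (mul_le_mul_of_nonneg_left h hq0.le) 4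
      _ = 2 ^ (4 * s) * (q * ‖corrSum f θ‖) ^ 4 := by rw [mul_comm 4 s, pow_mul]; ring
      _ ≤ 2 ^ (4 * s) * ((q ^ k) ^ 3 * (q ^ 5 * (q * Sg))) :=
          mul_le_mul_of_nonneg_left (h3.trans (mul_le_mul_of_nonneg_left h4 (by positivity)))
            (by positivity)
  have h6 : ((q ^ k) ^ 3 * q ^ 6) * q ^ (k + 2) ≤
      ((q ^ k) ^ 3 * q ^ 6) * (2 ^ (4 * s) * Sg) := by
    calc _ = (q * q ^ (k + 1)) ^ 4 := by simp only [pow_succ, pow_zero]; ring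
      _ ≤ _ := h5
      _ = _ := by ring
  exact le_of_mul_le_mul_left h6 (by positivity)

end

section

variable {k : ℕ} {V : Type} [AddCommGroup V] [Module (ZMod 2) V]

/-- Reindex the variables of a form. -/
def ri (f : Fin k → Fin k) (φ : (Fin k → V) → ZMod 2) : (Fin k → V) → ZMod 2 :=
  fun x => φ fun i => x (f i)

/-- Pull back a form along a linear map. -/
def pb (π : V →ₗ[ZMod 2] V) (φ : (Fin k → V) → ZMod 2) : (Fin k → V) → ZMod 2 :=
  fun x => φ fun i => π (x i)

/-- `π` is the identity up to a map of rank at most `M`. -/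
def Codim (M : ℕ) (π : V →ₗ[ZMod 2] V) : Prop :=
  ∃ (l : Fin M → V →ₗ[ZMod 2] ZMod 2) (c : Fin M → V), ∀ x, x + π x = ∑ i, l i x • c i

section basic
variable {f : Fin k → Fin k} {π : V →ₗ[ZMod 2] V} {φ ψ : (Fin k → V) → ZMod 2}
  {T R P : Finset (Fin k)} {s M M' : ℕ}

@[simp] lemma ri_add : ri f (φ + ψ) = ri f φ + ri f ψ := rfl
@[simp] lemma ri_mul : ri f (φ * ψ) = ri f φ * ri f ψ := rfl
@[simp] lemma ri_zero : ri f (0 : (Fin k → V) → ZMod 2) = 0 := rfl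
@[simp] lemma ri_sum {ι : Type*} (s : Finset ι) (g : ι → (Fin k → V) → ZMod 2) :
    ri f (∑ i ∈ s, g i) = ∑ i ∈ s, ri f (g i) := by ext; simp [ri]
@[simp] lemma pb_add : pb π (φ + ψ) = pb π φ + pb π ψ := rfl
@[simp] lemma pb_mul : pb π (φ * ψ) = pb π φ * pb π ψ := rfl
@[simp] lemma pb_zero : pb π (0 : (Fin k → V) → ZMod 2) = 0 := rfl
@[simp] lemma pb_sum {ι : Type*} (s : Finset ι) (g : ι → (Fin k → V) → ZMod 2) :
    pb π (∑ i ∈ s, g i) = ∑ i ∈ s, pb π (g i) := by ext; simp [pb]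
lemma pb_ri : pb π (ri f φ) = ri f (pb π φ) := rfl
lemma pb_pb (π' : V →ₗ[ZMod 2] V) : pb π' (pb π φ) = pb (π ∘ₗ π') φ := rfl

lemma ML.ri (h : ML T φ) (hf : f.Injective) : ML (T.image f) (ri f φ) := by
  refine ⟨fun x y hxy => h.1 _ _ fun i hi => hxy _ (mem_image_of_mem f hi), fun i hi x u v => ?_⟩
  obtain ⟨j, hj, rfl⟩ := mem_image.1 hi
  have e : ∀ w, (fun i => Function.update x (f j) w (f i)) = Function.update (fun i => x (f i)) j w :=
    fun w => by
      ext i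
      by_cases hij : i = j
      · subst hij; simp
      · simp [hij, hf.ne hij]
  simp only [_root_.ri, e]
  exact h.2 j hj _ _ _

lemma ML.ri_univ (h : ML univ φ) (hf : f.Bijective) : ML univ (_root_.ri f φ) := by
  have := h.ri hf.1
  rwa [image_univ_of_surjective hf.2] at this

lemma ML.pb (h : ML T φ) (π : V →ₗ[ZMod 2] V) : ML T (pb π φ) := by
  refine ⟨fun x y hxy => h.1 _ _ fun i hi => by rw [hxy i hi], fun i hi x u v => ?_⟩
  have e : ∀ w, (fun j => π (Function.update x i w j)) = Function.update (fun j => π (x j)) i (π w) :=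
    fun w => by
      ext j
      by_cases hij : j = i
      · subst hij; simp
      · simp [hij]
  simp only [_root_.pb, e, map_add]
  exact h.2 i hi _ _ _

lemma image_sdiff_univ (hf : f.Bijective) (I : Finset (Fin k)) :
    (univ \ I).image f = univ \ I.image f := by
  rw [image_sdiff _ _ hf.1, image_univ_of_surjective hf.2]

lemma PR.ri (h : PR univ s φ) (hf : f.Bijective) : PR univ s (ri f φ) := by
  generalize hR : (univ : Finset (Fin k)) = R at h
  induction h with
  | zero => exact .zero _
  | cons hI h0 h1 hβ hγ _ ih =>
    subst hR
    rw [ri_add, ri_mul]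
    refine .cons (subset_univ _) (h0.image f) ?_ (hβ.ri hf.1) ?_ ih
    · rw [← image_sdiff_univ hf]; exact h1.image f
    · rw [← image_sdiff_univ hf]; exact hγ.ri hf.1

lemma PR.pb (h : PR R s φ) (π : V →ₗ[ZMod 2] V) : PR R s (pb π φ) := by
  induction h with
  | zero => exact .zero _
  | cons hI h0 h1 hβ hγ _ ih => exact .cons hI h0 h1 (hβ.pb π) (hγ.pb π) ih

lemma Codim.id : Codim 0 (LinearMap.id : V →ₗ[ZMod 2] V) :=
  ⟨Fin.elim0, Fin.elim0, fun x => by simp [add_self2]⟩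

lemma Codim.comp {π' : V →ₗ[ZMod 2] V} (h : Codim M π) (h' : Codim M' π') :
    Codim (M + M') (π ∘ₗ π') := by
  obtain ⟨l, c, h⟩ := h
  obtain ⟨l', c', h'⟩ := h'
  refine ⟨Fin.append (fun i => l i ∘ₗ π') l', Fin.append c c', fun x => ?_⟩
  rw [Fin.sum_univ_add]
  simp only [Fin.append_left, Fin.append_right, LinearMap.comp_apply, ← h, ← h']
  calc x + π (π' x) = π' x + π' x + (x + π (π' x)) := by rw [add_self2, zero_add]
    _ = _ := by abel

lemma Codim.mono (h : Codim M π) (hM : M ≤ M') : Codim M' π := by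
  obtain ⟨d, rfl⟩ := Nat.exists_eq_add_of_le hM
  obtain ⟨l, c, h⟩ := h
  refine ⟨Fin.append l 0, Fin.append c 0, fun x => ?_⟩
  rw [Fin.sum_univ_add, h]
  simp

lemma exists_kill_functional (l : V →ₗ[ZMod 2] ZMod 2) :
    ∃ π : V →ₗ[ZMod 2] V, Codim 1 π ∧ ∀ x, l (π x) = 0 := by
  by_cases hl : l = 0
  · exact ⟨LinearMap.id, Codim.id.mono (by norm_num), fun x => by simp [hl]⟩
  obtain ⟨c, hc⟩ : ∃ c, l c = 1 := by
    by_contra! h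
    exact hl (LinearMap.ext fun x => (zmod2_cases (l x)).resolve_right (h x))
  refine ⟨LinearMap.id + l.smulRight c, ⟨fun _ => l, fun _ => c, fun x => ?_⟩, fun x => ?_⟩
  · simp [← add_assoc, add_self2]
  · simp [hc, add_self2]

lemma ML.exists_functional {i : Fin k} (h : ML {i} φ) :
    ∃ l : V →ₗ[ZMod 2] ZMod 2, ∀ x, φ x = l (x i) := by
  let l : V →+ ZMod 2 := AddMonoidHom.mk' (fun u => φ (Function.update 0 i u))
    fun u v => h.2 i (mem_singleton_self i) _ _ _
  refine ⟨l.toZModLinearMap 2, fun x => ?_⟩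
  exact h.1 _ _ fun j hj => by simp [mem_singleton.1 hj]

lemma ML.kill {i : Fin k} (h : ML {i} φ) : ∃ π : V →ₗ[ZMod 2] V, Codim 1 π ∧ _root_.pb π φ = 0 := by
  obtain ⟨l, hl⟩ := h.exists_functional
  obtain ⟨π, hπ, h0⟩ := exists_kill_functional l
  exact ⟨π, hπ, by ext x; simp [_root_.pb, hl, h0]⟩

lemma ML.kill_of_card_eq_one (h : ML T φ) (hT : T.card = 1) :
    ∃ π : V →ₗ[ZMod 2] V, Codim 1 π ∧ _root_.pb π φ = 0 := by
  obtain ⟨i, rfl⟩ := card_eq_one.1 hT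
  exact h.kill

lemma PR.kill (h : PR T s φ) (hT : T.card ≤ 3) :
    ∃ π : V →ₗ[ZMod 2] V, Codim s π ∧ _root_.pb π φ = 0 := by
  induction h with
  | zero s => exact ⟨LinearMap.id, Codim.id.mono (Nat.zero_le _), rfl⟩
  | @cons s I β γ φ hI h0 h1 hβ hγ _ ih =>
    obtain ⟨π, hπ, hφ⟩ := ih
    obtain ⟨π', hπ', h'⟩ : ∃ π' : V →ₗ[ZMod 2] V, Codim 1 π' ∧
        _root_.pb π' (_root_.pb π (β * γ)) = 0 := by
      have hc := card_sdiff_add_card_eq_card hI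
      have := h0.card_pos
      have := h1.card_pos
      by_cases hI1 : I.card = 1
      · obtain ⟨π', hπ', h'⟩ := (hβ.pb π).kill_of_card_eq_one hI1
        exact ⟨π', hπ', by rw [pb_mul, pb_mul, h', zero_mul]⟩
      · obtain ⟨π', hπ', h'⟩ := (hγ.pb π).kill_of_card_eq_one (by omega)
        exact ⟨π', hπ', by rw [pb_mul, pb_mul, h', mul_zero]⟩
    refine ⟨π ∘ₗ π', hπ.comp hπ', ?_⟩
    rw [← pb_pb, pb_add, pb_add, h', hφ]
    rfl

lemma PR.kill_family {ι : Type*} (t : Finset ι) {T : ι → Finset (Fin k)}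
    {φ : ι → (Fin k → V) → ZMod 2} (h : ∀ i ∈ t, PR (T i) s (φ i)) (hT : ∀ i ∈ t, (T i).card ≤ 3) :
    ∃ π : V →ₗ[ZMod 2] V, Codim (t.card * s) π ∧ ∀ i ∈ t, _root_.pb π (φ i) = 0 := by
  classical
  induction t using Finset.induction_on with
  | empty => exact ⟨LinearMap.id, Codim.id.mono (Nat.zero_le _), by simp⟩
  | insert j t hj ih =>
    obtain ⟨π, hπ, h1⟩ := ih (fun i hi => h i (mem_insert_of_mem hi))
      fun i hi => hT i (mem_insert_of_mem hi)
    obtain ⟨π', hπ', h2⟩ := ((h j (mem_insert_self _ _)).pb π).kill (hT j (mem_insert_self _ _))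
    refine ⟨π ∘ₗ π', ?_, fun i hi => ?_⟩
    · rw [card_insert_of_notMem hj, add_mul, one_mul]
      exact hπ.comp hπ'
    · rw [← pb_pb]
      rcases mem_insert.1 hi with rfl | hi
      · exact h2
      · rw [h1 i hi, pb_zero]

/-- Restricting to a subspace of bounded codimension changes a form by a form of low partition
rank. -/
lemma Codim.pr (hπ : Codim M π) (hφ : ML univ φ) (hk : 2 ≤ k) :
    PR univ (k * M) (φ + _root_.pb π φ) := by
  obtain ⟨l, c, h⟩ := hπ
  have key : ∀ S : Finset (Fin k), PR univ (S.card * M)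
      (φ + fun x => φ (S.piecewise (fun i => π (x i)) x)) := by
    intro S
    induction S using Finset.induction_on with
    | empty =>
      have : (φ + fun x => φ ((∅ : Finset (Fin k)).piecewise (fun i => π (x i)) x)) = 0 := by
        simp only [piecewise_empty]; exact add_self2 φ
      rw [this]; exact .zero _
    | insert j S hj ih =>
      rw [card_insert_of_notMem hj, add_mul, one_mul]
      have e : (φ + fun x => φ ((insert j S).piecewise (fun i => π (x i)) x)) =
          (φ + fun x => φ (S.piecewise (fun i => π (x i)) x)) +
          ∑ i, (fun x : Fin k → V => l i (x j)) *
            fun x => φ (Function.update (S.piecewise (fun i => π (x i)) x) j (c i)) := by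
        ext x
        have hL : ∀ w : V, ∃ L : V →ₗ[ZMod 2] ZMod 2, ∀ u,
            φ (Function.update (S.piecewise (fun i => π (x i)) x) j u) = L u := fun _ =>
          ⟨(AddMonoidHom.mk' (fun u => φ (Function.update (S.piecewise (fun i => π (x i)) x) j u))
            fun u v => hφ.2 j (mem_univ _) _ _ _).toZModLinearMap 2, fun u => rfl⟩
        obtain ⟨L, hL⟩ := hL 0
        have h1 : S.piecewise (fun i => π (x i)) x =
            Function.update (S.piecewise (fun i => π (x i)) x) j (x j) := by
          ext i
          by_cases hi : i = j
          · subst hi; simp [hj]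
          · simp [hi]
        simp only [Pi.add_apply, Finset.sum_apply, Pi.mul_apply, hL, piecewise_insert]
        rw [h1, hL, ← add_right_inj (φ x)]
        simp only [← add_assoc, add_self2, zero_add]
        have h2 : L (x j) + L (π (x j)) = ∑ i, l i (x j) * L (c i) := by
          rw [← map_add, h, map_sum]; simp
        rw [← h2, ← add_assoc, add_self2, zero_add]
      rw [e]
      refine ih.add ?_
      have : ∀ i, PR univ 1 ((fun x : Fin k → V => l i (x j)) *
            fun x => φ (Function.update (S.piecewise (fun i => π (x i)) x) j (c i))) := fun i => by
        have hne : (univ \ {j} : Finset (Fin k)).Nonempty := by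
          rw [← card_pos, card_sdiff_of_subset (subset_univ _)]
          simp; omega
        refine PR.single (I := {j}) (subset_univ _) (singleton_nonempty j) hne
          ⟨fun x y hxy => by simp only [hxy j (mem_singleton_self j)], fun i' hi x u v => ?_⟩
          ⟨fun x y hxy => ?_, fun i' hi x u v => ?_⟩
        · obtain rfl := mem_singleton.1 hi; simp
        · refine congrArg φ (funext fun i' => ?_)
          by_cases hi : i' = j
          · subst hi; simp
          · by_cases hS : i' ∈ S <;> simp [hi, hS, hxy i' (by simp [hi])]
        · have hij : i' ≠ j := by simpa using hi
          have e' : ∀ w : V, Function.update (S.piecewise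
              (fun i => π (Function.update x i' w i)) (Function.update x i' w)) j (c i) =
              Function.update (Function.update (S.piecewise (fun i => π (x i)) x) j (c i)) i'
                (if i' ∈ S then π w else w) := fun w => by
            ext i''
            by_cases h1 : i'' = i'
            · subst h1
              by_cases hS : i'' ∈ S <;> simp [hij, hS]
            · by_cases h2 : i'' = j
              · subst h2; simp [h1]
              · by_cases hS : i'' ∈ S <;> simp [h1, h2, hS]
          simp only [e']
          rw [← hφ.2 i' (mem_univ _)]
          congr 2
          split_ifs <;> simp
      simpa using PR.sum_fin this
  have := key univ
  rw [card_univ, Fintype.card_fin] at this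
  simp only [piecewise_univ] at this
  exact this

end basic

end

section

variable {k : ℕ} {V : Type} [AddCommGroup V] [Module (ZMod 2) V]

/-- `g` is a sum of `s` products of a form in the variables `P` and a form in the others. -/
def Dec (P : Finset (Fin k)) (s : ℕ) (g : (Fin k → V) → ZMod 2) : Prop :=
  ∃ b c : Fin s → (Fin k → V) → ZMod 2, (∀ i, ML P (b i)) ∧ (∀ i, ML Pᶜ (c i)) ∧
    g = ∑ i, b i * c i

section dec
variable {f : Fin k → Fin k} {π : V →ₗ[ZMod 2] V} {φ g g' : (Fin k → V) → ZMod 2}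
  {P : Finset (Fin k)} {s s' : ℕ} {𝓑 : Finset (Finset (Fin k))}

lemma Dec.ml (h : Dec P s g) : ML univ g := by
  obtain ⟨b, c, hb, hc, rfl⟩ := h
  exact ML.sum fun i _ => (hb i).mul' (hc i) disjoint_compl_right (union_compl P)

lemma Dec.pr (h : Dec P s g) (hP : P.Nonempty) (hP' : Pᶜ.Nonempty) : PR univ s g := by
  obtain ⟨b, c, hb, hc, rfl⟩ := h
  have : ∀ i, PR univ 1 (b i * c i) := fun i =>
    PR.single' (union_compl P) disjoint_compl_right hP hP' (hb i) (hc i)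
  simpa using PR.sum_fin this

lemma Dec.zero : Dec P 0 (0 : (Fin k → V) → ZMod 2) :=
  ⟨Fin.elim0, Fin.elim0, fun i => i.elim0, fun i => i.elim0, by simp⟩

lemma Dec.add (h : Dec P s g) (h' : Dec P s' g') : Dec P (s + s') (g + g') := by
  obtain ⟨b, c, hb, hc, rfl⟩ := h
  obtain ⟨b', c', hb', hc', rfl⟩ := h'
  refine ⟨Fin.append b b', Fin.append c c', fun i => ?_, fun i => ?_, ?_⟩
  · induction i using Fin.addCases <;> simp [hb, hb']
  · induction i using Fin.addCases <;> simp [hc, hc']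
  · rw [Fin.sum_univ_add]; simp

lemma Dec.single {b c : (Fin k → V) → ZMod 2} (hb : ML P b) (hc : ML Pᶜ c) : Dec P 1 (b * c) :=
  ⟨fun _ => b, fun _ => c, fun _ => hb, fun _ => hc, by simp⟩

lemma Dec.mono (h : Dec P s g) (hs : s ≤ s') : Dec P s' g := by
  obtain ⟨d, rfl⟩ := Nat.exists_eq_add_of_le hs
  have h0 : Dec P d (0 : (Fin k → V) → ZMod 2) :=
    ⟨0, 0, fun _ => ML.zero, fun _ => ML.zero, by simp⟩
  simpa using h.add h0

lemma Dec.compl (h : Dec P s g) : Dec Pᶜ s g := by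
  obtain ⟨b, c, hb, hc, rfl⟩ := h
  exact ⟨c, b, hc, by simpa using hb, sum_congr rfl fun i _ => mul_comm _ _⟩

lemma Dec.pb (h : Dec P s g) (π : V →ₗ[ZMod 2] V) : Dec P s (pb π g) := by
  obtain ⟨b, c, hb, hc, rfl⟩ := h
  exact ⟨_, _, fun i => (hb i).pb π, fun i => (hc i).pb π, by simp⟩

lemma Dec.ri (h : Dec P s g) (hf : f.Bijective) : Dec (P.image f) s (ri f g) := by
  obtain ⟨b, c, hb, hc, rfl⟩ := h
  refine ⟨_, _, fun i => (hb i).ri hf.1, fun i => ?_, by simp; rfl⟩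
  have := (hc i).ri hf.1
  rwa [compl_eq_univ_sdiff, image_sdiff_univ hf, ← compl_eq_univ_sdiff] at this

lemma Dec.sum {ι : Type*} (t : Finset ι) {g : ι → (Fin k → V) → ZMod 2}
    (h : ∀ i ∈ t, Dec P s (g i)) : Dec P (t.card * s) (∑ i ∈ t, g i) := by
  classical
  induction t using Finset.induction_on with
  | empty => simpa using Dec.zero
  | insert j t hj ih =>
    rw [sum_insert hj, card_insert_of_notMem hj, add_mul, one_mul, add_comm (#t * s)]
    exact (h j (mem_insert_self _ _)).add (ih fun i hi => h i (mem_insert_of_mem hi))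

/-- The bipartitions in `𝓑` are in general position, each with one side of size at most 3. -/
def Generic (𝓑 : Finset (Finset (Fin k))) : Prop :=
  ∀ P ∈ 𝓑, Pᶜ.card ≤ 3 ∧ ∀ P' ∈ 𝓑, P ≠ P' → (P' \ P).Nonempty ∧ (P'ᶜ \ P).Nonempty

/-- Decompositions along bipartitions in general position are unique up to passing to a subspace of
bounded codimension. -/
lemma Dec.unique (h𝓑 : Generic 𝓑) {Q : Finset (Fin k) → (Fin k → V) → ZMod 2}
    (hQ : ∀ P ∈ 𝓑, Dec P s (Q P)) (h0 : ∑ P ∈ 𝓑, Q P = 0) :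
    ∃ π : V →ₗ[ZMod 2] V, Codim (𝓑.card * s * (𝓑.card * s)) π ∧
      ∀ P ∈ 𝓑, _root_.pb π (Q P) = 0 := by
  have h1 : ∀ P ∈ 𝓑, ∃ (ys : Fin s → Fin k → V) (C : Fin s → (Fin k → V) → ZMod 2),
      Q P = ∑ i, C i * _root_.fz P (ys i) (Q P) := by
    intro P hP
    obtain ⟨b, c, hb, hc, hQP⟩ := hQ P hP
    have : Inhabited (Fin k → V) := ⟨0⟩
    obtain ⟨ys, C, -, hC⟩ := exists_dual_points (ML.submodule P) s b hb
    refine ⟨ys, C, ?_⟩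
    have e : ∀ i, _root_.fz P (ys i) (Q P) = ∑ j, b j (ys i) • c j := fun i => by
      rw [hQP, fz_sum]
      refine sum_congr rfl fun j _ => ?_
      rw [fz_mul, (hc j).fz_eq_of_disjoint disjoint_compl_right]
      ext v
      rw [Pi.mul_apply, (hb j).fz_of_subset subset_rfl, Pi.smul_apply, smul_eq_mul]
    simp only [e]
    ext v
    conv_lhs => rw [hQP]
    simp only [Finset.sum_apply, Pi.mul_apply, Pi.smul_apply, smul_eq_mul, mul_sum]
    rw [sum_comm]
    refine sum_congr rfl fun j _ => ?_
    rw [hC j v, sum_mul]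
    exact sum_congr rfl fun i _ => by ring
  choose! ys C hC using h1
  have h2 : ∀ p ∈ 𝓑 ×ˢ (univ : Finset (Fin s)),
      PR p.1ᶜ (𝓑.card * s) (_root_.fz p.1 (ys p.1 p.2) (Q p.1)) := by
    rintro ⟨P, i⟩ hp
    have hP : P ∈ 𝓑 := (mem_product.1 hp).1
    have e : _root_.fz P (ys P i) (Q P) =
        ∑ P' ∈ 𝓑.erase P, _root_.fz P (ys P i) (Q P') := by
      have := congrArg (_root_.fz P (ys P i)) h0
      rw [fz_sum, fz_zero, ← add_sum_erase _ _ hP] at this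
      rw [← add_zero (_root_.fz P (ys P i) (Q P)), ← add_self2 (∑ P' ∈ 𝓑.erase P, _),
        ← add_assoc, this, zero_add]
    dsimp only
    rw [e]
    refine (PR.sum (s := s) _ fun P' hP' => ?_).mono
      (Nat.mul_le_mul_right _ (card_le_card (erase_subset _ _)))
    obtain ⟨hne, hP'⟩ := mem_erase.1 hP'
    obtain ⟨b, c, hb, hc, hQP⟩ := hQ P' hP'
    obtain ⟨n1, n2⟩ := (h𝓑 P hP).2 P' hP' hne.symm
    rw [hQP, fz_sum]
    have : ∀ j, PR Pᶜ 1 (_root_.fz P (ys P i) (b j * c j)) := fun j => by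
      rw [fz_mul]
      refine PR.single' ?_ ?_ n1 n2 ((hb j).fz _ _) ((hc j).fz _ _)
      · rw [← union_sdiff_distrib, union_compl, compl_eq_univ_sdiff]
      · exact disjoint_compl_right.mono sdiff_subset sdiff_subset
    simpa using PR.sum_fin this
  obtain ⟨π, hπ, h3⟩ := PR.kill_family (𝓑 ×ˢ (univ : Finset (Fin s))) h2
    fun p hp => (h𝓑 _ (mem_product.1 hp).1).1
  refine ⟨π, by simpa using hπ, fun P hP => ?_⟩
  rw [hC P hP, pb_sum]
  refine sum_eq_zero fun i _ => ?_
  rw [pb_mul, h3 (P, i) (mem_product.2 ⟨hP, mem_univ i⟩), mul_zero]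

/-- The action of a permutation of the variables on bipartitions represented by elements of `𝓑`. -/
def act (𝓑 : Finset (Finset (Fin k))) (f : Fin k → Fin k) (P : Finset (Fin k)) :
    Finset (Fin k) :=
  if P.image f ∈ 𝓑 then P.image f else (P.image f)ᶜ

/-- `f` is an involution of the variables acting on `𝓑`. -/
def Acts (𝓑 : Finset (Finset (Fin k))) (f : Fin k → Fin k) : Prop :=
  (∀ i, f (f i) = i) ∧ ∀ P ∈ 𝓑, act 𝓑 f P ∈ 𝓑 ∧ act 𝓑 f (act 𝓑 f P) = P

lemma Dec.act (h𝓑 : Acts 𝓑 f) (h : Dec (act 𝓑 f P) s g) : Dec P s (_root_.ri f g) := by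
  have hf : f.Bijective := Function.Involutive.bijective h𝓑.1
  have e : (P.image f).image f = P := by
    rw [image_image, show f ∘ f = id from funext h𝓑.1, image_id]
  have := h.ri hf
  unfold _root_.act at this
  split_ifs at this
  · rwa [e] at this
  · rw [compl_eq_univ_sdiff, image_sdiff_univ hf, e, ← compl_eq_univ_sdiff] at this
    simpa using this.compl

lemma Dec.relation (h𝓑 : Generic 𝓑) {Q : Finset (Fin k) → (Fin k → V) → ZMod 2}
    (hQ : ∀ P ∈ 𝓑, Dec P s (Q P)) (L : List (Fin k → Fin k)) (hL : ∀ f ∈ L, Acts 𝓑 f)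
    (h0 : (L.map fun f => _root_.ri f (∑ P ∈ 𝓑, Q P)).sum = 0) :
    ∃ π : V →ₗ[ZMod 2] V, Codim (𝓑.card * (L.length * s) * (𝓑.card * (L.length * s))) π ∧
      ∀ P ∈ 𝓑, (L.map fun f => _root_.ri f (_root_.pb π (Q (_root_.act 𝓑 f P)))).sum = 0 := by
  have key : ∀ L : List (Fin k → Fin k), (∀ f ∈ L, Acts 𝓑 f) →
      (L.map fun f => _root_.ri f (∑ P ∈ 𝓑, Q P)).sum =
        ∑ P ∈ 𝓑, (L.map fun f => _root_.ri f (Q (_root_.act 𝓑 f P))).sum ∧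
      ∀ P ∈ 𝓑, Dec P (L.length * s) (L.map fun f => _root_.ri f (Q (_root_.act 𝓑 f P))).sum := by
    intro L
    induction L with
    | nil => exact fun _ => ⟨by simp, fun P _ => by simpa using Dec.zero⟩
    | cons f L ih =>
      intro hL
      obtain ⟨i1, i2⟩ := ih fun f hf => hL f (List.mem_cons_of_mem _ hf)
      have hf := hL f List.mem_cons_self
      constructor
      · simp only [List.map_cons, List.sum_cons, sum_add_distrib, ← i1, ri_sum]
        congr 1
        exact sum_bij' (fun P _ => _root_.act 𝓑 f P) (fun P _ => _root_.act 𝓑 f P)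
          (fun P hP => (hf.2 P hP).1) (fun P hP => (hf.2 P hP).1)
          (fun P hP => (hf.2 P hP).2) (fun P hP => (hf.2 P hP).2)
          fun P hP => by rw [(hf.2 P hP).2]
      · intro P hP
        simp only [List.map_cons, List.sum_cons, List.length_cons]
        rw [add_mul, one_mul, add_comm (L.length * s)]
        exact (Dec.act hf (hQ _ (hf.2 P hP).1)).add (i2 P hP)
  obtain ⟨k1, k2⟩ := key L hL
  rw [k1] at h0
  obtain ⟨π, hπ, h1⟩ := Dec.unique h𝓑 k2 h0
  refine ⟨π, hπ, fun P hP => ?_⟩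
  have hm : ∀ L : List (Fin k → Fin k),
      _root_.pb π (L.map fun f => _root_.ri f (Q (_root_.act 𝓑 f P))).sum =
      (L.map fun f => _root_.ri f (_root_.pb π (Q (_root_.act 𝓑 f P)))).sum := by
    intro L
    induction L with
    | nil => rfl
    | cons f L ih => simp only [List.map_cons, List.sum_cons, pb_add, ih, pb_ri]
  rw [← hm, h1 P hP]

/-- `𝓑` represents all bipartitions into two parts with at least two elements. -/
def Covers (𝓑 : Finset (Finset (Fin k))) : Prop :=
  ∀ I : Finset (Fin k), 2 ≤ I.card → 2 ≤ Iᶜ.card → I ∈ 𝓑 ∨ Iᶜ ∈ 𝓑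

lemma PR.decompose (h𝓑 : Covers 𝓑) (h : PR univ s φ) :
    ∃ π : V →ₗ[ZMod 2] V, Codim s π ∧ ∃ Q : Finset (Fin k) → (Fin k → V) → ZMod 2,
      (∀ P ∈ 𝓑, Dec P s (Q P)) ∧ _root_.pb π φ = ∑ P ∈ 𝓑, Q P := by
  generalize hR : (univ : Finset (Fin k)) = R at h
  induction h with
  | zero s =>
    exact ⟨LinearMap.id, Codim.id.mono (Nat.zero_le _), fun _ => 0,
      fun P _ => Dec.zero.mono (Nat.zero_le _), by simp⟩
  | @cons s I β γ φ hI h0 h1 hβ hγ _ ih =>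
    subst hR
    obtain ⟨π, hπ, Q, hQ, e⟩ := ih
    rw [← compl_eq_univ_sdiff] at h1 hγ
    by_cases hc : 2 ≤ I.card ∧ 2 ≤ Iᶜ.card
    · obtain ⟨P, hP, hd⟩ : ∃ P ∈ 𝓑, Dec P 1 (β * γ) := by
        rcases h𝓑 I hc.1 hc.2 with h | h
        · exact ⟨I, h, Dec.single hβ hγ⟩
        · exact ⟨Iᶜ, h, (Dec.single hβ hγ).compl⟩
      refine ⟨π, hπ.mono (Nat.le_succ s), fun P' => Q P' + if P' = P then _root_.pb π (β * γ) else 0,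
        fun P' hP' => (hQ P' hP').add ?_, ?_⟩
      · split_ifs with h
        · exact h ▸ hd.pb π
        · exact Dec.zero.mono (Nat.zero_le _)
      · rw [sum_add_distrib, sum_ite_eq' 𝓑 P, if_pos hP, pb_add, e, add_comm]
    · obtain ⟨π', hπ', h'⟩ : ∃ π' : V →ₗ[ZMod 2] V, Codim 1 π' ∧
          _root_.pb π' (_root_.pb π (β * γ)) = 0 := by
        have := h0.card_pos
        have := h1.card_pos
        by_cases hI1 : I.card = 1
        · obtain ⟨π', hπ', h'⟩ := (hβ.pb π).kill_of_card_eq_one hI1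
          exact ⟨π', hπ', by rw [pb_mul, pb_mul, h', zero_mul]⟩
        · obtain ⟨π', hπ', h'⟩ := (hγ.pb π).kill_of_card_eq_one (by omega)
          exact ⟨π', hπ', by rw [pb_mul, pb_mul, h', mul_zero]⟩
      refine ⟨π ∘ₗ π', hπ.comp hπ', fun P => _root_.pb π' (Q P),
        fun P hP => ((hQ P hP).pb π').mono (Nat.le_succ s), ?_⟩
      rw [← pb_pb, pb_add, pb_add, h', e, zero_add, pb_sum]

/-- A form of low partition rank decomposes along `𝓑`, on a subspace of bounded codimension, in such
a way that linear relations between its permutations are inherited by the pieces. -/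
lemma PR.decompose_relations (hg : Generic 𝓑) (hc : Covers 𝓑) (Ls : List (List (Fin k → Fin k)))
    (hL : ∀ L ∈ Ls, L.length ≤ 3 ∧ ∀ f ∈ L, Acts 𝓑 f) (h : PR univ s φ)
    (h0 : ∀ L ∈ Ls, (L.map fun f => _root_.ri f φ).sum = 0) :
    ∃ π : V →ₗ[ZMod 2] V, Codim (s + Ls.length * (𝓑.card * (3 * s) * (𝓑.card * (3 * s)))) π ∧
      ∃ Q : Finset (Fin k) → (Fin k → V) → ZMod 2,
      (∀ P ∈ 𝓑, Dec P s (Q P)) ∧ _root_.pb π φ = ∑ P ∈ 𝓑, Q P ∧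
      ∀ L ∈ Ls, ∀ P ∈ 𝓑, (L.map fun f => _root_.ri f (Q (act 𝓑 f P))).sum = 0 := by
  have hm : ∀ (π : V →ₗ[ZMod 2] V) (L : List (Fin k → Fin k))
      (ψ : (Fin k → Fin k) → (Fin k → V) → ZMod 2),
      (L.map fun f => _root_.ri f (ψ f)).sum = 0 →
      (L.map fun f => _root_.ri f (_root_.pb π (ψ f))).sum = 0 := by
    intro π L ψ hψ
    have : ∀ L : List (Fin k → Fin k), _root_.pb π (L.map fun f => _root_.ri f (ψ f)).sum =
        (L.map fun f => _root_.ri f (_root_.pb π (ψ f))).sum := by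
      intro L
      induction L with
      | nil => rfl
      | cons f L ih => simp only [List.map_cons, List.sum_cons, pb_add, ih, pb_ri]
    rw [← this, hψ, pb_zero]
  induction Ls with
  | nil =>
    obtain ⟨π, hπ, Q, hQ, e⟩ := h.decompose hc
    exact ⟨π, by simpa using hπ, Q, hQ, e, by simp⟩
  | cons L Ls ih =>
    obtain ⟨π, hπ, Q, hQ, e, hr⟩ := ih (fun L hL' => hL L (List.mem_cons_of_mem _ hL'))
      fun L hL' => h0 L (List.mem_cons_of_mem _ hL')
    obtain ⟨hl, hL1⟩ := hL L List.mem_cons_self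
    obtain ⟨π', hπ', hr'⟩ := Dec.relation hg hQ L hL1
      (by rw [← e]; exact hm π L (fun _ => φ) (h0 L List.mem_cons_self))
    refine ⟨π ∘ₗ π', (hπ.comp hπ').mono ?_, fun P => _root_.pb π' (Q P),
      fun P hP => (hQ P hP).pb π', ?_, fun L' hL' P hP => ?_⟩
    · rw [List.length_cons, add_mul, one_mul, ← add_assoc]
      gcongr
    · rw [← pb_pb, e, pb_sum]
    · rcases List.mem_cons.1 hL' with rfl | hL'
      · exact hr' P hP
      · exact hm π' L' _ (hr L' hL' P hP)

end dec

end

section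

section bilin
variable {k : ℕ} {V : Type} [AddCommGroup V] [Module (ZMod 2) V]
  {T : Finset (Fin k)} {φ : (Fin k → V) → ZMod 2}

lemma exists_bilin {B : V → V → ZMod 2} (h1 : ∀ u v w, B (u + v) w = B u w + B v w)
    (h2 : ∀ u v w, B w (u + v) = B w u + B w v) :
    ∃ B' : V →ₗ[ZMod 2] V →ₗ[ZMod 2] ZMod 2, ∀ u v, B u v = B' u v := by
  refine ⟨(AddMonoidHom.mk' (fun u => (AddMonoidHom.mk' (B u) fun v w => h2 v w u).toZModLinearMap 2)
    fun u v => LinearMap.ext fun w => h1 u v w).toZModLinearMap 2, fun u v => rfl⟩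

lemma ML.exists_bilin_update (h : ML T φ) {p q : Fin k} (hp : p ∈ T) (hq : q ∈ T) (hpq : p ≠ q)
    (x : Fin k → V) : ∃ B : V →ₗ[ZMod 2] V →ₗ[ZMod 2] ZMod 2,
      ∀ u v, φ (Function.update (Function.update x p u) q v) = B u v := by
  refine exists_bilin (B := fun u v => φ (Function.update (Function.update x p u) q v))
    (fun u v w => ?_) fun u v w => ?_
  · simp only [Function.update_comm hpq]
    exact h.2 p hp _ _ _
  · exact h.2 q hq _ _ _

lemma update_update_self (p q : Fin k) (x : Fin k → V) :
    Function.update (Function.update x p (x p)) q (x q) = x := by simp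

lemma comp_swap_eq {p q : Fin k} (x : Fin k → V) :
    (fun i => x (Equiv.swap p q i)) = Function.update (Function.update x p (x q)) q (x p) := by
  ext i
  rcases eq_or_ne i q with rfl | hq
  · simp
  rcases eq_or_ne i p with rfl | hp
  · simp [hq]
  · simp [hp, hq, Equiv.swap_apply_of_ne_of_ne]

lemma update_update_comp_swap {p q : Fin k} (hpq : p ≠ q) (x : Fin k → V) (u v : V) :
    (fun i => Function.update (Function.update x p u) q v (Equiv.swap p q i)) =
      Function.update (Function.update x p v) q u := by
  rw [comp_swap_eq]
  simp only [Function.update_self, Function.update_of_ne hpq]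
  rw [Function.update_comm hpq.symm]
  simp [Function.update_comm hpq]

end bilin

section trunc
variable {k n : ℕ} {T P : Finset (Fin k)} {s : ℕ} {p q : Fin k}
  {φ ψ : (Fin k → Fin n → ZMod 2) → ZMod 2}

/-- The upper triangular part of a form with respect to the variables `p` and `q`. -/
def trunc (p q : Fin k) (φ : (Fin k → Fin n → ZMod 2) → ZMod 2) :
    (Fin k → Fin n → ZMod 2) → ZMod 2 :=
  fun x => ∑ a, ∑ b, if a < b then x p a * x q b *
    φ (Function.update (Function.update x p (Pi.single a 1)) q (Pi.single b 1)) else 0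

lemma trunc_add : trunc p q (φ + ψ) = trunc p q φ + trunc p q ψ := by
  ext x
  simp only [trunc, Pi.add_apply, ← sum_add_distrib]
  refine sum_congr rfl fun a _ => sum_congr rfl fun b _ => ?_
  split_ifs <;> ring

lemma trunc_zero : trunc p q (0 : (Fin k → Fin n → ZMod 2) → ZMod 2) = 0 := by
  ext x; simp [trunc]

lemma trunc_sum {ι : Type*} (t : Finset ι) (g : ι → (Fin k → Fin n → ZMod 2) → ZMod 2) :
    trunc p q (∑ i ∈ t, g i) = ∑ i ∈ t, trunc p q (g i) := by
  classical
  induction t using Finset.induction_on with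
  | empty => exact trunc_zero
  | insert j t hj ih => rw [sum_insert hj, sum_insert hj, trunc_add, ih]

lemma trunc_mul_left (h : ML T ψ) (hp : p ∉ T) (hq : q ∉ T) :
    trunc p q (ψ * φ) = ψ * trunc p q φ := by
  ext x
  simp only [trunc, Pi.mul_apply, mul_sum]
  refine sum_congr rfl fun a _ => sum_congr rfl fun b _ => ?_
  rw [h.update_notMem hq, h.update_notMem hp]
  split_ifs <;> ring

lemma ML.trunc (h : ML T φ) (hp : p ∈ T) (hq : q ∈ T) (hpq : p ≠ q) : ML T (trunc p q φ) := by
  refine ⟨fun x y hxy => ?_, fun i hi x u v => ?_⟩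
  · refine sum_congr rfl fun a _ => sum_congr rfl fun b _ => ?_
    rw [hxy p hp, hxy q hq, h.congr fun i hi => ?_]
    rcases eq_or_ne i q with rfl | h1
    · simp
    rcases eq_or_ne i p with rfl | h2
    · simp [h1]
    · simp [h1, h2, hxy i hi]
  · simp only [_root_.trunc, ← sum_add_distrib]
    refine sum_congr rfl fun a _ => sum_congr rfl fun b _ => ?_
    split_ifs
    swap
    · simp
    rcases eq_or_ne i q with rfl | h1
    · simp only [Function.update_self, Function.update_of_ne hpq, Function.update_comm hpq,
        Function.update_idem, Pi.add_apply]
      ring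
    rcases eq_or_ne i p with rfl | h2
    · simp only [Function.update_self, Function.update_of_ne hpq.symm,
        Function.update_idem, Pi.add_apply]
      ring
    · have e : ∀ w, Function.update (Function.update (Function.update x i w) p (Pi.single a 1))
          q (Pi.single b 1) = Function.update (Function.update (Function.update x p (Pi.single a 1))
          q (Pi.single b 1)) i w := fun w => by
        rw [Function.update_comm h2, Function.update_comm h1]
      simp only [Function.update_of_ne h1.symm, Function.update_of_ne h2.symm, e, h.2 i hi]
      ring

lemma Dec.trunc (h : Dec P s φ) (hpq : p ≠ q) (hP : p ∈ P ∧ q ∈ P ∨ p ∉ P ∧ q ∉ P) :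
    Dec P s (trunc p q φ) := by
  obtain ⟨b, c, hb, hc, rfl⟩ := h
  rw [trunc_sum]
  rcases hP with ⟨hp, hq⟩ | ⟨hp, hq⟩
  · exact ⟨_, c, fun i => (hb i).trunc hp hq hpq, hc, sum_congr rfl fun i _ => by
      rw [mul_comm, trunc_mul_left (hc i) (by simpa) (by simpa), mul_comm]⟩
  · exact ⟨b, _, hb, fun i => (hc i).trunc (by simpa) (by simpa) hpq, sum_congr rfl fun i _ => by
      rw [trunc_mul_left (hb i) hp hq]⟩

/-- An alternating form is the symmetrization of its upper triangular part. -/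
lemma trunc_add_ri_swap (h : ML T φ) (hp : p ∈ T) (hq : q ∈ T) (hpq : p ≠ q)
    (hs : ri (Equiv.swap p q) φ = φ) (hd : ∀ x : Fin k → Fin n → ZMod 2, x p = x q → φ x = 0) :
    trunc p q φ + ri (Equiv.swap p q) (trunc p q φ) = φ := by
  ext x
  obtain ⟨B, hB⟩ := h.exists_bilin_update hp hq hpq x
  have hsym : ∀ u v, B u v = B v u := fun u v => by
    rw [← hB v u]
    conv_lhs => rw [← hB, ← hs, ri, update_update_comp_swap hpq]
  have hdiag : ∀ u, B u u = 0 := fun u => by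
    rw [← hB]; exact hd _ (by simp [hpq])
  have e : φ x = ∑ a, ∑ b, x p a * x q b * B (Pi.single a 1) (Pi.single b 1) := by
    conv_lhs => rw [← update_update_self p q x, hB]
    have := LinearMap.sum_repr_mul_repr_mul (Pi.basisFun (ZMod 2) (Fin n))
      (Pi.basisFun (ZMod 2) (Fin n)) (B := B) (x p) (x q)
    rw [← this, Finsupp.sum_fintype _ _ (by simp)]
    refine sum_congr rfl fun a _ => ?_
    rw [Finsupp.sum_fintype _ _ (by simp)]
    refine sum_congr rfl fun b _ => ?_
    simp [mul_assoc]
  have e2 : ∀ u v, Function.update (Function.update (fun i => x (Equiv.swap p q i)) p u) q v =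
      Function.update (Function.update x p u) q v := fun u v => by
    rw [comp_swap_eq, Function.update_comm hpq.symm, Function.update_idem, Function.update_idem]
  rw [e]
  simp only [Pi.add_apply, ri, trunc, e2, hB, Equiv.swap_apply_left, Equiv.swap_apply_right]
  rw [sum_comm (f := fun a b => if a < b then x q a * x p b * _ else 0)]
  rw [← sum_add_distrib]
  refine sum_congr rfl fun a _ => ?_
  rw [← sum_add_distrib]
  refine sum_congr rfl fun b _ => ?_
  rcases lt_trichotomy a b with h | rfl | h
  · simp [h, h.le.not_gt]
  · simp [hdiag]
  · simp [h, h.le.not_gt, hsym (Pi.single b 1), mul_comm (x q b)]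

end trunc

section steps
variable {k : ℕ}

/-- Every form on `𝔽₂ⁿ` with a large correlation and the property `A` is, up to bounded partition
rank, a form with the property `B`. -/
def Step (k : ℕ) (A B : ∀ n : ℕ, ((Fin k → Fin n → ZMod 2) → ZMod 2) → Prop) : Prop :=
  ∃ F, TowerBounded F ∧ ∀ (n s : ℕ) (α : (Fin k → Fin n → ZMod 2) → ZMod 2),
    ML univ α → Corr s α → A n α →
      ∃ α' : (Fin k → Fin n → ZMod 2) → ZMod 2, ML univ α' ∧ PR univ (F s) (α + α') ∧ B n α'

lemma Step.trans {A B C : ∀ n : ℕ, ((Fin k → Fin n → ZMod 2) → ZMod 2) → Prop}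
    (h : Step k A B) (h' : Step k B C) : Step k A C := by
  obtain ⟨F, hF, h⟩ := h
  obtain ⟨F', hF', h'⟩ := h'
  have : TowerBounded fun s => F' (s + F s) := by fun_prop
  refine ⟨fun s => F s + F' (s + F s), by fun_prop, fun n s α hα hc hA => ?_⟩
  obtain ⟨α', hα', hp, hB⟩ := h n s α hα hc hA
  obtain ⟨α'', hα'', hp', hC⟩ := h' n _ α' hα' (hc.of_pr hα hp) hB
  refine ⟨α'', hα'', ?_, hC⟩
  have e : α + α'' = (α + α') + (α' + α'') := by
    rw [← add_assoc, add_add_cancel2]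
  rw [e]
  exact hp.add hp'

end steps

end

section

variable {k : ℕ}

lemma ri_ri {V : Type} (f g : Fin k → Fin k) (φ : (Fin k → V) → ZMod 2) :
    ri f (ri g φ) = ri (f ∘ g) φ := rfl

lemma ri_id {V : Type} (φ : (Fin k → V) → ZMod 2) : ri id φ = φ := rfl

lemma ri_swap_swap {V : Type} (p q : Fin k) (φ : (Fin k → V) → ZMod 2) :
    ri (Equiv.swap p q) (ri (Equiv.swap p q) φ) = φ := by
  ext x; simp [ri]

lemma ri_eq_zero_of_diag {n : ℕ} {p q : Fin k} (φ : (Fin k → Fin n → ZMod 2) → ZMod 2)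
    (x : Fin k → Fin n → ZMod 2) (hx : x p = x q) : (φ + ri (Equiv.swap p q) φ) x = 0 := by
  have : (fun i => x (Equiv.swap p q i)) = x := by
    rw [comp_swap_eq, hx, ← hx, Function.update_eq_self, hx, Function.update_eq_self]
  simp only [Pi.add_apply, ri, this, add_self2]

/-- A correlated form is symmetric up to bounded partition rank. -/
lemma exists_swap_pr {p q : Fin k} (hpq : p ≠ q) : ∃ F, TowerBounded F ∧
    ∀ (V : Type) [AddCommGroup V] [Module (ZMod 2) V] [Fintype V] (s : ℕ)
      (α : (Fin k → V) → ZMod 2), ML univ α → Corr s α →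
      PR univ (F s) (α + ri (Equiv.swap p q) α) := by
  obtain ⟨F, hF, h⟩ := pr_of_bias (univ : Finset (Fin k)) ⟨p, mem_univ p⟩
  refine ⟨fun s => F (4 * s), by fun_prop, fun V _ _ _ s α hα hc => ?_⟩
  classical
  refine h V _ (4 * s) (hα.add (hα.ri_univ (Equiv.bijective _))) ?_
  have h1 := hc.parity {p, q}
  have e : ∀ u : Fin k → V, ∀ x y : V, α u + α (shiftOn {p, q} u x) + α (shiftOn {p, q} u y) +
      α (shiftOn {p, q} u (x + y)) = (α + ri (Equiv.swap p q) α)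
        (Function.update (Function.update u p x) q y) := by
    intro u x y
    obtain ⟨B, hB⟩ := hα.exists_bilin_update (mem_univ p) (mem_univ q) hpq u
    have e1 : ∀ z, shiftOn {p, q} u z =
        Function.update (Function.update u p (u p + z)) q (u q + z) := fun z => by
      ext i
      rcases eq_or_ne i q with rfl | h1
      · simp [shiftOn]
      rcases eq_or_ne i p with rfl | h2
      · rw [Function.update_of_ne hpq]; simp [shiftOn]
      · simp [shiftOn, h1, h2]
    rw [Pi.add_apply, ri, update_update_comp_swap hpq, hB, hB, e1, e1, e1, hB, hB, hB]
    conv_lhs => rw [← update_update_self p q u, hB]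
    simp only [map_add, LinearMap.add_apply]
    grind
  simp only [e] at h1
  have e2 : ∀ g : (Fin k → V) → ℝ, ∑ u, ∑ x, ∑ y, g (Function.update (Function.update u p x) q y) =
      (Fintype.card V : ℝ) ^ 2 * ∑ v, g v := by
    intro g
    have := sum_update p fun u => ∑ y, g (Function.update u q y)
    rw [sum_comm, this, sum_comm, sum_update]
    ring
  rw [e2 fun v => sgn ((α + ri (Equiv.swap p q) α) v)] at h1
  have hV : (0 : ℝ) < Fintype.card V := by exact_mod_cast Fintype.card_pos
  refine le_of_mul_le_mul_left ?_ (pow_pos hV 2)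
  calc _ = (Fintype.card V : ℝ) ^ (k + 2) := by ring
    _ ≤ _ := h1
    _ = _ := by ring

/-- The family `𝓑` of bipartitions is suited to symmetrization. -/
structure Adequate (𝓑 : Finset (Finset (Fin k))) : Prop where
  generic : Generic 𝓑
  covers : Covers 𝓑
  nonempty : ∀ P ∈ 𝓑, P.Nonempty ∧ Pᶜ.Nonempty
  acts : ∀ p q : Fin k, Acts 𝓑 (Equiv.swap p q)

lemma acts_id (𝓑 : Finset (Finset (Fin k))) : Acts 𝓑 id :=
  ⟨fun _ => rfl, fun P hP => by simp [act, hP]⟩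

lemma act_id {𝓑 : Finset (Finset (Fin k))} {P : Finset (Fin k)} (hP : P ∈ 𝓑) :
    act 𝓑 id P = P := by simp [act, hP]

lemma exists_swap_invariant {𝓑 : Finset (Finset (Fin k))} (h𝓑 : Adequate 𝓑) (hk : 2 ≤ k)
    {p q : Fin k} (hpq : p ≠ q)
    (hsep : ∀ P ∈ 𝓑, (p ∈ P ∧ q ∉ P) ↔
      (q ∈ act 𝓑 (Equiv.swap p q) P ∧ p ∉ act 𝓑 (Equiv.swap p q) P)) :
    Step k (fun _ _ => True) fun _ α => ri (Equiv.swap p q) α = α := by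
  obtain ⟨F, hF, h⟩ := exists_swap_pr hpq
  refine ⟨fun s => k * (F s + 1 * (𝓑.card * (3 * F s) * (𝓑.card * (3 * F s)))) +
    (𝓑.card * F s + 𝓑.card * F s), by fun_prop, fun n s α hα hc _ => ?_⟩
  set m := α + ri (Equiv.swap p q) α with hm
  have hsw := h𝓑.acts p q
  obtain ⟨π, hπ, Q, hQ, e, hr⟩ := (h _ s α hα hc).decompose_relations h𝓑.generic h𝓑.covers
    [[id, Equiv.swap p q]]
    (by simpa using ⟨acts_id 𝓑, hsw⟩) (by
      simp only [List.mem_singleton, forall_eq, List.map_cons, List.map_nil, List.sum_cons,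
        List.sum_nil, add_zero, ri_id]
      rw [ri_add, ri_swap_swap, add_comm (ri _ α), add_self2])
  have hr' : ∀ P ∈ 𝓑, ri (Equiv.swap p q) (Q P) = Q (act 𝓑 (Equiv.swap p q) P) := fun P hP => by
    have := hr _ List.mem_cons_self _ (hsw.2 P hP).1
    simp only [List.map_cons, List.map_nil, List.sum_cons,
        List.sum_nil, add_zero, ri_id, (hsw.2 P hP).2, act_id (hsw.2 P hP).1] at this
    rw [← zero_add (ri _ (Q P)), ← this, add_add_cancel2]
  set H := ∑ P ∈ 𝓑 with p ∈ P ∧ q ∉ P, Q P with hH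
  set O := ∑ P ∈ 𝓑 with (p ∈ P ↔ q ∈ P), Q P with hO
  have hHs : ri (Equiv.swap p q) H = ∑ P ∈ 𝓑 with q ∈ P ∧ p ∉ P, Q P := by
    rw [hH, ri_sum]
    refine sum_bij' (fun P _ => act 𝓑 (Equiv.swap p q) P) (fun P _ => act 𝓑 (Equiv.swap p q) P)
      ?_ ?_ ?_ ?_ ?_
    · intro P hP
      obtain ⟨hP, h1⟩ := mem_filter.1 hP
      exact mem_filter.2 ⟨(hsw.2 P hP).1, (hsep P hP).1 h1⟩
    · intro P hP
      obtain ⟨hP, h1⟩ := mem_filter.1 hP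
      refine mem_filter.2 ⟨(hsw.2 P hP).1, (hsep _ (hsw.2 P hP).1).2 ?_⟩
      rwa [(hsw.2 P hP).2]
    · exact fun P hP => (hsw.2 P (mem_filter.1 hP).1).2
    · exact fun P hP => (hsw.2 P (mem_filter.1 hP).1).2
    · exact fun P hP => hr' P (mem_filter.1 hP).1
  have hmO : pb π m = O + (H + ri (Equiv.swap p q) H) := by
    rw [hHs, e, hO, hH, ← sum_filter_add_sum_filter_not 𝓑 fun P => (p ∈ P ↔ q ∈ P)]
    congr 1
    rw [← sum_union]
    · refine sum_congr ?_ fun _ _ => rfl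
      ext P
      simp only [mem_filter, mem_union]
      tauto
    · rw [disjoint_left]
      intro P h1 h2
      simp only [mem_filter] at h1 h2
      tauto
  have hOm : O = pb π m + (H + ri (Equiv.swap p q) H) := by
    rw [hmO, add_add_cancel2]
  have hT : trunc p q O + ri (Equiv.swap p q) (trunc p q O) = O := by
    refine trunc_add_ri_swap (T := univ) (ML.sum fun P hP => (hQ P (mem_filter.1 hP).1).ml)
      (mem_univ _) (mem_univ _) hpq ?_ fun x hx => ?_
    · rw [hOm, ri_add, ri_add, ri_swap_swap, ← pb_ri, hm, ri_add, ri_swap_swap,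
        add_comm (ri _ α), add_comm (ri _ H)]
    · rw [hOm, Pi.add_apply, ri_eq_zero_of_diag H x hx, hm, pb_add, pb_ri,
        ri_eq_zero_of_diag _ x hx, add_zero]
  have hdp : ∀ P ∈ 𝓑, ∀ g : (Fin k → Fin n → ZMod 2) → ZMod 2, Dec P (F s) g → PR univ (F s) g :=
    fun P hP g hg => hg.pr (h𝓑.nonempty P hP).1 (h𝓑.nonempty P hP).2
  have hHp : PR univ (𝓑.card * F s) H := (PR.sum _ fun P hP =>
    hdp P (mem_filter.1 hP).1 _ (hQ P (mem_filter.1 hP).1)).mono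
      (Nat.mul_le_mul_right _ (card_filter_le _ _))
  have hOp : PR univ (𝓑.card * F s) (trunc p q O) := by
    rw [hO, trunc_sum]
    refine (PR.sum _ fun P hP => hdp P (mem_filter.1 hP).1 _
      ((hQ P (mem_filter.1 hP).1).trunc hpq ?_)).mono
      (Nat.mul_le_mul_right _ (card_filter_le _ _))
    have := (mem_filter.1 hP).2
    tauto
  have hHO := hHp.add hOp
  refine ⟨pb π α + (H + trunc p q O), (hα.pb π).add hHO.ml, ?_, ?_⟩
  · rw [← add_assoc]
    exact (hπ.pr hα hk).add hHO
  · have e1 : pb π α + ri (Equiv.swap p q) (pb π α) =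
      (H + trunc p q O) + ri (Equiv.swap p q) (H + trunc p q O) := by
      rw [← pb_ri, ← pb_add, ← hm, hmO, ri_add]
      conv_lhs => rw [← hT]
      abel
    show ri (Equiv.swap p q) (pb π α + (H + trunc p q O)) = pb π α + (H + trunc p q O)
    rw [ri_add, ← add_add_cancel2 (ri (Equiv.swap p q) (pb π α)) (pb π α),
      add_comm (ri (Equiv.swap p q) (pb π α)), e1]
    generalize ri (Equiv.swap p q) (H + trunc p q O) = a
    generalize H + trunc p q O = b
    have := add_self2 a
    calc b + a + pb π α + a = pb π α + b + (a + a) := by abel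
      _ = _ := by rw [this, add_zero]

/-- Invariance under permutations of the first three variables. -/
def Inv3 {k : ℕ} {V : Type} (α : (Fin (k + 3) → V) → ZMod 2) : Prop :=
  ri (Equiv.swap 0 1) α = α ∧ ri (Equiv.swap 1 2) α = α ∧ ri (Equiv.swap 0 2) α = α

lemma exists_inv3 {m : ℕ} (hm : m = 1 ∨ m = 2) :
    Step (m + 3) (fun _ α => ri (Equiv.swap 0 1) α = α) fun _ α => Inv3 α := by
  have h02 : (0 : Fin (m + 3)) ≠ 2 := by rcases hm with rfl | rfl <;> decide
  have h12 : (1 : Fin (m + 3)) ≠ 2 := by rcases hm with rfl | rfl <;> decide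
  obtain ⟨F, hF, h⟩ := exists_swap_pr h02
  obtain ⟨F', hF', h'⟩ := exists_swap_pr h12
  refine ⟨fun s => F s + F' s, by fun_prop, fun n s α hα hc h01 => ?_⟩
  have e := (h _ s α hα hc).add (h' _ s α hα hc)
  refine ⟨α + (ri (Equiv.swap 0 2) α + ri (Equiv.swap 1 2) α),
    hα.add ((hα.ri_univ (Equiv.bijective _)).add (hα.ri_univ (Equiv.bijective _))), ?_, ?_⟩
  · convert e using 1
    calc α + (α + _) = (α + α) + _ := (add_assoc _ _ _).symm
      _ = (α + α) + (ri (Equiv.swap 0 2) α + ri (Equiv.swap 1 2) α) := rfl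
      _ = _ := by abel
  · have key : ∀ f g g' : Equiv.Perm (Fin (m + 3)), (∀ i, f (g i) = g' (Equiv.swap 0 1 i)) →
        ri f (ri g α) = ri g' α := fun f g g' hfg => by
      rw [ri_ri, show (f ∘ g : Fin (m + 3) → Fin (m + 3)) = g' ∘ Equiv.swap 0 1 from funext hfg,
        ← ri_ri, h01]
    have k1 := key (Equiv.swap 0 1) (Equiv.swap 0 2) (Equiv.swap 1 2)
      (by rcases hm with rfl | rfl <;> decide)
    have k2 := key (Equiv.swap 0 1) (Equiv.swap 1 2) (Equiv.swap 0 2)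
      (by rcases hm with rfl | rfl <;> decide)
    have k3 := key (Equiv.swap 1 2) (Equiv.swap 0 2) (Equiv.swap 0 2)
      (by rcases hm with rfl | rfl <;> decide)
    have k4 := key (Equiv.swap 0 2) (Equiv.swap 1 2) (Equiv.swap 1 2)
      (by rcases hm with rfl | rfl <;> decide)
    refine ⟨?_, ?_, ?_⟩
    · simp only [ri_add, h01, k1, k2]; abel
    · simp only [ri_add, k3, ri_swap_swap]; abel
    · simp only [ri_add, k4, ri_swap_swap]; abel

end

section

lemma ri_trunc {k n : ℕ} {p q : Fin k} {f : Fin k → Fin k} (hf : f.Injective) (hp : f p = p)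
    (hq : f q = q) (φ : (Fin k → Fin n → ZMod 2) → ZMod 2) :
    ri f (trunc p q φ) = trunc p q (ri f φ) := by
  ext x
  simp only [ri, trunc, hp, hq]
  have e : ∀ u v, Function.update (Function.update (fun i => x (f i)) p u) q v =
      fun i => Function.update (Function.update x p u) q v (f i) := fun u v => by
    ext1 i
    rcases eq_or_ne i q with rfl | h1
    · simp [hq]
    have h1' : f i ≠ q := fun h => h1 (hf (h.trans hq.symm))
    rcases eq_or_ne i p with rfl | h2
    · simp [hp, h1]
    · have h2' : f i ≠ p := fun h => h2 (hf (h.trans hp.symm))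
      simp [h1, h2, h1', h2']
  simp only [e]

section five
variable {V : Type}

lemma exists_vec5 (x : Fin 5 → V) : ∃ a b c d e, x = ![a, b, c, d, e] :=
  ⟨x 0, x 1, x 2, x 3, x 4, by ext i; fin_cases i <;> rfl⟩

lemma ri_apply5 (i₀ i₁ i₂ i₃ i₄ : Fin 5) (φ : (Fin 5 → V) → ZMod 2) (x : Fin 5 → V) :
    ri ![i₀, i₁, i₂, i₃, i₄] φ x = φ ![x i₀, x i₁, x i₂, x i₃, x i₄] := by
  refine congrArg φ (funext fun i => ?_)
  fin_cases i <;> rfl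

lemma swap5_01 : ⇑(Equiv.swap (0 : Fin 5) 1) = ![1, 0, 2, 3, 4] := by decide
lemma swap5_02 : ⇑(Equiv.swap (0 : Fin 5) 2) = ![2, 1, 0, 3, 4] := by decide
lemma swap5_12 : ⇑(Equiv.swap (1 : Fin 5) 2) = ![0, 2, 1, 3, 4] := by decide
lemma swap5_13 : ⇑(Equiv.swap (1 : Fin 5) 3) = ![0, 3, 2, 1, 4] := by decide
lemma swap5_23 : ⇑(Equiv.swap (2 : Fin 5) 3) = ![0, 1, 3, 2, 4] := by decide
lemma swap5_34 : ⇑(Equiv.swap (3 : Fin 5) 4) = ![0, 1, 2, 4, 3] := by decide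
lemma swap5_04 : ⇑(Equiv.swap (0 : Fin 5) 4) = ![4, 1, 2, 3, 0] := by decide
lemma swap5_14 : ⇑(Equiv.swap (1 : Fin 5) 4) = ![0, 4, 2, 3, 1] := by decide
lemma swap5_24 : ⇑(Equiv.swap (2 : Fin 5) 4) = ![0, 1, 4, 3, 2] := by decide

/-- The two-element sets of variables. -/
def pairs5 : Finset (Finset (Fin 5)) :=
  {{0, 1}, {0, 2}, {0, 3}, {0, 4}, {1, 2}, {1, 3}, {1, 4}, {2, 3}, {2, 4}, {3, 4}}

set_option maxRecDepth 10000 in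
lemma pairs5_adequate : Adequate pairs5 where
  generic := by unfold Generic; decide
  covers := by unfold Covers; decide
  nonempty := by decide
  acts := by unfold Acts; decide +kernel

lemma sum_pairs5 (Q : Finset (Fin 5) → (Fin 5 → V) → ZMod 2) : ∑ P ∈ pairs5, Q P =
    Q {0, 1} + Q {0, 2} + Q {0, 3} + Q {0, 4} + Q {1, 2} + Q {1, 3} + Q {1, 4} + Q {2, 3} +
      Q {2, 4} + Q {3, 4} := by
  unfold pairs5
  repeat rw [sum_insert (by decide)]
  rw [sum_singleton]
  abel

set_option maxRecDepth 10000 in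
lemma exists_swap_invariant5 : Step 5 (fun _ _ => True)
    fun _ α => ri (Equiv.swap 0 1) α = α :=
  exists_swap_invariant pairs5_adequate (by norm_num) (by decide) (by decide)

end five

end

section

/-- Vanishing of a short list of permuted forms, for a decomposition along `pairs5`. -/
lemma list_relation {k : ℕ} {V : Type} {𝓑 : Finset (Finset (Fin k))}
    {Ls : List (List (Fin k → Fin k))} {Q : Finset (Fin k) → (Fin k → V) → ZMod 2}
    (h : ∀ L ∈ Ls, ∀ P ∈ 𝓑, (L.map fun f => ri f (Q (act 𝓑 f P))).sum = 0)
    {L : List (Fin k → Fin k)} (hL : L ∈ Ls) {P : Finset (Fin k)} (hP : P ∈ 𝓑)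
    (x : Fin k → V) : (L.map fun f => ri f (Q (act 𝓑 f P)) x).sum = 0 := by
  have h1 := congrFun (h L hL P hP) x
  have : ∀ L : List (Fin k → Fin k), (L.map fun f => ri f (Q (act 𝓑 f P))).sum x =
      (L.map fun f => ri f (Q (act 𝓑 f P)) x).sum := by
    intro L
    induction L with
    | nil => rfl
    | cons f L ih => simp only [List.map_cons, List.sum_cons, Pi.add_apply, ih]
  rw [← this, h1, Pi.zero_apply]

lemma eq_of_add_eq_zero2 {x y : ZMod 2} (h : x + y = 0) : x = y := by grind

section
variable {V : Type} (φ : (Fin 5 → V) → ZMod 2) (a b c d e : V)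

lemma ri_swap5_01 : ri (Equiv.swap 0 1) φ ![a, b, c, d, e] = φ ![b, a, c, d, e] := by
  rw [swap5_01, ri_apply5]; rfl

lemma ri_swap5_02 : ri (Equiv.swap 0 2) φ ![a, b, c, d, e] = φ ![c, b, a, d, e] := by
  rw [swap5_02, ri_apply5]; rfl

lemma ri_swap5_12 : ri (Equiv.swap 1 2) φ ![a, b, c, d, e] = φ ![a, c, b, d, e] := by
  rw [swap5_12, ri_apply5]; rfl

lemma ri_swap5_13 : ri (Equiv.swap 1 3) φ ![a, b, c, d, e] = φ ![a, d, c, b, e] := by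
  rw [swap5_13, ri_apply5]; rfl

lemma ri_swap5_23 : ri (Equiv.swap 2 3) φ ![a, b, c, d, e] = φ ![a, b, d, c, e] := by
  rw [swap5_23, ri_apply5]; rfl

lemma ri_swap5_34 : ri (Equiv.swap 3 4) φ ![a, b, c, d, e] = φ ![a, b, c, e, d] := by
  rw [swap5_34, ri_apply5]; rfl

lemma ri_swap5_04 : ri (Equiv.swap 0 4) φ ![a, b, c, d, e] = φ ![e, b, c, d, a] := by
  rw [swap5_04, ri_apply5]; rfl

lemma ri_swap5_14 : ri (Equiv.swap 1 4) φ ![a, b, c, d, e] = φ ![a, e, c, d, b] := by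
  rw [swap5_14, ri_apply5]; rfl

lemma ri_swap5_24 : ri (Equiv.swap 2 4) φ ![a, b, c, d, e] = φ ![a, b, e, d, c] := by
  rw [swap5_24, ri_apply5]; rfl

end

section
variable {n : ℕ}

set_option maxRecDepth 10000 in
/-- A form of low partition rank satisfying the cocycle relations of a coboundary under the
transposition of the variables `2` and `3` is the coboundary of a form of low partition rank. -/
lemma exists_coboundary5 {s : ℕ} {m : (Fin 5 → Fin n → ZMod 2) → ZMod 2} (h : PR univ s m)
    (h01 : m + ri (Equiv.swap 0 1) m = 0) (h23 : m + ri (Equiv.swap 2 3) m = 0)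
    (hc : m + ri (Equiv.swap 1 2) m + ri (Equiv.swap 1 3) m = 0) :
    ∃ (π : (Fin n → ZMod 2) →ₗ[ZMod 2] (Fin n → ZMod 2))
      (ν : (Fin 5 → Fin n → ZMod 2) → ZMod 2),
      Codim (s + 3 * (10 * (3 * s) * (10 * (3 * s)))) π ∧ PR univ (20 * s) ν ∧
      ri (Equiv.swap 0 1) ν = ν ∧ ri (Equiv.swap 1 2) ν = ν ∧
      ν + ri (Equiv.swap 2 3) ν = pb π m := by
  obtain ⟨π, hπ, Q, hQ, e, hr⟩ := h.decompose_relations pairs5_adequate.generic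
    pairs5_adequate.covers [[id, Equiv.swap 0 1], [id, Equiv.swap 2 3],
      [id, Equiv.swap 1 2, Equiv.swap 1 3]]
    (by
      have := pairs5_adequate.acts
      have := acts_id pairs5
      simp [*]) (by
      simp only [List.forall_mem_cons, List.map_cons, List.map_nil, List.sum_cons,
        List.sum_nil, add_zero, ri_id, h01, h23, ← add_assoc, hc]
      simp)
  have r01 : ∀ P P' : Finset (Fin 5), P ∈ pairs5 → act pairs5 (Equiv.swap 0 1) P = P' →
      ∀ a b c d e, Q P ![a, b, c, d, e] = Q P' ![b, a, c, d, e] := by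
    rintro P P' hP rfl a b c d e
    have := list_relation hr (L := [id, Equiv.swap 0 1]) (by simp) hP ![a, b, c, d, e]
    simp only [List.map_cons, List.map_nil, List.sum_cons, List.sum_nil, add_zero, ri_id,
      act_id hP, ri_swap5_01] at this
    exact eq_of_add_eq_zero2 this
  have r23 : ∀ P P' : Finset (Fin 5), P ∈ pairs5 → act pairs5 (Equiv.swap 2 3) P = P' →
      ∀ a b c d e, Q P ![a, b, c, d, e] = Q P' ![a, b, d, c, e] := by
    rintro P P' hP rfl a b c d e
    have := list_relation hr (L := [id, Equiv.swap 2 3]) (by simp) hP ![a, b, c, d, e]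
    simp only [List.map_cons, List.map_nil, List.sum_cons, List.sum_nil, add_zero, ri_id,
      act_id hP, ri_swap5_23] at this
    exact eq_of_add_eq_zero2 this
  have rc : ∀ P P' P'' : Finset (Fin 5), P ∈ pairs5 → act pairs5 (Equiv.swap 1 2) P = P' →
      act pairs5 (Equiv.swap 1 3) P = P'' →
      ∀ a b c d e, Q P ![a, b, c, d, e] = Q P' ![a, c, b, d, e] + Q P'' ![a, d, c, b, e] := by
    rintro P P' P'' hP rfl rfl a b c d e
    have := list_relation hr (L := [id, Equiv.swap 1 2, Equiv.swap 1 3]) (by simp) hP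
      ![a, b, c, d, e]
    simp only [List.map_cons, List.map_nil, List.sum_cons, List.sum_nil, add_zero, ri_id,
      act_id hP, ri_swap5_12, ri_swap5_13] at this
    exact eq_of_add_eq_zero2 this
  have q12 := r01 {1, 2} {0, 2} (by decide) (by decide)
  have q03 := r23 {0, 3} {0, 2} (by decide) (by decide)
  have q13 := r01 {1, 3} {0, 3} (by decide) (by decide)
  have q24 := r23 {2, 4} {3, 4} (by decide) (by decide)
  have q04 := r01 {0, 4} {1, 4} (by decide) (by decide)
  have q01 := rc {0, 2} {0, 1} {0, 2} (by decide) (by decide) (by decide)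
  have q14 := rc {3, 4} {3, 4} {1, 4} (by decide) (by decide) (by decide)
  have q23 := rc {2, 3} {1, 3} {1, 2} (by decide) (by decide) (by decide)
  have q01' := r01 {0, 1} {0, 1} (by decide) (by decide)
  have q01'' := r23 {0, 1} {0, 1} (by decide) (by decide)
  have q34' := r01 {3, 4} {3, 4} (by decide) (by decide)
  have q03' := rc {0, 3} {0, 3} {0, 1} (by decide) (by decide) (by decide)
  have q23' := r01 {2, 3} {2, 3} (by decide) (by decide)
  clear r01 r23 rc
  set E := Q {0, 2} with hE
  set U := Q {3, 4} with hU
  set W := E + ri (Equiv.swap 0 2) E with hW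
  set N' := trunc 0 2 W with hN'
  set N := E + N' with hN
  have dE : Dec {0, 2} s E := hQ _ (by decide)
  have dW : Dec {0, 2} (s + s) W := dE.add (by
    simpa [show image (Equiv.swap (0 : Fin 5) 2) {0, 2} = {0, 2} by decide] using
      dE.ri (Equiv.swap (0 : Fin 5) 2).bijective)
  have dN' : Dec {0, 2} (s + s) N' := dW.trunc (by decide) (by decide)
  have dN : Dec {0, 2} (s + (s + s)) N := dE.add dN'
  have pU : PR univ s U := (hQ {3, 4} (by decide)).pr (by decide) (by decide)
  have pN := dN.pr (by decide) (by decide)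
  have pN' := dN'.pr (by decide) (by decide)
  have hNW : N' + ri (Equiv.swap 0 2) N' = W := by
    refine trunc_add_ri_swap dW.ml (mem_univ _) (mem_univ _) (by decide) ?_ fun x hx => ?_
    · rw [hW, ri_add, ri_swap_swap, add_comm]
    · exact ri_eq_zero_of_diag E x hx
  have hNs : ri (Equiv.swap 1 3) N' = N' := by
    rw [hN', ri_trunc (Equiv.injective _) (by decide) (by decide)]
    congr 1
    ext x
    obtain ⟨a, b, c, d, e, rfl⟩ := exists_vec5 x
    simp only [hW, ri_swap5_13, Pi.add_apply, ri_swap5_02]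
    have h1 := q01 a d c b e
    have h2 := q01 c d a b e
    have h3 := q01' a c d b e
    grind
  have k1 : ∀ a b c d e, N' ![a, b, c, d, e] = N' ![a, d, c, b, e] := fun a b c d e => by
    conv_lhs => rw [← hNs, swap5_13, ri_apply5]
    rfl
  have k2 : ∀ a b c d e, N' ![a, b, c, d, e] + N' ![c, b, a, d, e] =
      E ![a, b, c, d, e] + E ![c, b, a, d, e] := fun a b c d e => by
    have := congrFun hNW ![a, b, c, d, e]
    rw [hW] at this
    simpa only [Pi.add_apply, ri_swap5_02] using this
  have k3 : ∀ a b c d e, N ![a, b, c, d, e] = E ![a, b, c, d, e] + N' ![a, b, c, d, e] :=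
    fun a b c d e => rfl
  clear_value N N' W
  refine ⟨π, ri ![1, 2, 3, 0, 4] U + ri ![0, 2, 3, 1, 4] U + ri ![0, 1, 3, 2, 4] U +
    ri ![0, 2, 1, 3, 4] N + ri ![0, 1, 2, 3, 4] N + ri ![1, 0, 2, 3, 4] N +
    ri ![0, 1, 3, 2, 4] N' + ri ![1, 0, 3, 2, 4] N' + ri ![2, 0, 3, 1, 4] N', hπ, ?_, ?_, ?_, ?_⟩
  · refine PR.mono (((((((((pU.ri ?_).add (pU.ri ?_)).add (pU.ri ?_)).add (pN.ri ?_)).add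
      (pN.ri ?_)).add (pN.ri ?_)).add (pN'.ri ?_)).add (pN'.ri ?_)).add (pN'.ri ?_)) (by omega) <;>
    decide
  · ext x
    obtain ⟨a, b, c, d, e, rfl⟩ := exists_vec5 x
    rw [ri_swap5_01]
    simp only [Pi.add_apply, ri_apply5, Matrix.cons_val]
    grind
  · ext x
    obtain ⟨a, b, c, d, e, rfl⟩ := exists_vec5 x
    rw [ri_swap5_12]
    simp only [Pi.add_apply, ri_apply5, Matrix.cons_val]
    grind
  · rw [e, sum_pairs5]
    ext x
    obtain ⟨a, b, c, d, e, rfl⟩ := exists_vec5 x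
    rw [Pi.add_apply, ri_swap5_23]
    simp only [Pi.add_apply, ri_apply5, Matrix.cons_val]
    simp only [k3, q12, q13, q03, q24, q04, q23]
    have h1 := q01 a c b d e
    have h2 := q14 a d c b e
    have h3 := q14 b d c a e
    have h4 := k2 c a d b e
    have h5 := k1 a b c d e
    have h6 := k1 a b d c e
    have h7 := k1 b a d c e
    have h8 := k1 a c b d e
    have h9 := k1 b a c d e
    have h10 := k1 c a d b e
    clear * - h1 h2 h3 h4 h5 h6 h7 h8 h9 h10
    grind

end

end

section

lemma exists_inv4 : Step 5 (fun _ α => Inv3 (k := 2) α) fun _ α => ri (Equiv.swap 0 1) α = α ∧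
    ri (Equiv.swap 1 2) α = α ∧ ri (Equiv.swap 2 3) α = α := by
  obtain ⟨F, hF, h⟩ := exists_swap_pr (show (2 : Fin 5) ≠ 3 by decide)
  refine ⟨fun s => 5 * (F s + 3 * (10 * (3 * F s) * (10 * (3 * F s)))) + 20 * F s, by fun_prop,
    fun n s α hα hc hi => ?_⟩
  have s01 : ∀ a b c d e, α ![a, b, c, d, e] = α ![b, a, c, d, e] := fun a b c d e => by
    conv_lhs => rw [← hi.1]
    exact ri_swap5_01 ..
  have s12 : ∀ a b c d e, α ![a, b, c, d, e] = α ![a, c, b, d, e] := fun a b c d e => by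
    conv_lhs => rw [← hi.2.1]
    exact ri_swap5_12 ..
  obtain ⟨π, ν, hπ, hν, n1, n2, e⟩ := exists_coboundary5 (h _ s α hα hc) (by
      ext x
      obtain ⟨a, b, c, d, e, rfl⟩ := exists_vec5 x
      simp only [Pi.add_apply, Pi.zero_apply, ri_swap5_01, ri_swap5_23]
      grind) (by
      ext x
      obtain ⟨a, b, c, d, e, rfl⟩ := exists_vec5 x
      simp only [Pi.add_apply, Pi.zero_apply, ri_swap5_23]
      grind) (by
      ext x
      obtain ⟨a, b, c, d, e, rfl⟩ := exists_vec5 x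
      simp only [Pi.add_apply, Pi.zero_apply, ri_swap5_12, ri_swap5_13, ri_swap5_23]
      grind)
  refine ⟨pb π α + ν, (hα.pb π).add hν.ml, ?_, ?_, ?_, ?_⟩
  · rw [← add_assoc]
    exact (hπ.pr hα (by norm_num)).add hν
  · rw [ri_add, ← pb_ri, hi.1, n1]
  · rw [ri_add, ← pb_ri, hi.2.1, n2]
  · rw [pb_add] at e
    ext x
    have := congrFun e x
    simp only [ri_add, ← pb_ri, Pi.add_apply] at this ⊢
    grind

/-- Invariance under all permutations of the variables. -/
def FullSym {k : ℕ} {V : Type} (α : (Fin k → V) → ZMod 2) : Prop :=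
  ∀ f : Equiv.Perm (Fin k), ri f α = α

lemma FullSym.of_swap {k : ℕ} {V : Type} {α : (Fin (k + 1) → V) → ZMod 2}
    (h : ∀ i : Fin k, ri (Equiv.swap i.castSucc i.succ) α = α) : FullSym α := by
  intro f
  have : f ∈ Submonoid.closure
      (Set.range fun i : Fin k => Equiv.swap i.castSucc i.succ) := by
    rw [Equiv.Perm.mclosure_swap_castSucc_succ]; trivial
  induction this using Submonoid.closure_induction with
  | mem f hf => obtain ⟨i, rfl⟩ := hf; exact h i
  | one => rfl
  | mul f g _ _ hf hg =>
    conv_rhs => rw [← hf, ← hg, ri_ri]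
    rfl

lemma exists_sym5 : Step 5 (fun _ α => ri (Equiv.swap 0 1) α = α ∧
    ri (Equiv.swap 1 2) α = α ∧ ri (Equiv.swap 2 3) α = α) fun _ α => FullSym α := by
  obtain ⟨F₀, hF₀, h₀⟩ := exists_swap_pr (show (0 : Fin 5) ≠ 4 by decide)
  obtain ⟨F₁, hF₁, h₁⟩ := exists_swap_pr (show (1 : Fin 5) ≠ 4 by decide)
  obtain ⟨F₂, hF₂, h₂⟩ := exists_swap_pr (show (2 : Fin 5) ≠ 4 by decide)
  obtain ⟨F₃, hF₃, h₃⟩ := exists_swap_pr (show (3 : Fin 5) ≠ 4 by decide)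
  refine ⟨fun s => F₀ s + F₁ s + (F₂ s + F₃ s), by fun_prop, fun n s α hα hc hi => ?_⟩
  have s01 : ∀ a b c d e, α ![a, b, c, d, e] = α ![b, a, c, d, e] := fun a b c d e => by
    conv_lhs => rw [← hi.1]
    exact ri_swap5_01 ..
  have s12 : ∀ a b c d e, α ![a, b, c, d, e] = α ![a, c, b, d, e] := fun a b c d e => by
    conv_lhs => rw [← hi.2.1]
    exact ri_swap5_12 ..
  have s23 : ∀ a b c d e, α ![a, b, c, d, e] = α ![a, b, d, c, e] := fun a b c d e => by
    conv_lhs => rw [← hi.2.2]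
    exact ri_swap5_23 ..
  have hml : ∀ p q : Fin 5, ML univ (ri (Equiv.swap p q) α) := fun p q =>
    hα.ri_univ (Equiv.bijective _)
  refine ⟨α + ri (Equiv.swap 0 4) α + ri (Equiv.swap 1 4) α + (ri (Equiv.swap 2 4) α +
    ri (Equiv.swap 3 4) α), ((hα.add (hml _ _)).add (hml _ _)).add ((hml _ _).add (hml _ _)),
    ?_, FullSym.of_swap fun i => ?_⟩
  · convert ((h₀ _ s α hα hc).add (h₁ _ s α hα hc)).add
      ((h₂ _ s α hα hc).add (h₃ _ s α hα hc)) using 1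
    ext x
    simp only [Pi.add_apply]
    grind
  · have e : ∀ a b c d e, (α + ri (Equiv.swap 0 4) α + ri (Equiv.swap 1 4) α +
        (ri (Equiv.swap 2 4) α + ri (Equiv.swap 3 4) α)) ![a, b, c, d, e] =
        α ![a, b, c, d, e] + α ![b, c, d, e, a] + α ![a, c, d, e, b] + α ![a, b, d, e, c] +
          α ![a, b, c, e, d] := fun a b c d e => by
      simp only [Pi.add_apply, ri_swap5_04, ri_swap5_14, ri_swap5_24, ri_swap5_34]
      rw [s01 e b, s12 b e, s23 b c e, s12 a e, s23 a c e, s23 a b e]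
      abel
    ext x
    obtain ⟨a, b, c, d, f, rfl⟩ := exists_vec5 x
    fin_cases i
    · refine (ri_swap5_01 ..).trans ?_
      rw [e, e, s01 b a c d f, s01 b a d f c, s01 b a c f d]
      abel
    · refine (ri_swap5_12 ..).trans ?_
      rw [e, e, s12 a c b d f, s01 c b d f a, s12 a c b f d]
      abel
    · refine (ri_swap5_23 ..).trans ?_
      rw [e, e, s23 a b d c f, s12 b d c f a, s12 a d c f b]
      abel
    · refine (ri_swap5_34 ..).trans ?_
      rw [e, e, s23 b c f d a, s23 a c f d b, s23 a b f d c]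
      abel

end

section

section tensor
variable {V : Type} [AddCommGroup V] [Module (ZMod 2) V]

/-- Bilinear forms, as functions on pairs. -/
def bilinFun (V : Type) [AddCommGroup V] [Module (ZMod 2) V] :
    (V →ₗ[ZMod 2] V →ₗ[ZMod 2] ZMod 2) →ₗ[ZMod 2] (V × V → ZMod 2) where
  toFun B p := B p.1 p.2
  map_add' _ _ := rfl
  map_smul' _ _ := rfl

/-- The symmetric bilinear forms. -/
def symBilin (V : Type) [AddCommGroup V] [Module (ZMod 2) V] :
    Submodule (ZMod 2) (V →ₗ[ZMod 2] V →ₗ[ZMod 2] ZMod 2) where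
  carrier := {B | ∀ x y, B x y = B y x}
  add_mem' hB hB' x y := by simp [hB x y, hB' x y]
  zero_mem' _ _ := rfl
  smul_mem' c B hB x y := by simp [hB x y]

variable {s : ℕ}

/-- A tensor of two bilinear forms which is symmetric in the last two variables is a sum of products
with symmetric second factors. -/
lemma exists_symm_factors (β γ : Fin s → V →ₗ[ZMod 2] V →ₗ[ZMod 2] ZMod 2)
    (h : ∀ x y z w, ∑ i, β i x y * γ i z w = ∑ i, β i x y * γ i w z) :
    ∃ β' γ' : Fin s → V →ₗ[ZMod 2] V →ₗ[ZMod 2] ZMod 2, (∀ i, γ' i ∈ symBilin V) ∧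
      ∀ x y z w, ∑ i, β i x y * γ i z w = ∑ i, β' i x y * γ' i z w := by
  have : Inhabited (V × V) := ⟨0⟩
  obtain ⟨ys, C, hC, e⟩ := exists_dual_points (LinearMap.range (bilinFun V)) s
    (fun i => bilinFun V (β i)) fun i => ⟨_, rfl⟩
  choose β' hβ' using hC
  refine ⟨β', fun i => ∑ j, β j (ys i).1 (ys i).2 • γ j, fun i x y => ?_, fun x y z w => ?_⟩
  · simpa [LinearMap.sum_apply] using h (ys i).1 (ys i).2 x y
  · have e' : ∀ j, β j x y = ∑ i, β' i x y * β j (ys i).1 (ys i).2 := fun j => by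
      have := e j (x, y)
      simp only [← hβ'] at this
      exact this
    simp only [LinearMap.sum_apply, LinearMap.smul_apply, smul_eq_mul, mul_sum]
    rw [sum_comm]
    refine sum_congr rfl fun j _ => ?_
    rw [e', sum_mul]
    exact sum_congr rfl fun i _ => by ring

/-- A symmetric tensor of symmetric bilinear forms is a square up to the symmetrization of a
tensor. -/
lemma exists_square_add (β γ : Fin s → V →ₗ[ZMod 2] V →ₗ[ZMod 2] ZMod 2)
    (h : ∀ x y z w, ∑ i, β i x y * γ i z w = ∑ i, β i x y * γ i w z)
    (hs : ∀ x y z w, ∑ i, β i x y * γ i z w = ∑ i, β i z w * γ i x y) :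
    ∃ b ∈ symBilin V, ∃ σ ρ : Fin s → V →ₗ[ZMod 2] V →ₗ[ZMod 2] ZMod 2,
      (∀ i, σ i ∈ symBilin V) ∧ ∀ x y z w, ∑ i, β i x y * γ i z w =
        b x y * b z w + ∑ i, (σ i x y * ρ i z w + σ i z w * ρ i x y) := by
  obtain ⟨β', γ', hγ', e⟩ := exists_symm_factors β γ h
  simp only [e] at hs ⊢
  clear e h
  have : Inhabited (V × V) := ⟨0⟩
  obtain ⟨ys, C, hC, e⟩ := exists_dual_points ((symBilin V).map (bilinFun V)) s
    (fun i => bilinFun V (γ' i)) fun i => ⟨_, hγ' i, rfl⟩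
  choose σ hσ hσ' using hC
  have e' : ∀ j x y, γ' j x y = ∑ i, σ i x y * γ' j (ys i).1 (ys i).2 := fun j x y => by
    have := e j (x, y)
    simp only [← hσ'] at this
    exact this
  clear e hσ' C
  set T : V → V → V → V → ZMod 2 := fun x y z w => ∑ i, β' i x y * γ' i z w with hT
  have t1 : ∀ x y z w, T x y z w = ∑ j, σ j z w * T x y (ys j).1 (ys j).2 := fun x y z w => by
    simp only [hT, mul_sum]
    rw [sum_comm]
    refine sum_congr rfl fun j _ => ?_
    rw [e', mul_sum]
    exact sum_congr rfl fun i _ => by ring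
  set c : Fin s → Fin s → ZMod 2 := fun i j => T (ys j).1 (ys j).2 (ys i).1 (ys i).2 with hc
  have hcs : ∀ i j, c i j = c j i := fun i j => hs _ _ _ _
  have t2 : ∀ x y z w, T x y z w = ∑ j, ∑ i, c i j * (σ i x y * σ j z w) := fun x y z w => by
    rw [t1]
    refine sum_congr rfl fun j _ => ?_
    rw [show T x y (ys j).1 (ys j).2 = T (ys j).1 (ys j).2 x y from hs .., t1, mul_sum]
    exact sum_congr rfl fun i _ => by simp only [hc]; ring
  have hT' : ∀ x y z w, ∑ i, β' i x y * γ' i z w = T x y z w := fun _ _ _ _ => rfl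
  clear_value T c
  refine ⟨∑ i, c i i • σ i, Submodule.sum_mem _ fun i _ => Submodule.smul_mem _ _ (hσ i), σ,
    fun i => ∑ j, (if i < j then c i j + c i i * c j j else 0) • σ j, hσ, fun x y z w => ?_⟩
  rw [hT', t2]
  simp only [LinearMap.sum_apply, LinearMap.smul_apply, smul_eq_mul, mul_sum, sum_mul,
    sum_add_distrib]
  have e3 : ∀ f : Fin s → Fin s → ZMod 2, ∑ j, ∑ i, f i j =
      ∑ i, ∑ j, if i < j then f i j + f j i else if i = j then f i i else 0 := by
    intro f
    have : ∀ i j, (if i < j then f i j + f j i else if i = j then f i i else 0) =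
        (if i ≤ j then f i j else 0) + (if i < j then f j i else 0) := fun i j => by
      rcases lt_trichotomy i j with h | rfl | h
      · simp [h, h.le]
      · simp
      · simp [h.not_ge, h.not_gt, h.ne']
    simp only [this, sum_add_distrib]
    rw [sum_comm (f := fun i j => if i < j then f j i else 0), ← sum_add_distrib, sum_comm]
    refine sum_congr rfl fun i _ => ?_
    rw [← sum_add_distrib]
    refine sum_congr rfl fun j _ => ?_
    rcases le_or_gt i j with h | h
    · simp [h, h.not_gt]
    · simp [h, h.not_ge]
  rw [e3 fun i j => c i j * (σ i x y * σ j z w),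
    e3 fun i j => c i i * σ i x y * (c j j * σ j z w), ← sum_add_distrib, ← sum_add_distrib]
  refine sum_congr rfl fun i _ => ?_
  rw [← sum_add_distrib, ← sum_add_distrib]
  refine sum_congr rfl fun j _ => ?_
  have q : ∀ a : ZMod 2, a * a = a := by decide
  have h1 := hcs i j
  have h2 := q (c i i)
  generalize c i i = u, c j j = v, c i j = p, c j i = r, σ i x y = a, σ i z w = b,
    σ j x y = d, σ j z w = e at *
  clear * - h1 h2
  split_ifs <;> grind

end tensor

end

section

section four
variable {V : Type}

lemma exists_vec4 (x : Fin 4 → V) : ∃ a b c d, x = ![a, b, c, d] :=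
  ⟨x 0, x 1, x 2, x 3, by ext i; fin_cases i <;> rfl⟩

lemma ri_apply4 (i₀ i₁ i₂ i₃ : Fin 4) (φ : (Fin 4 → V) → ZMod 2) (x : Fin 4 → V) :
    ri ![i₀, i₁, i₂, i₃] φ x = φ ![x i₀, x i₁, x i₂, x i₃] := by
  refine congrArg φ (funext fun i => ?_)
  fin_cases i <;> rfl

lemma swap4_01 : ⇑(Equiv.swap (0 : Fin 4) 1) = ![1, 0, 2, 3] := by decide
lemma swap4_02 : ⇑(Equiv.swap (0 : Fin 4) 2) = ![2, 1, 0, 3] := by decide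
lemma swap4_12 : ⇑(Equiv.swap (1 : Fin 4) 2) = ![0, 2, 1, 3] := by decide
lemma swap4_13 : ⇑(Equiv.swap (1 : Fin 4) 3) = ![0, 3, 2, 1] := by decide
lemma swap4_23 : ⇑(Equiv.swap (2 : Fin 4) 3) = ![0, 1, 3, 2] := by decide

variable (φ : (Fin 4 → V) → ZMod 2) (a b c d : V)

lemma ri_swap4_01 : ri (Equiv.swap 0 1) φ ![a, b, c, d] = φ ![b, a, c, d] := by
  rw [swap4_01, ri_apply4]; rfl

lemma ri_swap4_02 : ri (Equiv.swap 0 2) φ ![a, b, c, d] = φ ![c, b, a, d] := by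
  rw [swap4_02, ri_apply4]; rfl

lemma ri_swap4_12 : ri (Equiv.swap 1 2) φ ![a, b, c, d] = φ ![a, c, b, d] := by
  rw [swap4_12, ri_apply4]; rfl

lemma ri_swap4_13 : ri (Equiv.swap 1 3) φ ![a, b, c, d] = φ ![a, d, c, b] := by
  rw [swap4_13, ri_apply4]; rfl

lemma ri_swap4_23 : ri (Equiv.swap 2 3) φ ![a, b, c, d] = φ ![a, b, d, c] := by
  rw [swap4_23, ri_apply4]; rfl

/-- Representatives of the splits of four variables into two pairs. -/
def pairs4 : Finset (Finset (Fin 4)) := {{0, 1}, {0, 2}, {1, 2}}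

set_option maxRecDepth 10000 in
lemma pairs4_adequate : Adequate pairs4 where
  generic := by unfold Generic; decide
  covers := by unfold Covers; decide
  nonempty := by decide
  acts := by unfold Acts; decide +kernel

lemma sum_pairs4 (Q : Finset (Fin 4) → (Fin 4 → V) → ZMod 2) : ∑ P ∈ pairs4, Q P =
    Q {0, 1} + Q {0, 2} + Q {1, 2} := by
  unfold pairs4
  repeat rw [sum_insert (by decide)]
  rw [sum_singleton]
  abel

set_option maxRecDepth 10000 in
lemma exists_swap_invariant4 : Step 4 (fun _ _ => True)
    fun _ α => ri (Equiv.swap 0 1) α = α :=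
  exists_swap_invariant pairs4_adequate (by norm_num) (by decide) (by decide)

end four

lemma exists_bilin_of_dec {V : Type} [AddCommGroup V] [Module (ZMod 2) V] {s : ℕ}
    {g : (Fin 4 → V) → ZMod 2} (h : Dec {0, 2} s g) :
    ∃ β γ : Fin s → V →ₗ[ZMod 2] V →ₗ[ZMod 2] ZMod 2,
      ∀ x y z w, g ![x, z, y, w] = ∑ i, β i x y * γ i z w := by
  obtain ⟨b, c, hb, hc, rfl⟩ := h
  choose β hβ using fun i => (hb i).exists_bilin_update (p := 0) (q := 2) (by decide) (by decide)
    (by decide) 0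
  choose γ hγ using fun i => (hc i).exists_bilin_update (p := 1) (q := 3) (by decide) (by decide)
    (by decide) 0
  refine ⟨β, γ, fun x y z w => ?_⟩
  rw [Finset.sum_apply]
  refine sum_congr rfl fun i _ => ?_
  rw [Pi.mul_apply, ← hβ, ← hγ]
  congr 1
  · refine (hb i).1 _ _ fun j hj => ?_
    fin_cases j
    · rfl
    · simp at hj
    · rfl
    · simp at hj
  · refine (hc i).1 _ _ fun j hj => ?_
    fin_cases j
    · simp at hj
    · rfl
    · simp at hj
    · rfl

section
variable {n : ℕ}

/-- A tensor with the symmetries coming from a coboundary is, up to a square, the symmetrization of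
a tensor with symmetric first factors. -/
lemma exists_square_of_dec {s : ℕ} {E : (Fin 4 → Fin n → ZMod 2) → ZMod 2} (hE : Dec {0, 2} s E)
    (hs : ∀ a b c d, E ![a, b, c, d] = E ![b, a, d, c])
    (hd : ∀ a b c d, E ![a, b, c, d] + E ![c, b, a, d] + E ![a, d, c, b] + E ![c, d, a, b] = 0) :
    ∃ b ∈ symBilin (Fin n → ZMod 2),
      ∃ σ ρ : Fin (s + (s + s) + (s + s) + (s + s)) →
        (Fin n → ZMod 2) →ₗ[ZMod 2] (Fin n → ZMod 2) →ₗ[ZMod 2] ZMod 2,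
      (∀ i, σ i ∈ symBilin _) ∧ ∀ x y z w, E ![x, z, y, w] =
        b x y * b z w + ∑ i, (σ i x y * ρ i z w + σ i z w * ρ i x y) := by
  set W := E + ri (Equiv.swap 0 2) E with hW
  set N := trunc 0 2 W with hN
  set D := E + N + ri ![1, 0, 3, 2] N with hD
  have dW : Dec {0, 2} (s + s) W := hE.add (by
    simpa [show image (Equiv.swap (0 : Fin 4) 2) {0, 2} = {0, 2} by decide] using
      hE.ri (Equiv.swap (0 : Fin 4) 2).bijective)
  have dN : Dec {0, 2} (s + s) N := dW.trunc (by decide) (by decide)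
  have dD : Dec {0, 2} (s + (s + s) + (s + s)) D := by
    refine (hE.add dN).add ?_
    have := (dN.ri (f := ![1, 0, 3, 2]) (by decide)).compl
    rwa [show (image ![1, 0, 3, 2] {0, 2} : Finset (Fin 4))ᶜ = {0, 2} by decide] at this
  have hNW : N + ri (Equiv.swap 0 2) N = W := by
    refine trunc_add_ri_swap dW.ml (mem_univ _) (mem_univ _) (by decide) ?_ fun x hx => ?_
    · rw [hW, ri_add, ri_swap_swap, add_comm]
    · exact ri_eq_zero_of_diag E x hx
  have hNs : ri (Equiv.swap 1 3) N = N := by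
    rw [hN, ri_trunc (Equiv.injective _) (by decide) (by decide)]
    congr 1
    ext x
    obtain ⟨a, b, c, d, rfl⟩ := exists_vec4 x
    simp only [hW, ri_swap4_13, Pi.add_apply, ri_swap4_02]
    have := hd a b c d
    grind
  have k1 : ∀ a b c d, N ![a, b, c, d] = N ![a, d, c, b] := fun a b c d => by
    conv_lhs => rw [← hNs, swap4_13, ri_apply4]
    rfl
  have k2 : ∀ a b c d, N ![a, b, c, d] + N ![c, b, a, d] = E ![a, b, c, d] + E ![c, b, a, d] :=
    fun a b c d => by
      have := congrFun hNW ![a, b, c, d]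
      rw [hW] at this
      simpa only [Pi.add_apply, ri_swap4_02] using this
  have k3 : ∀ a b c d, D ![a, b, c, d] = E ![a, b, c, d] + N ![a, b, c, d] + N ![b, a, d, c] :=
    fun a b c d => by simp only [hD, Pi.add_apply, ri_apply4]; rfl
  have k4 : ∀ a b c d, D ![a, b, c, d] = D ![b, a, d, c] := fun a b c d => by
    rw [k3, k3, hs]
    abel
  have k5 : ∀ a b c d, D ![a, b, c, d] = D ![c, b, a, d] := fun a b c d => by
    rw [k3, k3]
    have h1 := k2 a b c d
    have h2 := k1 b a d c
    clear * - h1 h2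
    grind
  have k6 : ∀ a b c d, D ![a, b, c, d] = D ![a, d, c, b] := fun a b c d => by
    rw [k4, k5, k4]
  clear_value D N W
  obtain ⟨β, γ, e⟩ := exists_bilin_of_dec dD
  obtain ⟨β', γ', e'⟩ := exists_bilin_of_dec dN
  obtain ⟨b, hb, σ, ρ, hσ, e⟩ : ∃ b ∈ symBilin (Fin n → ZMod 2),
      ∃ σ ρ : Fin (s + (s + s) + (s + s)) →
        (Fin n → ZMod 2) →ₗ[ZMod 2] (Fin n → ZMod 2) →ₗ[ZMod 2] ZMod 2,
      (∀ i, σ i ∈ symBilin _) ∧ ∀ x y z w, D ![x, z, y, w] =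
        b x y * b z w + ∑ i, (σ i x y * ρ i z w + σ i z w * ρ i x y) := by
    simp only [e]
    refine exists_square_add β γ (fun x y z w => ?_) fun x y z w => ?_
    · rw [← e, ← e, k6]
    · rw [← e, ← e, k4]
  obtain ⟨ρ', σ', hσ', e'⟩ : ∃ ρ' σ' : Fin (s + s) →
        (Fin n → ZMod 2) →ₗ[ZMod 2] (Fin n → ZMod 2) →ₗ[ZMod 2] ZMod 2,
      (∀ i, σ' i ∈ symBilin _) ∧ ∀ x y z w, N ![x, z, y, w] = ∑ i, ρ' i x y * σ' i z w := by
    simp only [e']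
    refine exists_symm_factors β' γ' fun x y z w => ?_
    rw [← e', ← e', k1]
  refine ⟨b, hb, Fin.append σ σ', Fin.append ρ ρ', fun i => ?_, fun x y z w => ?_⟩
  · induction i using Fin.addCases <;> simp [hσ, hσ']
  · rw [Fin.sum_univ_add]
    simp only [Fin.append_left, Fin.append_right]
    have e1 : ∑ i, (σ' i x y * ρ' i z w + σ' i z w * ρ' i x y) =
        N ![z, x, w, y] + N ![x, z, y, w] := by
      rw [e', e', ← sum_add_distrib]
      exact sum_congr rfl fun i _ => by ring
    have e2 := e x y z w
    have e3 := k3 x z y w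
    rw [← add_assoc, ← e2, e1, e3]
    clear * -
    grind

set_option maxRecDepth 10000 in
/-- A form of low partition rank satisfying the cocycle relations of a coboundary under the
transposition of the variables `2` and `3` is, up to a square, the coboundary of an explicit form of
low partition rank. -/
lemma exists_coboundary4 {s : ℕ} {m : (Fin 4 → Fin n → ZMod 2) → ZMod 2} (h : PR univ s m)
    (h01 : m + ri (Equiv.swap 0 1) m = 0) (h23 : m + ri (Equiv.swap 2 3) m = 0)
    (hc : m + ri (Equiv.swap 1 2) m + ri (Equiv.swap 1 3) m = 0) :
    ∃ (π : (Fin n → ZMod 2) →ₗ[ZMod 2] (Fin n → ZMod 2)),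
      Codim (s + 3 * (3 * (3 * s) * (3 * (3 * s)))) π ∧
      ∃ b ∈ symBilin (Fin n → ZMod 2), ∃ σ ρ : Fin (s + (s + s) + (s + s) + (s + s)) →
        (Fin n → ZMod 2) →ₗ[ZMod 2] (Fin n → ZMod 2) →ₗ[ZMod 2] ZMod 2,
      (∀ i, σ i ∈ symBilin _) ∧ ∀ x y z w, m ![π x, π y, π z, π w] =
        b x z * b y w + b x w * b y z + ∑ i, (σ i x y * (ρ i z w + ρ i w z) + σ i x z * ρ i y w +
          σ i y z * ρ i x w + σ i x w * ρ i y z + σ i y w * ρ i x z) := by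
  obtain ⟨π, hπ, Q, hQ, e, hr⟩ := h.decompose_relations pairs4_adequate.generic
    pairs4_adequate.covers [[id, Equiv.swap 0 1], [id, Equiv.swap 2 3],
      [id, Equiv.swap 1 2, Equiv.swap 1 3]]
    (by
      have := pairs4_adequate.acts
      have := acts_id pairs4
      simp [*]) (by
      simp only [List.forall_mem_cons, List.map_cons, List.map_nil, List.sum_cons,
        List.sum_nil, add_zero, ri_id, h01, h23, ← add_assoc, hc]
      simp)
  have r01 : ∀ P P' : Finset (Fin 4), P ∈ pairs4 → act pairs4 (Equiv.swap 0 1) P = P' →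
      ∀ a b c d, Q P ![a, b, c, d] = Q P' ![b, a, c, d] := by
    rintro P P' hP rfl a b c d
    have := list_relation hr (L := [id, Equiv.swap 0 1]) (by simp) hP ![a, b, c, d]
    simp only [List.map_cons, List.map_nil, List.sum_cons, List.sum_nil, add_zero, ri_id,
      act_id hP, ri_swap4_01] at this
    exact eq_of_add_eq_zero2 this
  have r23 : ∀ P P' : Finset (Fin 4), P ∈ pairs4 → act pairs4 (Equiv.swap 2 3) P = P' →
      ∀ a b c d, Q P ![a, b, c, d] = Q P' ![a, b, d, c] := by
    rintro P P' hP rfl a b c d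
    have := list_relation hr (L := [id, Equiv.swap 2 3]) (by simp) hP ![a, b, c, d]
    simp only [List.map_cons, List.map_nil, List.sum_cons, List.sum_nil, add_zero, ri_id,
      act_id hP, ri_swap4_23] at this
    exact eq_of_add_eq_zero2 this
  have rc : ∀ P P' P'' : Finset (Fin 4), P ∈ pairs4 → act pairs4 (Equiv.swap 1 2) P = P' →
      act pairs4 (Equiv.swap 1 3) P = P'' →
      ∀ a b c d, Q P ![a, b, c, d] = Q P' ![a, c, b, d] + Q P'' ![a, d, c, b] := by
    rintro P P' P'' hP rfl rfl a b c d
    have := list_relation hr (L := [id, Equiv.swap 1 2, Equiv.swap 1 3]) (by simp) hP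
      ![a, b, c, d]
    simp only [List.map_cons, List.map_nil, List.sum_cons, List.sum_nil, add_zero, ri_id,
      act_id hP, ri_swap4_12, ri_swap4_13] at this
    exact eq_of_add_eq_zero2 this
  have q12 := r01 {1, 2} {0, 2} (by decide) (by decide)
  have q02 := r23 {0, 2} {1, 2} (by decide) (by decide)
  have q01 := rc {0, 2} {0, 1} {0, 2} (by decide) (by decide) (by decide)
  have q01' := r01 {0, 1} {0, 1} (by decide) (by decide)
  clear r01 r23 rc
  obtain ⟨b, hb, σ, ρ, hσ, eE⟩ := exists_square_of_dec (hQ {0, 2} (by decide))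
    (fun a b c d => by rw [q02, q12]) (fun a b c d => by
      have h1 := q01 a b c d
      have h2 := q01 c b a d
      have h3 := q01' a c b d
      clear * - h1 h2 h3
      grind)
  refine ⟨π, hπ, b, hb, σ, ρ, hσ, fun x y z w => ?_⟩
  have e1 : pb π m ![x, y, z, w] = m ![π x, π y, π z, π w] :=
    congrArg m (funext fun i => by fin_cases i <;> rfl)
  have e2 : Q {0, 1} ![x, y, z, w] = Q {0, 2} ![x, z, y, w] + Q {0, 2} ![x, w, y, z] := by
    have := q01 x z y w
    clear * - this
    grind
  rw [← e1, e, sum_pairs4]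
  simp only [Pi.add_apply]
  rw [e2, q12, eE, eE, eE, eE]
  have e4 : b z w = b w z := hb _ _
  have e5 : ∀ i, σ i z w = σ i w z := fun i => hσ i _ _
  have e8 : ∑ i, (σ i x y * ρ i z w + σ i z w * ρ i x y) +
      ∑ i, (σ i x y * ρ i w z + σ i w z * ρ i x y) +
      ∑ i, (σ i x z * ρ i y w + σ i y w * ρ i x z) +
      ∑ i, (σ i y z * ρ i x w + σ i x w * ρ i y z) =
      ∑ i, (σ i x y * (ρ i z w + ρ i w z) + σ i x z * ρ i y w +
          σ i y z * ρ i x w + σ i x w * ρ i y z + σ i y w * ρ i x z) := by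
    simp only [← sum_add_distrib]
    refine sum_congr rfl fun i _ => ?_
    rw [e5]
    have : ∀ a : ZMod 2, a + a = 0 := by decide
    linear_combination this (σ i w z * ρ i x y)
  rw [← e8, e4]
  clear * -
  grind

end

end

section

lemma Step.of_pb {k : ℕ} (hk : 2 ≤ k) {A B : ∀ n : ℕ, ((Fin k → Fin n → ZMod 2) → ZMod 2) → Prop}
    (h : ∃ F, TowerBounded F ∧ ∀ (n s : ℕ) (α : (Fin k → Fin n → ZMod 2) → ZMod 2),
      ML univ α → Corr s α → A n α → ∃ π, Codim (F s) π ∧ B n (pb π α)) : Step k A B := by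
  obtain ⟨F, hF, h⟩ := h
  refine ⟨fun s => k * F s, by fun_prop, fun n s α hα hc hA => ?_⟩
  obtain ⟨π, hπ, hB⟩ := h n s α hα hc hA
  exact ⟨_, hα.pb π, hπ.pr hα hk, hB⟩

section vec
variable {V : Type}

lemma sum_vecCons [Fintype V] {n : ℕ} (g : (Fin (n + 1) → V) → ℝ) :
    ∑ v, g v = ∑ a, ∑ v, g (Matrix.vecCons a v) := by
  rw [← Fintype.sum_prod_type', ← (Fin.consEquiv fun _ : Fin (n + 1) => V).sum_comp]
  rfl

lemma sum_vec2 [Fintype V] (g : (Fin 2 → V) → ℝ) : ∑ v, g v = ∑ a, ∑ b, g ![a, b] := by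
  simp only [sum_vecCons, Fintype.sum_unique]
  rfl

lemma sum_vec3 [Fintype V] (g : (Fin 3 → V) → ℝ) : ∑ v, g v = ∑ a, ∑ b, ∑ c, g ![a, b, c] := by
  simp only [sum_vecCons, Fintype.sum_unique]
  rfl

lemma sum_vec4 [Fintype V] (g : (Fin 4 → V) → ℝ) :
    ∑ v, g v = ∑ a, ∑ b, ∑ c, ∑ d, g ![a, b, c, d] := by
  simp only [sum_vecCons, Fintype.sum_unique]
  rfl

lemma sum_vec5 [Fintype V] (g : (Fin 5 → V) → ℝ) :
    ∑ v, g v = ∑ a, ∑ b, ∑ c, ∑ d, ∑ e, g ![a, b, c, d, e] := by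
  simp only [sum_vecCons, Fintype.sum_unique]
  rfl

lemma update_vec2_0 (a b u : V) :
    Function.update ![a, b] 0 u = ![u, b] := by
  ext j; fin_cases j <;> rfl

lemma update_vec2_1 (a b u : V) :
    Function.update ![a, b] 1 u = ![a, u] := by
  ext j; fin_cases j <;> rfl

lemma update_vec3_0 (a b c u : V) :
    Function.update ![a, b, c] 0 u = ![u, b, c] := by
  ext j; fin_cases j <;> rfl

lemma update_vec3_1 (a b c u : V) :
    Function.update ![a, b, c] 1 u = ![a, u, c] := by
  ext j; fin_cases j <;> rfl

lemma update_vec3_2 (a b c u : V) :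
    Function.update ![a, b, c] 2 u = ![a, b, u] := by
  ext j; fin_cases j <;> rfl

lemma update_vec4_0 (a b c d u : V) :
    Function.update ![a, b, c, d] 0 u = ![u, b, c, d] := by
  ext j; fin_cases j <;> rfl

lemma update_vec4_1 (a b c d u : V) :
    Function.update ![a, b, c, d] 1 u = ![a, u, c, d] := by
  ext j; fin_cases j <;> rfl

lemma update_vec4_2 (a b c d u : V) :
    Function.update ![a, b, c, d] 2 u = ![a, b, u, d] := by
  ext j; fin_cases j <;> rfl

lemma update_vec4_3 (a b c d u : V) :
    Function.update ![a, b, c, d] 3 u = ![a, b, c, u] := by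
  ext j; fin_cases j <;> rfl

lemma update_vec5_0 (a b c d e u : V) :
    Function.update ![a, b, c, d, e] 0 u = ![u, b, c, d, e] := by
  ext j; fin_cases j <;> rfl

lemma update_vec5_1 (a b c d e u : V) :
    Function.update ![a, b, c, d, e] 1 u = ![a, u, c, d, e] := by
  ext j; fin_cases j <;> rfl

lemma update_vec5_2 (a b c d e u : V) :
    Function.update ![a, b, c, d, e] 2 u = ![a, b, u, d, e] := by
  ext j; fin_cases j <;> rfl

lemma update_vec5_3 (a b c d e u : V) :
    Function.update ![a, b, c, d, e] 3 u = ![a, b, c, u, e] := by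
  ext j; fin_cases j <;> rfl

lemma update_vec5_4 (a b c d e u : V) :
    Function.update ![a, b, c, d, e] 4 u = ![a, b, c, d, u] := by
  ext j; fin_cases j <;> rfl

end vec

section ml
variable {V : Type} [AddCommGroup V] [Module (ZMod 2) V]

lemma ml_univ_of_add {k : ℕ} {φ : (Fin k → V) → ZMod 2}
    (h : ∀ i x u v, φ (Function.update x i (u + v)) =
      φ (Function.update x i u) + φ (Function.update x i v)) : ML univ φ :=
  ⟨fun _ _ hxy => congrArg φ (funext fun i => hxy i (mem_univ i)), fun i _ x u v => h i x u v⟩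

lemma ml_vec2 {φ : (Fin 2 → V) → ZMod 2}
    (h0 : ∀ a a' b, φ ![a + a', b] = φ ![a, b] + φ ![a', b])
    (h1 : ∀ a b b', φ ![a, b + b'] = φ ![a, b] + φ ![a, b']) : ML univ φ := by
  refine ml_univ_of_add fun i x u v => ?_
  have e : x = ![x 0, x 1] := by ext i; fin_cases i <;> rfl
  rw [e]
  fin_cases i
  · simpa only [Fin.zero_eta, Fin.mk_one, Fin.reduceFinMk, update_vec2_0] using h0 u v (x 1)
  · simpa only [Fin.zero_eta, Fin.mk_one, Fin.reduceFinMk, update_vec2_1] using h1 (x 0) u v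

lemma ml_vec3 {φ : (Fin 3 → V) → ZMod 2}
    (h0 : ∀ a a' b c, φ ![a + a', b, c] = φ ![a, b, c] + φ ![a', b, c])
    (h1 : ∀ a b b' c, φ ![a, b + b', c] = φ ![a, b, c] + φ ![a, b', c])
    (h2 : ∀ a b c c', φ ![a, b, c + c'] = φ ![a, b, c] + φ ![a, b, c']) : ML univ φ := by
  refine ml_univ_of_add fun i x u v => ?_
  have e : x = ![x 0, x 1, x 2] := by ext i; fin_cases i <;> rfl
  rw [e]
  fin_cases i
  · simpa only [Fin.zero_eta, Fin.mk_one, Fin.reduceFinMk, update_vec3_0] using h0 u v (x 1) (x 2)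
  · simpa only [Fin.zero_eta, Fin.mk_one, Fin.reduceFinMk, update_vec3_1] using h1 (x 0) u v (x 2)
  · simpa only [Fin.zero_eta, Fin.mk_one, Fin.reduceFinMk, update_vec3_2] using h2 (x 0) (x 1) u v

lemma ml_vec4 {φ : (Fin 4 → V) → ZMod 2}
    (h0 : ∀ a a' b c d, φ ![a + a', b, c, d] = φ ![a, b, c, d] + φ ![a', b, c, d])
    (h1 : ∀ a b b' c d, φ ![a, b + b', c, d] = φ ![a, b, c, d] + φ ![a, b', c, d])
    (h2 : ∀ a b c c' d, φ ![a, b, c + c', d] = φ ![a, b, c, d] + φ ![a, b, c', d])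
    (h3 : ∀ a b c d d', φ ![a, b, c, d + d'] = φ ![a, b, c, d] + φ ![a, b, c, d']) :
    ML univ φ := by
  refine ml_univ_of_add fun i x u v => ?_
  obtain ⟨a, b, c, d, rfl⟩ := exists_vec4 x
  fin_cases i
  · simpa only [Fin.zero_eta, Fin.mk_one, Fin.reduceFinMk, update_vec4_0] using h0 u v b c d
  · simpa only [Fin.zero_eta, Fin.mk_one, Fin.reduceFinMk, update_vec4_1] using h1 a u v c d
  · simpa only [Fin.zero_eta, Fin.mk_one, Fin.reduceFinMk, update_vec4_2] using h2 a b u v d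
  · simpa only [Fin.zero_eta, Fin.mk_one, Fin.reduceFinMk, update_vec4_3] using h3 a b c u v

section
variable {φ : (Fin 4 → V) → ZMod 2} (h : ML univ φ) (a a' b c d : V)
include h

lemma ML.add4_0 : φ ![a + a', b, c, d] = φ ![a, b, c, d] + φ ![a', b, c, d] := by
  simpa only [update_vec4_0] using h.2 0 (mem_univ _) ![a, b, c, d] a a'

lemma ML.add4_1 : φ ![b, a + a', c, d] = φ ![b, a, c, d] + φ ![b, a', c, d] := by
  simpa only [update_vec4_1] using h.2 1 (mem_univ _) ![b, a, c, d] a a'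

lemma ML.add4_2 : φ ![b, c, a + a', d] = φ ![b, c, a, d] + φ ![b, c, a', d] := by
  simpa only [update_vec4_2] using h.2 2 (mem_univ _) ![b, c, a, d] a a'

lemma ML.add4_3 : φ ![b, c, d, a + a'] = φ ![b, c, d, a] + φ ![b, c, d, a'] := by
  simpa only [update_vec4_3] using h.2 3 (mem_univ _) ![b, c, d, a] a a'

end

section
variable {φ : (Fin 5 → V) → ZMod 2} (h : ML univ φ) (a a' b c d e : V)
include h

lemma ML.add5_0 : φ ![a + a', b, c, d, e] = φ ![a, b, c, d, e] + φ ![a', b, c, d, e] := by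
  simpa only [update_vec5_0] using h.2 0 (mem_univ _) ![a, b, c, d, e] a a'

lemma ML.add5_1 : φ ![b, a + a', c, d, e] = φ ![b, a, c, d, e] + φ ![b, a', c, d, e] := by
  simpa only [update_vec5_1] using h.2 1 (mem_univ _) ![b, a, c, d, e] a a'

lemma ML.add5_2 : φ ![b, c, a + a', d, e] = φ ![b, c, a, d, e] + φ ![b, c, a', d, e] := by
  simpa only [update_vec5_2] using h.2 2 (mem_univ _) ![b, c, a, d, e] a a'

lemma ML.add5_3 : φ ![b, c, d, a + a', e] = φ ![b, c, d, a, e] + φ ![b, c, d, a', e] := by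
  simpa only [update_vec5_3] using h.2 3 (mem_univ _) ![b, c, d, a, e] a a'

lemma ML.add5_4 : φ ![b, c, d, e, a + a'] = φ ![b, c, d, e, a] + φ ![b, c, d, e, a'] := by
  simpa only [update_vec5_4] using h.2 4 (mem_univ _) ![b, c, d, e, a] a a'

end

end ml

end

section

lemma pr_mul_functionals {V : Type} [AddCommGroup V] [Module (ZMod 2) V]
    (l l' : V →ₗ[ZMod 2] ZMod 2) : PR univ 1 fun v : Fin 2 → V => l (v 0) * l' (v 1) := by
  refine PR.single' (I := {0}) (J := {1}) (by decide) (by decide) (by decide) (by decide)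
    (β := fun v => l (v 0)) (γ := fun v => l' (v 1)) ⟨fun x y h => ?_, fun i hi x u v => ?_⟩
    ⟨fun x y h => ?_, fun i hi x u v => ?_⟩
  · exact congrArg l (h 0 (by simp))
  · rw [mem_singleton.1 hi]; simp
  · exact congrArg l' (h 1 (by simp))
  · rw [mem_singleton.1 hi]; simp

/-- A biased bilinear form, perturbed by products of its slices, vanishes on a subspace of bounded
codimension. -/
lemma exists_kill_bilin {k : ℕ} (t : Finset (Fin k × Fin k)) : ∃ F, TowerBounded F ∧
    ∀ (V : Type) [AddCommGroup V] [Module (ZMod 2) V] [Fintype V]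
      (b : V →ₗ[ZMod 2] V →ₗ[ZMod 2] ZMod 2) (s : ℕ),
      (Fintype.card V : ℝ) ^ (k + 2) ≤ 2 ^ s * ∑ u : Fin k → V, ∑ x, ∑ y,
        sgn (b x y + ∑ p ∈ t, b x (u p.1) * b y (u p.2)) →
      ∃ π, Codim (F s) π ∧ ∀ x y, b (π x) (π y) = 0 := by
  obtain ⟨F, hF, h⟩ := pr_of_bias (univ : Finset (Fin 2)) (by decide)
  refine ⟨fun s => F s + t.card * 1, by fun_prop, fun V _ _ _ b s hb => ?_⟩
  obtain ⟨u, hu⟩ : ∃ u : Fin k → V, (Fintype.card V : ℝ) ^ 2 ≤ 2 ^ s * ∑ x, ∑ y,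
      sgn (b x y + ∑ p ∈ t, b x (u p.1) * b y (u p.2)) := by
    rw [mul_sum] at hb
    obtain ⟨u, -, hu⟩ := exists_le_of_sum_le (s := (univ : Finset (Fin k → V)))
      (f := fun _ => (Fintype.card V : ℝ) ^ 2) ⟨0, mem_univ _⟩ (by
        refine le_trans (le_of_eq ?_) hb
        simp [card_univ, pow_add])
    exact ⟨u, hu⟩
  set R : (Fin 2 → V) → ZMod 2 := ∑ p ∈ t, fun v => b.flip (u p.1) (v 0) * b.flip (u p.2) (v 1)
    with hR
  have hRp : PR univ (t.card * 1) R := PR.sum t fun p _ => pr_mul_functionals _ _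
  have hRv : ∀ x y, R ![x, y] = ∑ p ∈ t, b x (u p.1) * b y (u p.2) := fun x y => by
    simp [hR, Finset.sum_apply]
  have hbm : ML univ fun v : Fin 2 → V => b (v 0) (v 1) :=
    ml_vec2 (fun a a' c => by simp) fun a c c' => by simp
  have hp := h V ((fun v : Fin 2 → V => b (v 0) (v 1)) + R) s (hbm.add hRp.ml) (by
    rw [sum_vec2]
    simpa [hRv] using hu)
  have hp' := hp.add hRp
  rw [add_add_cancel2] at hp'
  obtain ⟨π, hπ, h0⟩ := hp'.kill (by decide)
  exact ⟨π, hπ, fun x y => congrFun h0 ![x, y]⟩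

end

section

lemma ml_bilin {k : ℕ} {V : Type} [AddCommGroup V] [Module (ZMod 2) V] {p q : Fin k} (hpq : p ≠ q)
    (B : V →ₗ[ZMod 2] V →ₗ[ZMod 2] ZMod 2) : ML {p, q} fun v : Fin k → V => B (v p) (v q) := by
  refine ⟨fun x y h => ?_, fun i hi x u v => ?_⟩
  · show B (x p) (x q) = B (y p) (y q)
    rw [h p (by simp), h q (by simp)]
  · rcases mem_insert.1 hi with rfl | hi
    · simp [hpq.symm]
    · rw [mem_singleton.1 hi]
      simp [hpq]

lemma pr_mul_bilin {V : Type} [AddCommGroup V] [Module (ZMod 2) V]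
    (B C : V →ₗ[ZMod 2] V →ₗ[ZMod 2] ZMod 2) :
    PR univ 1 fun v : Fin 4 → V => B (v 0) (v 1) * C (v 2) (v 3) :=
  PR.single' (I := {0, 1}) (J := {2, 3}) (by decide) (by decide) (by decide) (by decide)
    (ml_bilin (by decide) B) (ml_bilin (by decide) C)

/-- The defect of the symmetry of `α` in the last two variables is the symmetrized square of `b`. -/
structure SquareDefect {V : Type} [AddCommGroup V] [Module (ZMod 2) V] (α : (Fin 4 → V) → ZMod 2)
    (b : V →ₗ[ZMod 2] V →ₗ[ZMod 2] ZMod 2) : Prop where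
  swap01 : ∀ x y z w, α ![x, y, z, w] = α ![y, x, z, w]
  swap12 : ∀ x y z w, α ![x, y, z, w] = α ![x, z, y, w]
  symm : ∀ x y, b x y = b y x
  diag : ∀ x, b x x = 0
  defect : ∀ x y z w, α ![x, y, z, w] + α ![x, y, w, z] = b x z * b y w + b x w * b y z

section
variable {V : Type} [AddCommGroup V] [Module (ZMod 2) V] {α : (Fin 4 → V) → ZMod 2}
  {b : V →ₗ[ZMod 2] V →ₗ[ZMod 2] ZMod 2}

lemma pb_vec4 (π : V →ₗ[ZMod 2] V) (φ : (Fin 4 → V) → ZMod 2) (x y z w : V) :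
    pb π φ ![x, y, z, w] = φ ![π x, π y, π z, π w] :=
  congrArg φ (funext fun i => by fin_cases i <;> rfl)

lemma SquareDefect.pb (h : SquareDefect α b) (π : V →ₗ[ZMod 2] V) :
    SquareDefect (pb π α) (b.compl₁₂ π π) where
  swap01 x y z w := by rw [pb_vec4, pb_vec4, h.swap01]
  swap12 x y z w := by rw [pb_vec4, pb_vec4, h.swap12]
  symm x y := h.symm _ _
  diag x := h.diag _
  defect x y z w := by rw [pb_vec4, pb_vec4]; exact h.defect ..

end

lemma exists_kill_diag {V : Type} [AddCommGroup V] [Module (ZMod 2) V]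
    {b : V →ₗ[ZMod 2] V →ₗ[ZMod 2] ZMod 2} (h : ∀ x y, b x y = b y x) :
    ∃ π, Codim 1 π ∧ ∀ x, b (π x) (π x) = 0 := by
  refine exists_kill_functional ((AddMonoidHom.mk' (fun x => b x x)
    fun x y => ?_).toZModLinearMap 2)
  simp only [map_add, LinearMap.add_apply, h y x]
  have : ∀ p q r : ZMod 2, p + q + (q + r) = p + r := by decide
  exact this _ _ _

lemma exists_squareDefect : Step 4 (fun _ α => Inv3 (k := 1) α)
    fun _ α => ∃ b, SquareDefect α b := by
  obtain ⟨F, hF, h⟩ := exists_swap_pr (show (2 : Fin 4) ≠ 3 by decide)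
  let M : ℕ → ℕ := fun s => F s + (F s + F s) + (F s + F s) + (F s + F s)
  refine ⟨fun s => 4 * (F s + 3 * (3 * (3 * F s) * (3 * (3 * F s))) + 1) + 3 * M s,
    by fun_prop, fun n s α hα hc hi => ?_⟩
  have s01 : ∀ a b c d, α ![a, b, c, d] = α ![b, a, c, d] := fun a b c d => by
    conv_lhs => rw [← hi.1]
    exact ri_swap4_01 ..
  have s12 : ∀ a b c d, α ![a, b, c, d] = α ![a, c, b, d] := fun a b c d => by
    conv_lhs => rw [← hi.2.1]
    exact ri_swap4_12 ..
  obtain ⟨π, hπ, b, hb, σ, ρ, hσ, e⟩ := exists_coboundary4 (h _ s α hα hc) (by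
      ext x
      obtain ⟨a, b, c, d, rfl⟩ := exists_vec4 x
      simp only [Pi.add_apply, Pi.zero_apply, ri_swap4_01, ri_swap4_23]
      grind) (by
      ext x
      obtain ⟨a, b, c, d, rfl⟩ := exists_vec4 x
      simp only [Pi.add_apply, Pi.zero_apply, ri_swap4_23]
      grind) (by
      ext x
      obtain ⟨a, b, c, d, rfl⟩ := exists_vec4 x
      simp only [Pi.add_apply, Pi.zero_apply, ri_swap4_12, ri_swap4_13, ri_swap4_23]
      grind)
  obtain ⟨π', hπ', hd⟩ := exists_kill_diag hb
  let P : Fin (M s) → (Fin 4 → Fin n → ZMod 2) → ZMod 2 := fun i v => σ i (v 0) (v 1) * ρ i (v 2) (v 3)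
  let ν := ∑ i, (P i + ri ![0, 2, 1, 3] (P i) + ri ![1, 2, 0, 3] (P i))
  have hν : PR univ (3 * M s) ν := by
    have := PR.sum_fin fun i => ((pr_mul_bilin (σ i) (ρ i)).add ((pr_mul_bilin (σ i) (ρ i)).ri
      (f := ![0, 2, 1, 3]) (by decide))).add ((pr_mul_bilin (σ i) (ρ i)).ri
      (f := ![1, 2, 0, 3]) (by decide))
    rw [mul_comm]
    exact this
  have hνv : ∀ x y z w, ν ![x, y, z, w] = ∑ i, (σ i x y * ρ i z w + σ i x z * ρ i y w +
      σ i y z * ρ i x w) := fun x y z w => by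
    simp only [ν, Finset.sum_apply, Pi.add_apply, ri_apply4]
    rfl
  have hml : ML univ (pb π α + ν) := (hα.pb π).add hν.ml
  refine ⟨pb π' (pb π α + ν), hml.pb π', ?_, b.compl₁₂ π' π', ?_⟩
  · have h1 := (hπ.comp hπ').pr hα (by norm_num)
    have h2 := h1.add (hν.pb π')
    rw [add_assoc α] at h2
    exact h2
  · constructor
    · intro x y z w
      simp only [pb_vec4, Pi.add_apply, hνv, s01 (π (π' x))]
      congr 1
      refine sum_congr rfl fun i _ => ?_
      rw [hσ i (π' x) (π' y)]
      ring
    · intro x y z w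
      simp only [pb_vec4, Pi.add_apply, hνv, s12 _ (π (π' y))]
      congr 1
      refine sum_congr rfl fun i _ => ?_
      rw [hσ i (π' y) (π' z)]
      ring
    · exact fun x y => hb _ _
    · exact hd
    · intro x y z w
      simp only [pb_vec4, Pi.add_apply, hνv, LinearMap.compl₁₂_apply]
      generalize π' x = x, π' y = y, π' z = z, π' w = w
      have e1 := e x y z w
      rw [Pi.add_apply, ri_swap4_23] at e1
      have : ∀ p q r u v w : ZMod 2, p + q = r + u → v + w = u → p + v + (q + w) = r := by decide
      refine this _ _ _ _ _ _ e1 ?_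
      rw [← sum_add_distrib]
      exact sum_congr rfl fun i _ => by ring

end

section

section
variable {V : Type} [AddCommGroup V] [Module (ZMod 2) V] {α : (Fin 4 → V) → ZMod 2}
  {b : V →ₗ[ZMod 2] V →ₗ[ZMod 2] ZMod 2}

lemma shiftOn_vec4 (x y z w h : V) : shiftOn {0, 1, 2} ![x, y, z, w] h = ![x + h, y + h, z + h, w] := by
  ext i; fin_cases i <;> simp [shiftOn]

lemma shiftOn_univ_vec4 (x y z w h : V) :
    shiftOn univ ![x, y, z, w] h = ![x + h, y + h, z + h, w + h] := by
  ext i; fin_cases i <;> simp [shiftOn]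

lemma SquareDefect.expand (h : SquareDefect α b) (hα : ML univ α) (p q r w x : V) :
    α ![p + x, q + x, r + x, w] = α ![p, q, r, w] + (α ![x, q, r, w] + α ![x, p, r, w] +
      α ![x, p, q, w]) + (α ![x, x, p, w] + α ![x, x, q, w] + α ![x, x, r, w]) +
      α ![x, x, x, w] := by
  simp only [hα.add4_0, hα.add4_1, hα.add4_2]
  rw [h.swap01 p x r w, h.swap12 p q x w, h.swap01 p x q w, h.swap12 x q x w, h.swap01 p x x w,
    h.swap12 x p x w]
  abel

lemma SquareDefect.add_two (h : SquareDefect α b) (hα : ML univ α) (r w x y : V) :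
    α ![x + y, x + y, r, w] = α ![x, x, r, w] + α ![y, y, r, w] := by
  simp only [hα.add4_0, hα.add4_1]
  rw [h.swap01 y x]
  grind

lemma SquareDefect.add_three (h : SquareDefect α b) (hα : ML univ α) (w x y : V) :
    α ![x + y, x + y, x + y, w] = α ![x, x, x, w] + α ![y, y, y, w] +
      (α ![x, x, y, w] + α ![x, y, y, w]) := by
  rw [h.add_two hα, hα.add4_2, hα.add4_2, h.swap12 y y x, h.swap01 y x y]
  abel

lemma SquareDefect.parity (h : SquareDefect α b) (hα : ML univ α) (p q r w x y : V) :
    α ![p, q, r, w] + α ![p + x, q + x, r + x, w] + α ![p + y, q + y, r + y, w] +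
      α ![p + (x + y), q + (x + y), r + (x + y), w] = α ![x, x, y, w] + α ![x, y, y, w] := by
  rw [h.expand hα, h.expand hα p q r w y, h.expand hα p q r w (x + y), h.add_three hα]
  simp only [h.add_two hα, hα.add4_0 x y]
  clear * -
  grind

lemma SquareDefect.parity_univ (h : SquareDefect α b) (hα : ML univ α)
    (hθ : ∀ x y z, α ![x, x, y, z] + α ![x, y, y, z] = 0) (p q r w x y : V) :
    α ![p, q, r, w] + α ![p + x, q + x, r + x, w + x] + α ![p + y, q + y, r + y, w + y] +
      α ![p + (x + y), q + (x + y), r + (x + y), w + (x + y)] =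
    b x y + (b x p * b y q + b x q * b y p + (b x p * b y r + b x r * b y p) +
      (b x q * b y r + b x r * b y q)) := by
  have hd : ∀ p q, α ![x, p, q, y] + α ![y, p, q, x] = b x p * b y q + b x q * b y p :=
    fun p q => by
      rw [h.swap01 x p, h.swap12, h.swap01 y p, h.swap12 p y, h.defect, h.symm p x, h.symm q y,
        h.symm p y, h.symm q x]
      ring
  have hθ' : ∀ x y z, α ![x, x, y, z] = α ![x, y, y, z] := fun x y z =>
    eq_of_add_eq_zero2 (hθ x y z)
  have h2 : ∀ q, α ![x, x, q, y] + α ![y, y, q, x] = 0 := fun q => by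
    rw [hθ' x, hθ' y, hd]
    exact add_self2 _
  have h3 : α ![x, x, x, y] + α ![y, y, y, x] = b x y := by
    have e1 := h.defect x x x y
    have e2 := h.defect y y y x
    have e3 := h.defect x y x y
    have e4 := hθ' x y x
    have e5 := hθ' y x y
    have e6 := h.swap01 y x x y
    have e7 : ∀ a : ZMod 2, a * a = a := by decide
    rw [h.diag, zero_mul, mul_zero, add_zero] at e1 e2
    rw [h.diag, zero_mul, zero_add, h.symm y x, e7] at e3
    clear * - e1 e2 e3 e4 e5 e6
    grind
  rw [h.expand hα, h.expand hα p q r (w + y), h.expand hα p q r (w + (x + y)), h.add_three hα]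
  simp only [h.add_two hα, hα.add4_0 x y, hα.add4_3]
  have d1 := hd q r
  have d2 := hd p r
  have d3 := hd p q
  have d4 := h2 p
  have d5 := h2 q
  have d6 := h2 r
  have t1 := hθ x y w
  have t2 := hθ x y x
  have t3 := hθ x y y
  clear * - h3 d1 d2 d3 d4 d5 d6 t1 t2 t3
  grind

end

lemma exists_theta4 : Step 4 (fun _ α => ∃ b, SquareDefect α b) fun _ α => ∃ b,
    SquareDefect α b ∧ ∀ x y z, α ![x, x, y, z] + α ![x, y, y, z] = 0 := by
  obtain ⟨F, hF, h⟩ := pr_of_bias (univ : Finset (Fin 3)) (by decide)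
  refine Step.of_pb (by norm_num) ⟨fun s => F (4 * s), by fun_prop, fun n s α hα hc => ?_⟩
  rintro ⟨b, hb⟩
  have := h _ (fun v => α ![v 0, v 0, v 1, v 2] + α ![v 0, v 1, v 1, v 2]) (4 * s)
    (ml_vec3 ?_ ?_ ?_) ?_
  · obtain ⟨π, hπ, h0⟩ := this.kill (by decide)
    refine ⟨π, hπ, _, hb.pb π, fun x y z => ?_⟩
    rw [pb_vec4, pb_vec4]
    exact congrFun h0 ![x, y, z]
  · intro x x' y z
    simp only [Matrix.cons_val]
    rw [hb.add_two hα, hα.add4_0]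
    abel
  · intro x y y' z
    simp only [Matrix.cons_val]
    have e : ∀ u, α ![x, u, u, z] = α ![u, u, x, z] := fun u => by rw [hb.swap01, hb.swap12]
    rw [hα.add4_2, e, hb.add_two hα, e, e]
    abel
  · intro x y z z'
    simp only [Matrix.cons_val, hα.add4_3]
    abel
  · have hp := hc.parity {0, 1, 2}
    simp only [sum_vec4, shiftOn_vec4, hb.parity hα] at hp
    rw [sum_vec3]
    simp only [Matrix.cons_val]
    have hq : ∀ g : (Fin n → ZMod 2) → (Fin n → ZMod 2) → (Fin n → ZMod 2) → ℝ,
        ∑ w, ∑ x, ∑ y, g w x y = ∑ x, ∑ y, ∑ w, g w x y := fun g => by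
      rw [sum_comm]
      exact sum_congr rfl fun x _ => sum_comm
    simp only [sum_const, card_univ, nsmul_eq_mul] at hp
    rw [hq] at hp
    have hV : (0 : ℝ) < Fintype.card (Fin n → ZMod 2) := by exact_mod_cast Fintype.card_pos
    refine le_of_mul_le_mul_left ?_ (pow_pos hV 3)
    calc _ = _ := by ring
      _ ≤ _ := hp
      _ = _ := by ring

/-- `α` is symmetric and so is its restriction to coincident first variables. -/
def Strong4 {V : Type} (α : (Fin 4 → V) → ZMod 2) : Prop :=
  FullSym α ∧ ∀ x y z, α ![x, x, y, z] = α ![x, y, y, z]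

lemma exists_strong4 : Step 4 (fun _ α => ∃ b,
    SquareDefect α b ∧ ∀ x y z, α ![x, x, y, z] + α ![x, y, y, z] = 0) fun _ α => Strong4 α := by
  obtain ⟨F, hF, h⟩ := exists_kill_bilin
    ({(0, 1), (1, 0), (0, 2), (2, 0), (1, 2), (2, 1)} : Finset (Fin 4 × Fin 4))
  refine Step.of_pb (by norm_num) ⟨fun s => F (4 * s), by fun_prop, fun n s α hα hc => ?_⟩
  rintro ⟨b, hb, hθ⟩
  have hp := hc.parity univ
  simp only [sum_vec4, shiftOn_univ_vec4, hb.parity_univ hα hθ] at hp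
  obtain ⟨π, hπ, h0⟩ := h _ b (4 * s) (by
    rw [sum_vec4]
    convert hp using 12 with p _ q _ r _ w _ x _ y _
    repeat rw [sum_insert (by decide)]
    rw [sum_singleton]
    simp only [Matrix.cons_val]
    ring)
  refine ⟨π, hπ, FullSym.of_swap fun i => ?_, fun x y z => ?_⟩
  · ext v
    obtain ⟨x, y, z, w, rfl⟩ := exists_vec4 v
    fin_cases i
    · refine (ri_swap4_01 ..).trans ?_
      rw [pb_vec4, pb_vec4, hb.swap01]
    · refine (ri_swap4_12 ..).trans ?_
      rw [pb_vec4, pb_vec4, hb.swap12]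
    · refine (ri_swap4_23 ..).trans ?_
      rw [pb_vec4, pb_vec4]
      refine eq_of_add_eq_zero2 ?_
      rw [hb.defect, h0, h0, h0, h0]
      rfl
  · rw [pb_vec4, pb_vec4]
    exact eq_of_add_eq_zero2 (hθ _ _ _)

end

section

section
variable {V : Type} [AddCommGroup V] [Module (ZMod 2) V] {α : (Fin 5 → V) → ZMod 2}

lemma shiftOn_vec5 (a b c d e h : V) :
    shiftOn {0, 1, 2} ![a, b, c, d, e] h = ![a + h, b + h, c + h, d, e] := by
  ext i; fin_cases i <;> simp [shiftOn]

lemma shiftOn_univ_vec5 (a b c d e h : V) :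
    shiftOn univ ![a, b, c, d, e] h = ![a + h, b + h, c + h, d + h, e + h] := by
  ext i; fin_cases i <;> simp [shiftOn]

lemma pb_vec5 (π : V →ₗ[ZMod 2] V) (φ : (Fin 5 → V) → ZMod 2) (a b c d e : V) :
    pb π φ ![a, b, c, d, e] = φ ![π a, π b, π c, π d, π e] :=
  congrArg φ (funext fun i => by fin_cases i <;> rfl)

/-- Invariance under the adjacent transpositions of five variables. -/
structure Sym5 {V : Type} (α : (Fin 5 → V) → ZMod 2) : Prop where
  s01 : ∀ a b c d e, α ![a, b, c, d, e] = α ![b, a, c, d, e]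
  s12 : ∀ a b c d e, α ![a, b, c, d, e] = α ![a, c, b, d, e]
  s23 : ∀ a b c d e, α ![a, b, c, d, e] = α ![a, b, d, c, e]
  s34 : ∀ a b c d e, α ![a, b, c, d, e] = α ![a, b, c, e, d]

lemma FullSym.sym5 (h : FullSym α) : Sym5 α where
  s01 a b c d e := by
    conv_lhs => rw [← h (Equiv.swap 0 1)]
    exact ri_swap5_01 ..
  s12 a b c d e := by
    conv_lhs => rw [← h (Equiv.swap 1 2)]
    exact ri_swap5_12 ..
  s23 a b c d e := by
    conv_lhs => rw [← h (Equiv.swap 2 3)]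
    exact ri_swap5_23 ..
  s34 a b c d e := by
    conv_lhs => rw [← h (Equiv.swap 3 4)]
    exact ri_swap5_34 ..

lemma Sym5.fullSym (h : Sym5 α) : FullSym α := FullSym.of_swap fun i => by
  ext v
  obtain ⟨a, b, c, d, e, rfl⟩ := exists_vec5 v
  fin_cases i
  · exact (ri_swap5_01 ..).trans (h.s01 ..).symm
  · exact (ri_swap5_12 ..).trans (h.s12 ..).symm
  · exact (ri_swap5_23 ..).trans (h.s23 ..).symm
  · exact (ri_swap5_34 ..).trans (h.s34 ..).symm

lemma Sym5.pb (h : Sym5 α) (π : V →ₗ[ZMod 2] V) : Sym5 (pb π α) where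
  s01 a b c d e := by rw [pb_vec5, pb_vec5, h.s01]
  s12 a b c d e := by rw [pb_vec5, pb_vec5, h.s12]
  s23 a b c d e := by rw [pb_vec5, pb_vec5, h.s23]
  s34 a b c d e := by rw [pb_vec5, pb_vec5, h.s34]

lemma Sym5.add_two (h : Sym5 α) (hα : ML univ α) (x y c d e : V) :
    α ![x + y, x + y, c, d, e] = α ![x, x, c, d, e] + α ![y, y, c, d, e] := by
  simp only [hα.add5_0, hα.add5_1]
  rw [h.s01 y x]
  grind

lemma Sym5.add_three (h : Sym5 α) (hα : ML univ α) (x y d e : V) :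
    α ![x + y, x + y, x + y, d, e] = α ![x, x, x, d, e] + α ![y, y, y, d, e] +
      (α ![x, x, y, d, e] + α ![x, y, y, d, e]) := by
  rw [h.add_two hα, hα.add5_2, hα.add5_2, h.s12 y y x, h.s01 y x y]
  abel

lemma Sym5.add_four (h : Sym5 α) (hα : ML univ α) (x y e : V) :
    α ![x + y, x + y, x + y, x + y, e] = α ![x, x, x, x, e] + α ![y, y, y, y, e] := by
  have e1 : ∀ u, α ![u, u, x + y, x + y, e] = α ![u, u, x, x, e] + α ![u, u, y, y, e] := fun u => by
    simp only [hα.add5_2, hα.add5_3]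
    rw [h.s23 u u y x]
    grind
  rw [h.add_two hα, e1, e1, h.s12 y y x, h.s01 y x, h.s23 x y y x, h.s12 x y x]
  grind

lemma Sym5.add_five (h : Sym5 α) (hα : ML univ α) (x y : V) :
    α ![x + y, x + y, x + y, x + y, x + y] = α ![x, x, x, x, x] + α ![y, y, y, y, y] +
      (α ![x, x, x, x, y] + α ![y, y, y, y, x]) := by
  rw [h.add_four hα, hα.add5_4, hα.add5_4]
  abel

lemma Sym5.parity (h : Sym5 α) (hα : ML univ α) (p q r d e x y : V) :
    α ![p, q, r, d, e] + α ![p + x, q + x, r + x, d, e] + α ![p + y, q + y, r + y, d, e] +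
      α ![p + (x + y), q + (x + y), r + (x + y), d, e] =
      α ![x, x, y, d, e] + α ![x, y, y, d, e] := by
  have h1 : ∀ x, α ![p + x, q + x, r + x, d, e] = α ![p, q, r, d, e] + (α ![x, q, r, d, e] +
      α ![x, p, r, d, e] + α ![x, p, q, d, e]) + (α ![x, x, p, d, e] + α ![x, x, q, d, e] +
      α ![x, x, r, d, e]) + α ![x, x, x, d, e] := fun x => by
    simp only [hα.add5_0, hα.add5_1, hα.add5_2]
    rw [h.s01 p x, h.s12 p q x, h.s01 p x q, h.s12 x q x, h.s01 p x x, h.s12 x p x]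
    abel
  rw [h1, h1 y, h1 (x + y), h.add_three hα]
  simp only [h.add_two hα, hα.add5_0 x y]
  clear * -
  grind

lemma Sym5.expand (h : Sym5 α) (hα : ML univ α) (p q r d e x : V) :
    α ![p + x, q + x, r + x, d + x, e + x] = α ![p, q, r, d, e] +
      (α ![x, q, r, d, e] + α ![x, p, r, d, e] + α ![x, p, q, d, e] + α ![x, p, q, r, e] +
        α ![x, p, q, r, d]) +
      (α ![x, x, p, q, r] + α ![x, x, p, q, d] + α ![x, x, p, q, e] + α ![x, x, p, r, d] +
        α ![x, x, p, r, e] + α ![x, x, p, d, e] + α ![x, x, q, r, d] + α ![x, x, q, r, e] +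
        α ![x, x, q, d, e] + α ![x, x, r, d, e]) +
      (α ![x, x, x, p, q] + α ![x, x, x, p, r] + α ![x, x, x, p, d] + α ![x, x, x, p, e] +
        α ![x, x, x, q, r] + α ![x, x, x, q, d] + α ![x, x, x, q, e] + α ![x, x, x, r, d] +
        α ![x, x, x, r, e] + α ![x, x, x, d, e]) +
      (α ![x, x, x, x, p] + α ![x, x, x, x, q] + α ![x, x, x, x, r] + α ![x, x, x, x, d] +
        α ![x, x, x, x, e]) + α ![x, x, x, x, x] := by
  simp only [hα.add5_0, hα.add5_1, hα.add5_2, hα.add5_3, hα.add5_4]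
  simp only [h.s01, h.s12, h.s23, h.s34]
  abel

end

end

section

/-- A symmetric form in five variables whose failure of strong symmetry is the symmetrized square
of `b`. -/
structure SquareDefect5 {V : Type} [AddCommGroup V] [Module (ZMod 2) V]
    (α : (Fin 5 → V) → ZMod 2) (b : V →ₗ[ZMod 2] V →ₗ[ZMod 2] ZMod 2) : Prop extends Sym5 α where
  symm : ∀ x y, b x y = b y x
  diag : ∀ x, b x x = 0
  defect : ∀ x y z w, α ![x, x, y, z, w] + α ![x, y, y, z, w] = b x z * b y w + b x w * b y z

section
variable {V : Type} [AddCommGroup V] [Module (ZMod 2) V] {α : (Fin 5 → V) → ZMod 2}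
  {b : V →ₗ[ZMod 2] V →ₗ[ZMod 2] ZMod 2}

lemma SquareDefect5.fourth (h : SquareDefect5 α b) (x y : V) :
    α ![x, x, x, x, y] + α ![y, y, y, y, x] = b x y := by
  have e1 := h.defect x y x x
  have e2 := h.defect x y y y
  have e3 := h.defect x y x y
  have e4 : ∀ a : ZMod 2, a * a = a := by decide
  rw [h.diag, zero_mul, zero_add, h.symm y x, e4] at e3
  simp only [h.diag, zero_mul, mul_zero, add_zero] at e1 e2
  simp only [h.s01, h.s12, h.s23, h.s34] at e1 e2 e3 ⊢
  clear * - e1 e2 e3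
  grind

lemma SquareDefect5.parity_univ (h : SquareDefect5 α b) (hα : ML univ α) (p q r d e x y : V) :
    α ![p, q, r, d, e] + α ![p + x, q + x, r + x, d + x, e + x] +
      α ![p + y, q + y, r + y, d + y, e + y] +
      α ![p + (x + y), q + (x + y), r + (x + y), d + (x + y), e + (x + y)] =
    b x y +
      ((b x p * b y q + b x q * b y p) + (b x p * b y r + b x r * b y p) +
       (b x p * b y d + b x d * b y p) + (b x p * b y e + b x e * b y p) +
       (b x q * b y r + b x r * b y q) + (b x q * b y d + b x d * b y q) +
       (b x q * b y e + b x e * b y q) + (b x r * b y d + b x d * b y r) +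
       (b x r * b y e + b x e * b y r) + (b x d * b y e + b x e * b y d)) := by
  have hS := h.toSym5
  have h3 : ∀ d e, α ![x + y, x + y, x + y, d, e] = α ![x, x, x, d, e] + α ![y, y, y, d, e] +
      (b x d * b y e + b x e * b y d) := fun d e => by rw [hS.add_three hα, h.defect]
  rw [hS.expand hα, hS.expand hα p q r d e y, hS.expand hα p q r d e (x + y), hS.add_five hα,
    h.fourth]
  simp only [hS.add_four hα]
  simp only [h3]
  simp only [hS.add_two hα]
  simp only [hα.add5_0 x y]
  rw [← sub_eq_zero]
  ring_nf
  reduce_mod_char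

end

end

section

lemma exists_kill_diag_family {V : Type} [AddCommGroup V] [Module (ZMod 2) V] : ∀ (M : ℕ)
    (σ : Fin M → V →ₗ[ZMod 2] V →ₗ[ZMod 2] ZMod 2), (∀ i x y, σ i x y = σ i y x) →
    ∃ π, Codim M π ∧ ∀ i x, σ i (π x) (π x) = 0
  | 0, _, _ => ⟨_, Codim.id, fun i => i.elim0⟩
  | M + 1, σ, h => by
    obtain ⟨π, hπ, h0⟩ := exists_kill_diag (h 0)
    obtain ⟨π', hπ', h1⟩ := exists_kill_diag_family M (fun i => (σ i.succ).compl₁₂ π π)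
      fun i x y => h _ _ _
    exact ⟨_, (hπ.comp hπ').mono (by omega), fun i => Fin.cases (fun x => h0 _) (fun i x => h1 i x) i⟩

section
variable {n : ℕ}

/-- The symmetric trilinear form with `polarCubic ρ x x z = ρ z x`. -/
def polarCubic (ρ : (Fin n → ZMod 2) →ₗ[ZMod 2] (Fin n → ZMod 2) →ₗ[ZMod 2] ZMod 2)
    (x y z : Fin n → ZMod 2) : ZMod 2 :=
  ∑ a, (x a * y a * ρ z (Pi.single a 1) + x a * z a * ρ y (Pi.single a 1) +
    y a * z a * ρ x (Pi.single a 1))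

variable (ρ : (Fin n → ZMod 2) →ₗ[ZMod 2] (Fin n → ZMod 2) →ₗ[ZMod 2] ZMod 2)
  (x x' y z : Fin n → ZMod 2)

lemma polarCubic_comm : polarCubic ρ x y z = polarCubic ρ y x z :=
  sum_congr rfl fun a _ => by ring

lemma polarCubic_comm' : polarCubic ρ x y z = polarCubic ρ x z y :=
  sum_congr rfl fun a _ => by ring

lemma polarCubic_add : polarCubic ρ (x + x') y z = polarCubic ρ x y z + polarCubic ρ x' y z := by
  simp only [polarCubic, ← sum_add_distrib, map_add, LinearMap.add_apply, Pi.add_apply]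
  exact sum_congr rfl fun a _ => by ring

lemma polarCubic_self : polarCubic ρ x x z = ρ z x := by
  have : ρ z x = ∑ a, x a * ρ z (Pi.single a 1) := by
    conv_lhs => rw [pi_eq_sum_univ' x, map_sum]
    simp only [map_smul, smul_eq_mul]
  rw [this]
  refine sum_congr rfl fun a _ => ?_
  have e : ∀ p q r : ZMod 2, p * p * q + r + r = p * q := by decide
  exact e ..

lemma ml_polarCubic : ML {2, 3, 4} fun v : Fin 5 → Fin n → ZMod 2 =>
    polarCubic ρ (v 2) (v 3) (v 4) := by
  refine ⟨fun x y h => ?_, fun i hi x u v => ?_⟩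
  · show polarCubic ρ (x 2) (x 3) (x 4) = polarCubic ρ (y 2) (y 3) (y 4)
    rw [h 2 (by simp), h 3 (by simp), h 4 (by simp)]
  · simp only [mem_insert, mem_singleton] at hi
    rcases hi with rfl | rfl | rfl
    · simp [polarCubic_add]
    · simp [polarCubic_comm ρ (x 2), polarCubic_add]
    · have e : ∀ w, polarCubic ρ (x 2) (x 3) w = polarCubic ρ w (x 2) (x 3) := fun w => by
        rw [polarCubic_comm', polarCubic_comm]
      simp [e, polarCubic_add]

lemma pr_mul_polarCubic (σ : (Fin n → ZMod 2) →ₗ[ZMod 2] (Fin n → ZMod 2) →ₗ[ZMod 2] ZMod 2) :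
    PR univ 1 fun v : Fin 5 → Fin n → ZMod 2 => σ (v 0) (v 1) * polarCubic ρ (v 2) (v 3) (v 4) :=
  PR.single' (I := {0, 1}) (J := {2, 3, 4}) (by decide) (by decide) (by decide) (by decide)
    (ml_bilin (by decide) σ) (ml_polarCubic ρ)

/-- One permutation of five indices for each choice of the first two. -/
def pairSort : Fin 10 → Fin 5 → Fin 5 :=
  ![![0, 1, 2, 3, 4], ![0, 2, 1, 3, 4], ![0, 3, 1, 2, 4], ![0, 4, 1, 2, 3], ![1, 2, 0, 3, 4],
    ![1, 3, 0, 2, 4], ![1, 4, 0, 2, 3], ![2, 3, 0, 1, 4], ![2, 4, 0, 1, 3], ![3, 4, 0, 1, 2]]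

/-- A symmetric form in five variables whose restriction to coincident variables is governed by
`σ` and `ρ`. -/
def pairForm (σ ρ : (Fin n → ZMod 2) →ₗ[ZMod 2] (Fin n → ZMod 2) →ₗ[ZMod 2] ZMod 2) :
    (Fin 5 → Fin n → ZMod 2) → ZMod 2 :=
  ∑ j, ri (pairSort j) fun v => σ (v 0) (v 1) * polarCubic ρ (v 2) (v 3) (v 4)

variable (σ : (Fin n → ZMod 2) →ₗ[ZMod 2] (Fin n → ZMod 2) →ₗ[ZMod 2] ZMod 2)

lemma pr_pairForm : PR univ 10 (pairForm σ ρ) :=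
  PR.sum_fin (s := 1) fun j => (pr_mul_polarCubic ρ σ).ri
    ((by decide : ∀ j, (pairSort j).Bijective) j)

lemma pairForm_apply (a b c d e : Fin n → ZMod 2) : pairForm σ ρ ![a, b, c, d, e] =
    σ a b * polarCubic ρ c d e + σ a c * polarCubic ρ b d e + σ a d * polarCubic ρ b c e +
    σ a e * polarCubic ρ b c d + σ b c * polarCubic ρ a d e + σ b d * polarCubic ρ a c e +
    σ b e * polarCubic ρ a c d + σ c d * polarCubic ρ a b e + σ c e * polarCubic ρ a b d +
    σ d e * polarCubic ρ a b c := by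
  have e : ∀ g : Fin 10 → ZMod 2, ∑ j, g j =
      g 0 + g 1 + g 2 + g 3 + g 4 + g 5 + g 6 + g 7 + g 8 + g 9 := fun g => by
    simp only [Fin.sum_univ_castSucc]
    simp
  rw [pairForm, Finset.sum_apply, e]
  rfl

variable {σ}

lemma sym5_pairForm (hσ : ∀ x y, σ x y = σ y x) : Sym5 (pairForm σ ρ) where
  s01 a b c d e := by
    simp only [pairForm_apply]
    rw [hσ b a, polarCubic_comm ρ b a, polarCubic_comm ρ b a, polarCubic_comm ρ b a]
    ring
  s12 a b c d e := by
    simp only [pairForm_apply]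
    rw [hσ c b, polarCubic_comm' ρ a c b, polarCubic_comm ρ c b, polarCubic_comm ρ c b]
    ring
  s23 a b c d e := by
    simp only [pairForm_apply]
    rw [hσ d c, polarCubic_comm' ρ a d c, polarCubic_comm' ρ b d c, polarCubic_comm ρ d c]
    ring
  s34 a b c d e := by
    simp only [pairForm_apply]
    rw [hσ e d, polarCubic_comm' ρ a e d, polarCubic_comm' ρ b e d, polarCubic_comm' ρ c e d]
    ring

lemma pairForm_self (h0 : σ x x = 0) (y z w : Fin n → ZMod 2) : pairForm σ ρ ![x, x, y, z, w] =
    σ y z * ρ w x + σ y w * ρ z x + σ z w * ρ y x := by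
  simp only [pairForm_apply, h0, polarCubic_self]
  grind

end

end

section

lemma exists_squareDefect5 : Step 5 (fun _ α => FullSym α) fun _ α => ∃ b, SquareDefect5 α b := by
  obtain ⟨F, hF, h⟩ := pr_of_bias (univ : Finset (Fin 4)) (by decide)
  let M : ℕ → ℕ := fun s => F s + (F s + F s) + (F s + F s) + (F s + F s)
  refine ⟨fun s => 5 * (F (4 * s) + 3 * (3 * (3 * F (4 * s)) * (3 * (3 * F (4 * s)))) +
    (M (4 * s) + 1)) + M (4 * s) * 10, by fun_prop, fun n s α hα hc hi => ?_⟩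
  have hS := hi.sym5
  let m : (Fin 4 → Fin n → ZMod 2) → ZMod 2 := fun v =>
    α ![v 2, v 2, v 3, v 0, v 1] + α ![v 2, v 3, v 3, v 0, v 1]
  have hmv : ∀ x y z w, m ![x, y, z, w] = α ![z, z, w, x, y] + α ![z, w, w, x, y] :=
    fun _ _ _ _ => rfl
  have hsw : ∀ x y z w, α ![x, y, y, z, w] = α ![y, y, x, z, w] := fun x y z w => by
    rw [hS.s01, hS.s12]
  have hm : ML univ m := by
    refine ml_vec4 ?_ ?_ ?_ ?_
    · intro x x' y z w
      simp only [hmv, hα.add5_3]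
      abel
    · intro x y y' z w
      simp only [hmv, hα.add5_4]
      abel
    · intro x y z z' w
      simp only [hmv, hS.add_two hα, hα.add5_0 z]
      abel
    · intro x y z w w'
      rw [hmv, hmv, hmv, hsw _ (w + w'), hS.add_two hα, hα.add5_2, hsw, hsw]
      abel
  have hp := hc.parity {0, 1, 2}
  simp only [sum_vec5, shiftOn_vec5, hS.parity hα] at hp
  have hb : (Fintype.card (Fin n → ZMod 2) : ℝ) ^ 4 ≤ 2 ^ (4 * s) * ∑ v, sgn (m v) := by
    rw [sum_vec4]
    simp only [hmv]
    simp only [sum_const, card_univ, nsmul_eq_mul] at hp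
    have hV : (0 : ℝ) < Fintype.card (Fin n → ZMod 2) := by exact_mod_cast Fintype.card_pos
    refine le_of_mul_le_mul_left ?_ (pow_pos hV 3)
    calc _ = _ := by ring
      _ ≤ _ := hp
      _ = _ := by ring
  obtain ⟨π, hπ, b, hb, σ, ρ, hσ, e⟩ := exists_coboundary4 (h _ m (4 * s) hm hb) (by
      ext x
      obtain ⟨a, b, c, d, rfl⟩ := exists_vec4 x
      simp only [Pi.add_apply, Pi.zero_apply, ri_swap4_01, hmv, hS.s34 _ _ _ b]
      exact add_self2 _) (by
      ext x
      obtain ⟨a, b, c, d, rfl⟩ := exists_vec4 x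
      simp only [Pi.add_apply, Pi.zero_apply, ri_swap4_23, hmv, hsw]
      grind) (by
      ext x
      obtain ⟨a, b, c, d, rfl⟩ := exists_vec4 x
      simp only [Pi.add_apply, Pi.zero_apply, ri_swap4_12, ri_swap4_13, hmv, hsw]
      simp only [hS.s01, hS.s12, hS.s23, hS.s34]
      grind)
  obtain ⟨π', hπ', hd⟩ := exists_kill_diag_family (M (4 * s) + 1) (Fin.cons b σ) fun i =>
    Fin.cases hb hσ i
  have hdb : ∀ x, b (π' x) (π' x) = 0 := hd 0
  have hdσ : ∀ i x, σ i (π' x) (π' x) = 0 := fun i => hd i.succ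
  let ν := ∑ i, pairForm (σ i) (ρ i)
  have hν : PR univ (M (4 * s) * 10) ν := PR.sum_fin fun i => pr_pairForm (ρ i) (σ i)
  have hνv : ∀ x y z w v, ν ![x, y, z, w, v] = ∑ i, pairForm (σ i) (ρ i) ![x, y, z, w, v] :=
    fun x y z w v => by simp only [ν, Finset.sum_apply]
  have hml : ML univ (pb π α + ν) := (hα.pb π).add hν.ml
  refine ⟨pb π' (pb π α + ν), hml.pb π', ?_, b.compl₁₂ π' π', ?_⟩
  · have h1 := (hπ.comp hπ').pr hα (by norm_num)
    have h2 := h1.add (hν.pb π')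
    rw [add_assoc α] at h2
    exact h2
  · have hν5 : Sym5 ν := by
      constructor <;> intro x y z w v <;> simp only [hνv] <;> refine sum_congr rfl fun i _ => ?_
      · exact (sym5_pairForm (ρ i) (hσ i)).s01 ..
      · exact (sym5_pairForm (ρ i) (hσ i)).s12 ..
      · exact (sym5_pairForm (ρ i) (hσ i)).s23 ..
      · exact (sym5_pairForm (ρ i) (hσ i)).s34 ..
    have hS' : Sym5 (pb π α + ν) := by
      have h1 := hS.pb π
      constructor <;> intro x y z w v <;> simp only [Pi.add_apply]
      · rw [h1.s01, hν5.s01]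
      · rw [h1.s12, hν5.s12]
      · rw [h1.s23, hν5.s23]
      · rw [h1.s34, hν5.s34]
    refine { hS'.pb π' with
      symm := fun x y => hb _ _
      diag := hdb
      defect := fun x y z w => ?_ }
    have e1 := e (π' z) (π' w) (π' x) (π' y)
    rw [hmv] at e1
    simp only [pb_vec5, Pi.add_apply, LinearMap.compl₁₂_apply]
    rw [add_add_add_comm, e1, hν5.s01 (π' x) (π' y), hν5.s12 (π' y) (π' x), hνv, hνv,
      hb (π' z), hb (π' w), hb (π' z), hb (π' w)]
    have : ∀ p q u v : ZMod 2, p = q → u = v → p + u + v = q := by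
      rintro p _ u _ rfl rfl
      rw [add_assoc, add_self2, add_zero]
    refine this _ _ _ _ ?_ ?_
    · ring
    · rw [← sum_add_distrib]
      refine sum_congr rfl fun i _ => ?_
      rw [pairForm_self _ _ (hdσ i x), pairForm_self _ _ (hdσ i y), hσ i (π' z) (π' x),
        hσ i (π' w) (π' x), hσ i (π' z) (π' y), hσ i (π' w) (π' y)]
      ring

end

section

/-- `α` is symmetric and so is its restriction to coincident first variables. -/
def Strong5 {V : Type} (α : (Fin 5 → V) → ZMod 2) : Prop :=
  FullSym α ∧ ∀ x y z w, α ![x, x, y, z, w] = α ![x, y, y, z, w]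

lemma exists_strong5 : Step 5 (fun _ α => ∃ b, SquareDefect5 α b) fun _ α => Strong5 α := by
  obtain ⟨F, hF, h⟩ := exists_kill_bilin ({p | p.1 ≠ p.2} : Finset (Fin 5 × Fin 5))
  refine Step.of_pb (by norm_num) ⟨fun s => F (4 * s), by fun_prop, fun n s α hα hc => ?_⟩
  rintro ⟨b, hb⟩
  have hp := hc.parity univ
  simp only [sum_vec5, shiftOn_univ_vec5, hb.parity_univ hα] at hp
  obtain ⟨π, hπ, h0⟩ := h _ b (4 * s) (by
    rw [sum_vec5]
    convert hp using 14 with p _ q _ r _ d _ e _ x _ y _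
    rw [sum_filter, Fintype.sum_prod_type]
    simp only [Fin.sum_univ_five, Matrix.cons_val]
    simp only [Fin.reduceEq, ne_eq, not_true_eq_false, not_false_eq_true, if_true, if_false]
    ring)
  refine ⟨π, hπ, (hb.toSym5.pb π).fullSym, fun x y z w => ?_⟩
  rw [pb_vec5, pb_vec5]
  refine eq_of_add_eq_zero2 ?_
  rw [hb.defect, h0, h0, h0, h0]
  rfl

end

section

lemma FullSym.symmetricForm {k : ℕ} {V : Type} {α : (Fin k → V) → ZMod 2} (h : FullSym α) :
    SymmetricForm k α := fun π => h π.symm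

lemma Strong4.stronglySymmetric {V : Type} {α : (Fin 4 → V) → ZMod 2} (h : Strong4 α) :
    StronglySymmetric 4 α := by
  refine ⟨h.1.symmetricForm, fun u v z => ?_⟩
  have e : ∀ u v : V, (fun i : Fin 4 => if (i : ℕ) = 0 ∨ (i : ℕ) = 1 then u else
      if (i : ℕ) = 2 then v else z i) = ![u, u, v, z 3] := fun u v => by
    ext i; fin_cases i <;> rfl
  rw [e, e, h.2]
  conv_lhs => rw [← h.1 (Equiv.swap 0 2)]
  exact ri_swap4_02 ..

lemma Strong5.stronglySymmetric {V : Type} {α : (Fin 5 → V) → ZMod 2} (h : Strong5 α) :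
    StronglySymmetric 5 α := by
  refine ⟨h.1.symmetricForm, fun u v z => ?_⟩
  have e : ∀ u v : V, (fun i : Fin 5 => if (i : ℕ) = 0 ∨ (i : ℕ) = 1 then u else
      if (i : ℕ) = 2 then v else z i) = ![u, u, v, z 3, z 4] := fun u v => by
    ext i; fin_cases i <;> rfl
  rw [e, e, h.2]
  conv_lhs => rw [← h.1 (Equiv.swap 0 2)]
  exact ri_swap5_02 ..

lemma Step.imp {k : ℕ} {A B C : ∀ n : ℕ, ((Fin k → Fin n → ZMod 2) → ZMod 2) → Prop}
    (h : Step k A B) (hBC : ∀ n α, B n α → C n α) : Step k A C := by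
  obtain ⟨F, hF, h⟩ := h
  refine ⟨F, hF, fun n s α hα hc hA => ?_⟩
  obtain ⟨α', h1, h2, h3⟩ := h n s α hα hc hA
  exact ⟨α', h1, h2, hBC n α' h3⟩

lemma exists_stronglySymmetric {k : ℕ} (hk : k = 4 ∨ k = 5) :
    Step k (fun _ _ => True) fun _ α => StronglySymmetric k α := by
  rcases hk with rfl | rfl
  · exact ((((exists_swap_invariant4.trans (exists_inv3 (Or.inl rfl))).trans
      exists_squareDefect).trans exists_theta4).trans exists_strong4).imp
      fun _ _ h => h.stronglySymmetric
  · exact (((((exists_swap_invariant5.trans (exists_inv3 (Or.inr rfl))).trans exists_inv4).trans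
      exists_sym5).trans exists_squareDefect5).trans exists_strong5).imp
      fun _ _ h => h.stronglySymmetric

lemma tow_le_exp (t s : ℕ) : (tow t s : ℝ) ≤ Real.exp^[t] (s + 1) := by
  induction t with
  | zero => simp [tow_zero]
  | succ t ih =>
    rw [tow_succ, Function.iterate_succ_apply']
    refine le_trans ?_ (Real.exp_le_exp.2 ih)
    rw [← Real.exp_one_pow]
    push_cast
    exact pow_le_pow_left₀ (by norm_num) (by linarith [Real.add_one_le_exp 1]) _

lemma monotone_iterate_exp (t : ℕ) : Monotone (Real.exp^[t]) :=
  Real.exp_monotone.iterate t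

lemma one_le_iterate_exp (t : ℕ) {x : ℝ} (hx : 0 ≤ x) : 1 ≤ Real.exp^[t + 1] x := by
  induction t with
  | zero => simpa using hx
  | succ t ih =>
    rw [Function.iterate_succ_apply']
    exact Real.one_le_exp (zero_le_one.trans ih)

end

/-- **Quantitative inverse theorem, main structural result (Theorem 4 of the paper).**
For `k ∈ {4,5}`: if `f : 𝔽₂ⁿ → 𝔻` correlates (with density `c`) with the phase
`(-1)^{α(a₁,…,a_k)}` along `k`-fold multiplicative derivatives, then `α` differs from a
strongly symmetric multilinear form by a form of partition rank at most
`C · exp^{(t)}(C · c⁻¹)`. -/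
theorem statement0 (k : ℕ) (hk : k = 4 ∨ k = 5) :
    ∃ (C : ℝ) (t : ℕ), 1 ≤ C ∧
      ∀ (n : ℕ) (f : (Fin n → ZMod 2) → ℂ), (∀ x, ‖f x‖ = 1) →
        ∀ (α : (Fin k → (Fin n → ZMod 2)) → ZMod 2), IsMultilinear k α →
          ∀ c : ℝ, 0 < c →
            c ≤ ‖(∑ x : Fin n → ZMod 2, ∑ a : Fin k → Fin n → ZMod 2,
                    mderIter k f a x * chF2 (α a)) /
                  ((Fintype.card (Fin n → ZMod 2) : ℂ)) ^ (k + 1)‖ →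
            ∃ σ : (Fin k → (Fin n → ZMod 2)) → ZMod 2,
              IsMultilinear k σ ∧ StronglySymmetric k σ ∧
              (prank k (α + σ) : ℝ) ≤ C * Real.exp^[t] (C * c⁻¹) := by
  obtain ⟨F, ⟨t, hF⟩, h⟩ := exists_stronglySymmetric hk
  have ht : (0 : ℝ) ≤ tow (t + 1) 1 := Nat.cast_nonneg _
  refine ⟨3 + tow (t + 1) 1, t + 1, by linarith, fun n f hf α hα c hc hcorr => ?_⟩
  have hc' : 0 < c⁻¹ := inv_pos.2 hc
  have hV : (0 : ℝ) < Fintype.card (Fin n → ZMod 2) := by exact_mod_cast Fintype.card_pos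
  set s := ⌈c⁻¹⌉₊ with hs
  have hcs : c⁻¹ ≤ 2 ^ s := (Nat.le_ceil _).trans (by exact_mod_cast Nat.lt_two_pow_self.le)
  have hα' : Corr s α := by
    refine ⟨f, hf, ?_⟩
    rw [norm_div, norm_pow, Complex.norm_natCast, le_div_iff₀ (pow_pos hV _)] at hcorr
    refine le_trans ?_ (mul_le_mul_of_nonneg_right hcs (norm_nonneg _))
    rwa [← div_eq_inv_mul, le_div_iff₀ hc, mul_comm]
  obtain ⟨σ, hσ, hp, hS⟩ := h n s α hα hα' trivial
  refine ⟨σ, hσ, hS, ?_⟩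
  have hle : (prank k (α + σ) : ℝ) ≤ tow (t + 1) s := by
    exact_mod_cast (hp.prank_le.trans (hF s)).trans (tow_mono_left (Nat.le_succ t) s)
  have hC : 0 ≤ (3 + tow (t + 1) 1) * c⁻¹ := by positivity
  have h1 := one_le_iterate_exp t hC
  refine hle.trans ?_
  rcases le_total c 1 with hc1 | hc1
  · have h2 : (s : ℝ) + 1 ≤ (3 + tow (t + 1) 1) * c⁻¹ := by
      have := Nat.ceil_lt_add_one hc'.le
      have := (one_le_inv₀ hc).2 hc1
      nlinarith
    calc _ ≤ Real.exp^[t + 1] (s + 1) := tow_le_exp _ _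
      _ ≤ Real.exp^[t + 1] ((3 + tow (t + 1) 1) * c⁻¹) := monotone_iterate_exp _ h2
      _ ≤ _ := le_mul_of_one_le_left (zero_le_one.trans h1) (by linarith)
  · have h2 : s ≤ 1 := Nat.ceil_le.2 (by simpa using inv_le_one_of_one_le₀ hc1)
    calc (tow (t + 1) s : ℝ) ≤ tow (t + 1) 1 := by exact_mod_cast tow_mono _ h2
      _ ≤ 3 + tow (t + 1) 1 := by linarith
      _ ≤ _ := le_mul_of_one_le_right (by linarith) h1
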